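/- arXiv:1507.04917 — 3 statements merged into one kernel-verified Lean document; each statement's English description precedes it below -/
import Mathlib

section
/- Let 𝐬 be any composition of positive integers, with v-dual 𝐬^∨ as in the context. Then for all sufficiently large primes p: −H^⋆_{p−1}(𝐬^∨) ≡ H^⋆_{p−1}(𝐬) + p · Σ_{𝐭 ⪯ 𝐬} H_{p−1}((1,𝐭)) (mod p²), where (1,𝐭) denotes the composition obtained by prepending 1 to 𝐭 and the sum is over all compositions 𝐭 ⪯ 𝐬. -/
open scoped BigOperators

/-- Alternating multiple harmonic sum `H_n(𝐬)` where `𝐬` is a list of pairs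
`(sⱼ, εⱼ)` (exponent, sign):
`H_n(𝐬) = Σ_{n ≥ k₁ > ⋯ > k_d ≥ 1} Π εⱼ^{kⱼ} / kⱼ^{sⱼ}`. -/
def AMHS : ℕ → List (ℕ × ℚ) → ℚ
  | _, [] => 1
  | n, (s, ε) :: t => ∑ k ∈ Finset.Icc 1 n, ε ^ k / (k : ℚ) ^ s * AMHS (k - 1) t

/-- Alternating multiple harmonic star sum `H⋆_n(𝐬)` (indices weakly decreasing). -/
def AMHSstar : ℕ → List (ℕ × ℚ) → ℚ
  | _, [] => 1
  | n, (s, ε) :: t => ∑ k ∈ Finset.Icc 1 n, ε ^ k / (k : ℚ) ^ s * AMHSstar k t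

/-- A list of pairs is a signed composition: positive exponents, signs `±1`. -/
def IsSignedComp (l : List (ℕ × ℚ)) : Prop := ∀ x ∈ l, 0 < x.1 ∧ (x.2 = 1 ∨ x.2 = -1)

/-- `a ≡ b (mod p^ℓ)` for rationals: the `p`-adic valuation of `a - b` is at least `ℓ`. -/
def RatModEq (p ℓ : ℕ) (a b : ℚ) : Prop := a = b ∨ (ℓ : ℤ) ≤ padicValRat p (a - b)

/-- View a composition of positive integers as a signed composition with all signs `+1`. -/
def posComp (l : List ℕ) : List (ℕ × ℚ) := l.map (fun s => (s, 1))

/-- The composition `𝐬 = (r₁, {1}^{t₁-1}, r₂+1, {1}^{t₂-1}, …, r_ℓ+1, {1}^{t_ℓ-1})`.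
Every composition of positive integers arises uniquely in this form. -/
def vComp (ℓ : ℕ) (r t : ℕ → ℕ) : List ℕ :=
  (List.range ℓ).flatMap
    (fun j => (if j = 0 then r 0 else r j + 1) :: List.replicate (t j - 1) 1)

/-- The v-dual `𝐬^∨ = ({1}^{r₁-1}, t₁+1, {1}^{r₂-1}, t₂+1, …, t_{ℓ-1}+1, {1}^{r_ℓ-1}, t_ℓ)`. -/
def vDual (ℓ : ℕ) (r t : ℕ → ℕ) : List ℕ :=
  (List.range ℓ).flatMap
    (fun j => List.replicate (r j - 1) 1 ++ [if j = ℓ - 1 then t j else t j + 1])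

/-- All coarsenings `𝐭 ⪯ 𝐬` of a signed composition `𝐬`: partition `𝐬` into
consecutive nonempty blocks and replace each block by the `⊕`-sum of its entries. -/
def coarsenings : List (ℕ × ℚ) → List (List (ℕ × ℚ))
  | [] => [[]]
  | a :: s => (coarsenings s).flatMap (fun t =>
      match t with
      | [] => [[a]]
      | b :: t' => [a :: b :: t', (a.1 + b.1, a.2 * b.2) :: t'])

def vdTr (a : ℕ → ℚ) (n : ℕ) : ℚ :=
  ∑ k ∈ Finset.range n, (-1 : ℚ) ^ k * (n.choose (k + 1) : ℚ) * a (k + 1)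

def vdSg (a : ℕ → ℚ) (n : ℕ) : ℚ := ∑ k ∈ Finset.range n, a (k + 1)

def vdF : List ℕ → ℕ → ℚ
  | [], _ => 0
  | s :: t, n => 1 / (n : ℚ) ^ s * AMHSstar n (posComp t)

theorem vd_sum_Icc (g : ℕ → ℚ) (n : ℕ) :
    ∑ k ∈ Finset.Icc 1 n, g k = ∑ k ∈ Finset.range n, g (k + 1) := by
  induction n with
  | zero => simp
  | succ n ih => rw [Finset.sum_Icc_succ_top (by omega), ih, Finset.sum_range_succ]

theorem vd_star_cons (n s : ℕ) (t : List ℕ) :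
    AMHSstar n (posComp (s :: t)) = vdSg (vdF (s :: t)) n := by
  simp only [posComp, List.map_cons, AMHSstar, vdSg, vdF, one_pow]
  rw [vd_sum_Icc]

theorem vd_pascal (a : ℕ → ℚ) (n : ℕ) :
    vdTr a (n + 1) = vdTr a n +
      ∑ k ∈ Finset.range (n + 1), (-1 : ℚ) ^ k * (n.choose k : ℚ) * a (k + 1) := by
  have h : vdTr a n =
      ∑ k ∈ Finset.range (n + 1), (-1 : ℚ) ^ k * (n.choose (k + 1) : ℚ) * a (k + 1) := by
    rw [Finset.sum_range_succ, vdTr]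
    simp
  rw [h, vdTr, ← Finset.sum_add_distrib]
  refine Finset.sum_congr rfl fun k _ => ?_
  rw [Nat.choose_succ_succ]
  push_cast
  ring

theorem vd_TD (a : ℕ → ℚ) (n : ℕ) :
    vdTr (fun m => 1 / (m : ℚ) * a m) n = vdSg (fun m => 1 / (m : ℚ) * vdTr a m) n := by
  induction n with
  | zero => simp [vdTr, vdSg]
  | succ n ih =>
    rw [vd_pascal, ih]
    have hS : ∀ g : ℕ → ℚ, vdSg g (n + 1) = vdSg g n + g (n + 1) := fun g =>
      Finset.sum_range_succ _ _
    rw [hS]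
    congr 1
    simp only [vdTr]
    rw [Finset.mul_sum]
    refine Finset.sum_congr rfl fun k _ => ?_
    have h : ((n + 1 : ℕ) : ℚ) * (n.choose k : ℚ) = ((n + 1).choose (k + 1) : ℚ) * ((k + 1 : ℕ) : ℚ) := by
      exact_mod_cast Nat.add_one_mul_choose_eq n k
    have h1 : ((n + 1 : ℕ) : ℚ) ≠ 0 := by positivity
    have h2 : ((k + 1 : ℕ) : ℚ) ≠ 0 := by positivity
    generalize ((n + 1 : ℕ) : ℚ) = N at *
    generalize ((k + 1 : ℕ) : ℚ) = K at *
    field_simp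
    linear_combination (a (k + 1)) * h

theorem vd_TS (a : ℕ → ℚ) (n : ℕ) :
    vdTr (vdSg a) (n + 1) =
      ∑ k ∈ Finset.range (n + 1), (-1 : ℚ) ^ k * (n.choose k : ℚ) * a (k + 1) := by
  rw [vd_pascal]
  have h : vdTr (vdSg a) n =
      - ∑ k ∈ Finset.range (n + 1), (-1 : ℚ) ^ k * (n.choose k : ℚ) * vdSg a k := by
    rw [Finset.sum_range_succ', vdTr]
    simp only [vdSg, Finset.range_zero, Finset.sum_empty, mul_zero, add_zero, pow_succ]
    rw [← Finset.sum_neg_distrib]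
    refine Finset.sum_congr rfl fun k _ => ?_
    ring
  rw [h, neg_add_eq_sub, ← Finset.sum_sub_distrib]
  refine Finset.sum_congr rfl fun k _ => ?_
  simp only [vdSg]
  rw [Finset.sum_range_succ]
  ring

inductive VDual : List ℕ → List ℕ → Prop
  | base : VDual [1] [1]
  | up (a b : ℕ) (s s' : List ℕ) : VDual (a :: s) (b :: s') →
      VDual ((a + 1) :: s) (1 :: b :: s')
  | pre (a b : ℕ) (s s' : List ℕ) : VDual (a :: s) (b :: s') →
      VDual (1 :: a :: s) ((b + 1) :: s')

theorem vdF_succ (a : ℕ) (s : List ℕ) :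
    vdF ((a + 1) :: s) = fun m : ℕ => 1 / (m : ℚ) * vdF (a :: s) m := by
  funext m
  simp only [vdF, pow_succ, one_div, mul_inv]
  ring

theorem vdF_one (a : ℕ) (s : List ℕ) :
    vdF (1 :: a :: s) = fun m : ℕ => 1 / (m : ℚ) * vdSg (vdF (a :: s)) m := by
  funext m
  simp only [vdF, pow_one, vd_star_cons]

theorem vdSg_congr (a b : ℕ → ℚ) (h : ∀ n, a (n + 1) = b (n + 1)) (n : ℕ) :
    vdSg a n = vdSg b n := Finset.sum_congr rfl fun k _ => h k

theorem VDual.main {s s' : List ℕ} (h : VDual s s') (n : ℕ) :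
    vdTr (vdF s) n = vdSg (vdF s') n := by
  induction h generalizing n with
  | base =>
    have e : vdF [1] = fun m : ℕ => 1 / (m : ℚ) * (fun _ => (1 : ℚ)) m := by
      funext m; simp [vdF, posComp, AMHSstar]
    rw [e, vd_TD]
    apply vdSg_congr
    intro m
    have h0 : vdTr (fun _ => (1 : ℚ)) (m + 1) = 1 := by
      have h2 : (fun k => if k = 1 then (1 : ℚ) else 0) = fun k => if k = 1 then (1 : ℚ) else 0 := rfl
      have h1 := vd_TS (fun k => if k = 1 then (1 : ℚ) else 0) m
      have h3 : vdTr (vdSg (fun k => if k = 1 then (1 : ℚ) else 0)) (m + 1)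
          = vdTr (fun _ => (1 : ℚ)) (m + 1) := by
        refine Finset.sum_congr rfl fun k _ => ?_
        simp [vdSg]
      rw [← h3, h1, Finset.sum_range_succ']
      simp
    rw [h0]
  | up a b s s' _ ih =>
    rw [vdF_succ, vd_TD, vdF_one]
    apply vdSg_congr
    intro m
    rw [ih]
  | pre a b s s' _ ih =>
    rw [vdF_one, vd_TD, vdF_succ]
    apply vdSg_congr
    intro m
    have h1 := vd_pascal (vdF (a :: s)) m
    rw [← vd_TS, ih, ih, vdSg, Finset.sum_range_succ] at h1
    have h2 : vdF (b :: s') (m + 1) = vdTr (vdSg (vdF (a :: s))) (m + 1) := by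
      unfold vdSg at h1 ⊢
      linarith
    rw [h2]

theorem VDual.upN {a b : ℕ} {s s' : List ℕ} (h : VDual (a :: s) (b :: s')) (m : ℕ) :
    VDual ((a + m) :: s) (List.replicate m 1 ++ b :: s') := by
  induction m with
  | zero => simpa using h
  | succ m ih =>
    rw [List.replicate_succ, List.cons_append]
    cases m with
    | zero => exact VDual.up _ _ _ _ h
    | succ m =>
      rw [List.replicate_succ, List.cons_append] at ih ⊢
      exact VDual.up _ _ _ _ ih

theorem VDual.preN {a b : ℕ} {s s' : List ℕ} (h : VDual (a :: s) (b :: s')) (m : ℕ) :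
    VDual (List.replicate m 1 ++ a :: s) ((b + m) :: s') := by
  induction m with
  | zero => simpa using h
  | succ m ih =>
    rw [List.replicate_succ, List.cons_append]
    cases m with
    | zero => exact VDual.pre _ _ _ _ h
    | succ m =>
      rw [List.replicate_succ, List.cons_append] at ih ⊢
      exact VDual.pre _ _ _ _ ih

theorem vComp_one (r t : ℕ → ℕ) : vComp 1 r t = r 0 :: List.replicate (t 0 - 1) 1 := by
  simp [vComp]

theorem vDual_one (r t : ℕ → ℕ) : vDual 1 r t = List.replicate (r 0 - 1) 1 ++ [t 0] := by
  simp [vDual]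

theorem vDual_succ (ℓ : ℕ) (hℓ : 0 < ℓ) (r t : ℕ → ℕ) : vDual (ℓ + 1) r t =
    List.replicate (r 0 - 1) 1 ++ (t 0 + 1) ::
      vDual ℓ (fun j => r (j + 1)) (fun j => t (j + 1)) := by
  have e : ∀ j, (j + 1 = ℓ) = (j = ℓ - 1) := fun j => by
    apply propext; omega
  have e0 : ¬ (0 = ℓ) := by omega
  simp only [vDual, List.range_succ_eq_map, List.flatMap_cons, List.flatMap_map,
    Nat.add_sub_cancel, Nat.succ_eq_add_one, e, e0, if_false, List.append_assoc,
    List.cons_append, List.nil_append]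

theorem vComp_tail (ℓ : ℕ) (r t : ℕ → ℕ) : vComp (ℓ + 1) r t =
    r 0 :: (List.replicate (t 0 - 1) 1 ++
      (List.range ℓ).flatMap
        (fun j => (r (j + 1) + 1) :: List.replicate (t (j + 1) - 1) 1)) := by
  simp only [vComp, List.range_succ_eq_map, List.flatMap_cons, List.flatMap_map,
    Nat.succ_eq_add_one, if_true, List.cons_append]
  simp

theorem VDual.ne_nil {s s' : List ℕ} (h : VDual s s') : s' ≠ [] := by
  cases h <;> simp

theorem VDual.comp (ℓ : ℕ) : ∀ (r t : ℕ → ℕ)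
    (_ : ∀ i < ℓ + 1, 0 < r i) (_ : ∀ i < ℓ + 1, 0 < t i),
    VDual (vComp (ℓ + 1) r t) (vDual (ℓ + 1) r t) := by
  induction ℓ with
  | zero =>
    intro r t hr ht
    obtain ⟨R, hR⟩ : ∃ R, r 0 = 1 + R := ⟨r 0 - 1, by have := hr 0 (by omega); omega⟩
    obtain ⟨U, hU⟩ : ∃ U, t 0 = 1 + U := ⟨t 0 - 1, by have := ht 0 (by omega); omega⟩
    rw [zero_add, vComp_one, vDual_one, hR, hU]
    simp only [Nat.add_sub_cancel_left]
    have h := VDual.base.preN U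
    have e : List.replicate U 1 ++ [1] = 1 :: List.replicate U 1 := by
      rw [← List.replicate_succ', List.replicate_succ]
    rw [e] at h
    exact h.upN R
  | succ ℓ ih =>
    intro r t hr ht
    obtain ⟨R, hR⟩ : ∃ R, r 0 = 1 + R := ⟨r 0 - 1, by have := hr 0 (by omega); omega⟩
    obtain ⟨U, hU⟩ : ∃ U, t 0 = 1 + U := ⟨t 0 - 1, by have := ht 0 (by omega); omega⟩
    have h := ih (fun j => r (j + 1)) (fun j => t (j + 1))
      (fun i hi => hr _ (by omega)) (fun i hi => ht _ (by omega))
    rw [vDual_succ _ (by omega), vComp_tail, hR, hU]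
    rw [vComp_tail] at h
    rw [List.range_succ_eq_map, List.flatMap_cons, List.flatMap_map]
    simp only [Nat.add_sub_cancel_left, Nat.succ_eq_add_one, zero_add] at h ⊢
    generalize vDual (ℓ + 1) (fun j => r (j + 1)) (fun j => t (j + 1)) = d at h ⊢
    cases d with
    | nil => exact absurd rfl h.ne_nil
    | cons b d =>
      have h2 := (VDual.up _ _ _ _ h).preN (U + 1)
      rw [List.replicate_succ, List.cons_append] at h2
      have h3 := h2.upN R
      rw [show 1 + (U + 1) = 1 + U + 1 by ring] at h3
      simpa using h3

/-! coarsenings -/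

theorem vd_map_sum_congr_aux (L : List (List (ℕ × ℚ))) (g : List (ℕ × ℚ) → List (List (ℕ × ℚ)))
    (F : List (ℕ × ℚ) → ℚ) :
    ((L.flatMap g).map F).sum = (L.map fun t => ((g t).map F).sum).sum := by
  induction L with
  | nil => simp
  | cons x L ih => simp [ih]

theorem vd_list_sum_comm (L : List (List (ℕ × ℚ))) (n : ℕ) (c : ℕ → ℚ)
    (F : ℕ → List (ℕ × ℚ) → ℚ) :
    (L.map fun u => ∑ k ∈ Finset.Icc 1 n, c k * F k u).sum =
      ∑ k ∈ Finset.Icc 1 n, c k * (L.map (F k)).sum := by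
  induction L with
  | nil => simp
  | cons x L ih => simp [ih, mul_add, Finset.sum_add_distrib]

theorem vd_coarse_step (n : ℕ) (s : ℕ) (ε : ℚ) (t : List (ℕ × ℚ)) :
    ((match t with
      | [] => [[(s, ε)]]
      | b :: t' => [(s, ε) :: b :: t', ((s, ε).1 + b.1, (s, ε).2 * b.2) :: t']).map (AMHS n)).sum
    = ∑ k ∈ Finset.Icc 1 n, ε ^ k / (k : ℚ) ^ s * AMHS k t := by
  cases t with
  | nil => simp [AMHS]
  | cons b t' =>
    obtain ⟨b1, b2⟩ := b
    simp only [List.map_cons, List.map_nil, List.sum_cons, List.sum_nil, add_zero]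
    rw [AMHS, AMHS, ← Finset.sum_add_distrib]
    refine Finset.sum_congr rfl fun k hk => ?_
    have hk1 : 1 ≤ k := (Finset.mem_Icc.mp hk).1
    obtain ⟨m, rfl⟩ : ∃ m, k = m + 1 := ⟨k - 1, by omega⟩
    rw [AMHS, AMHS, Finset.sum_Icc_succ_top (by omega)]
    simp only [Nat.add_sub_cancel]
    rw [pow_add _ s b1, mul_pow, mul_add]
    congr 1
    rw [mul_div_mul_comm]
    ring

theorem vd_coarse (s : List (ℕ × ℚ)) (n : ℕ) :
    ((coarsenings s).map (AMHS n)).sum = AMHSstar n s := by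
  induction s generalizing n with
  | nil => simp [coarsenings, AMHS, AMHSstar]
  | cons a s ih =>
    obtain ⟨s1, ε⟩ := a
    rw [coarsenings, vd_map_sum_congr_aux]
    simp only [vd_coarse_step]
    rw [vd_list_sum_comm _ n (fun k => ε ^ k / (k : ℚ) ^ s1) (fun k u => AMHS k u), AMHSstar]
    refine Finset.sum_congr rfl fun k _ => ?_
    rw [← ih k]

theorem vd_coarse_one (s : List (ℕ × ℚ)) (n : ℕ) :
    ((coarsenings s).map (fun u => AMHS n ((1, (1 : ℚ)) :: u))).sum =
      ∑ k ∈ Finset.range n, 1 / ((k + 1 : ℕ) : ℚ) * AMHSstar k s := by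
  have : (fun u => AMHS n ((1, (1 : ℚ)) :: u)) =
    fun u => ∑ k ∈ Finset.Icc 1 n, (1 / (k : ℚ)) * (fun k u => AMHS (k - 1) u) k u := by
    funext u
    simp [AMHS]
  rw [this, vd_list_sum_comm, vd_sum_Icc]
  refine Finset.sum_congr rfl fun k _ => ?_
  simp only [Nat.add_sub_cancel]
  rw [← vd_coarse s k]

/-! p-integrality -/

noncomputable def vdR (p : ℕ) [Fact p.Prime] : Subring ℚ := (PadicInt.subring p).comap (Rat.castHom ℚ_[p])

theorem vdR_inv (p : ℕ) [hp : Fact p.Prime] (k : ℕ) (h : k < p) : 1 / (k : ℚ) ∈ vdR p := by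
  rcases Nat.eq_zero_or_pos k with rfl | h0
  · simpa using (vdR p).zero_mem
  have hk : ‖(k : ℚ_[p])‖ = 1 := by
    rw [Padic.norm_natCast_eq_one_iff]
    exact (Nat.Prime.coprime_iff_not_dvd hp.out).2 (Nat.not_dvd_of_pos_of_lt h0 h)
  show ((1 / (k : ℚ) : ℚ) : ℚ_[p]) ∈ PadicInt.subring p
  rw [PadicInt.mem_subring_iff]
  push_cast
  simp [hk]

theorem vdR_star (p : ℕ) [hp : Fact p.Prime] (s : List ℕ) (n : ℕ) (h : n < p) :
    AMHSstar n (posComp s) ∈ vdR p := by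
  induction s generalizing n with
  | nil => simpa [posComp, AMHSstar] using (vdR p).one_mem
  | cons a s ih =>
    rw [vd_star_cons]
    refine (vdR p).sum_mem fun k hk => ?_
    have hk := Finset.mem_range.mp hk
    rw [vdF, ← one_div_pow]
    exact (vdR p).mul_mem ((vdR p).pow_mem (vdR_inv p _ (by omega)) _) (ih _ (by omega))

theorem vdR_F (p : ℕ) [hp : Fact p.Prime] (s : List ℕ) (n : ℕ) (h : n < p) :
    vdF s n ∈ vdR p := by
  cases s with
  | nil => exact (vdR p).zero_mem
  | cons a s =>
    rw [vdF, ← one_div_pow]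
    exact (vdR p).mul_mem ((vdR p).pow_mem (vdR_inv p _ h) _) (vdR_star p s n h)

theorem vdR_modEq (p : ℕ) [hp : Fact p.Prime] (a b x : ℚ) (hx : x ∈ vdR p)
    (h : a - b = (p : ℚ) ^ 2 * x) : RatModEq p 2 a b := by
  by_cases h0 : x = 0
  · left
    rw [h0, mul_zero] at h
    linarith
  right
  have hp0 : (p : ℚ) ≠ 0 := by exact_mod_cast hp.out.ne_zero
  rw [h, padicValRat.mul (pow_ne_zero _ hp0) h0, padicValRat.pow, padicValRat.self hp.out.one_lt]
  have hx' : ‖((x : ℚ) : ℚ_[p])‖ ≤ 1 := hx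
  have h1 : 0 ≤ padicValRat p x := by
    rw [Padic.eq_padicNorm] at hx'
    have h2 : padicNorm p x ≤ 1 := by exact_mod_cast hx'
    rw [padicNorm.eq_zpow_of_nonzero h0] at h2
    by_contra hneg
    push Not at hneg
    have h3 : (1 : ℚ) < (p : ℚ) ^ (-padicValRat p x) :=
      one_lt_zpow₀ (by exact_mod_cast hp.out.one_lt) (by omega)
    linarith
  push_cast
  omega

def vdH (k : ℕ) : ℚ := ∑ j ∈ Finset.range k, 1 / ((j + 1 : ℕ) : ℚ)

theorem vdR_H (p : ℕ) [hp : Fact p.Prime] (n : ℕ) (h : n < p) : vdH n ∈ vdR p :=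
  (vdR p).sum_mem fun k hk => vdR_inv p _ (by have := Finset.mem_range.mp hk; omega)

theorem vd_choose (p : ℕ) [hp : Fact p.Prime] (k : ℕ) (h : k < p) :
    ∃ x ∈ vdR p, (-1 : ℚ) ^ k * ((p - 1).choose k : ℚ) = 1 - p * vdH k + (p : ℚ) ^ 2 * x := by
  induction k with
  | zero => exact ⟨0, (vdR p).zero_mem, by simp [vdH]⟩
  | succ k ih =>
    obtain ⟨x, hx, e⟩ := ih (by omega)
    have hi := vdR_inv p (k + 1) h
    refine ⟨vdH k * (1 / ((k + 1 : ℕ) : ℚ)) + x * (1 - p * (1 / ((k + 1 : ℕ) : ℚ))), ?_, ?_⟩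
    · refine (vdR p).add_mem ((vdR p).mul_mem (vdR_H p k (by omega)) hi)
        ((vdR p).mul_mem hx ((vdR p).sub_mem (vdR p).one_mem
          ((vdR p).mul_mem (natCast_mem _ _) hi)))
    · have hc : ((p - 1).choose (k + 1) : ℚ) * ((k + 1 : ℕ) : ℚ) =
          ((p - 1).choose k : ℚ) * ((p : ℚ) - ((k + 1 : ℕ) : ℚ)) := by
        have := Nat.choose_succ_right_eq (p - 1) k
        have h2 : (p : ℚ) - ((k + 1 : ℕ) : ℚ) = ((p - 1 - k : ℕ) : ℚ) := by
          rw [← Nat.cast_sub (by omega)]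
          congr 1
          omega
        rw [h2]
        exact_mod_cast this
      have hK : ((k + 1 : ℕ) : ℚ) ≠ 0 := by positivity
      have hH : vdH (k + 1) = vdH k + 1 / ((k + 1 : ℕ) : ℚ) := Finset.sum_range_succ _ _
      have hc' : ((p - 1).choose (k + 1) : ℚ) = ((p - 1).choose k : ℚ) *
          (p * (1 / ((k + 1 : ℕ) : ℚ)) - 1) := by
        generalize ((k + 1 : ℕ) : ℚ) = K at *
        field_simp
        linarith
      rw [hH, hc', pow_succ]
      generalize 1 / ((k + 1 : ℕ) : ℚ) = K at *
      linear_combination (1 - p * K) * e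

theorem vd_wol (p : ℕ) [hp : Fact p.Prime] (h : 2 < p) :
    ∃ x ∈ vdR p, vdH (p - 1) = p * x := by
  refine ⟨(1 / ((2 : ℕ) : ℚ)) * ∑ j ∈ Finset.range (p - 1),
    1 / ((j + 1 : ℕ) : ℚ) * (1 / ((p - 1 - 1 - j + 1 : ℕ) : ℚ)), ?_, ?_⟩
  · refine (vdR p).mul_mem (vdR_inv p 2 h) ((vdR p).sum_mem fun k hk => ?_)
    have := Finset.mem_range.mp hk
    exact (vdR p).mul_mem (vdR_inv p _ (by omega)) (vdR_inv p _ (by omega))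
  · have h1 : vdH (p - 1) = ∑ j ∈ Finset.range (p - 1), 1 / ((p - 1 - 1 - j + 1 : ℕ) : ℚ) :=
      (Finset.sum_range_reflect (fun j => 1 / ((j + 1 : ℕ) : ℚ)) (p - 1)).symm
    have h2 : vdH (p - 1) + vdH (p - 1) = p * ∑ j ∈ Finset.range (p - 1),
        1 / ((j + 1 : ℕ) : ℚ) * (1 / ((p - 1 - 1 - j + 1 : ℕ) : ℚ)) := by
      nth_rewrite 1 [h1]
      rw [vdH, ← Finset.sum_add_distrib, Finset.mul_sum]
      refine Finset.sum_congr rfl fun k hk => ?_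
      have := Finset.mem_range.mp hk
      have e : (p : ℚ) = ((k + 1 : ℕ) : ℚ) + ((p - 1 - 1 - k + 1 : ℕ) : ℚ) := by
        rw [← Nat.cast_add]
        congr 1
        omega
      rw [e]
      have hK : ((k + 1 : ℕ) : ℚ) ≠ 0 := by positivity
      have hL : ((p - 1 - 1 - k + 1 : ℕ) : ℚ) ≠ 0 := by positivity
      generalize ((k + 1 : ℕ) : ℚ) = K at *
      generalize ((p - 1 - 1 - k + 1 : ℕ) : ℚ) = L at *
      field_simp
    push_cast at h2 ⊢
    linarith

theorem vd_parts (f : ℕ → ℚ) (n : ℕ) :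
    ∑ k ∈ Finset.range n, 1 / ((k + 1 : ℕ) : ℚ) * vdSg f k +
      ∑ k ∈ Finset.range n, vdH (k + 1) * f (k + 1) = vdH n * vdSg f n := by
  induction n with
  | zero => simp [vdH]
  | succ n ih =>
    have hH : vdH (n + 1) = vdH n + 1 / ((n + 1 : ℕ) : ℚ) := Finset.sum_range_succ _ _
    have hS : vdSg f (n + 1) = vdSg f n + f (n + 1) := Finset.sum_range_succ _ _
    rw [Finset.sum_range_succ, Finset.sum_range_succ, hS, hH]
    rw [hH] at *
    linear_combination ih

theorem vd_final (p : ℕ) [hp : Fact p.Prime] (h : 2 < p) (a b : ℕ) (s s' : List ℕ)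
    (hd : VDual (a :: s) (b :: s')) :
    RatModEq p 2 (-(AMHSstar (p - 1) (posComp (b :: s'))))
        (AMHSstar (p - 1) (posComp (a :: s)) +
          (p : ℚ) * ((coarsenings (posComp (a :: s))).map
            (fun u => AMHS (p - 1) ((1, (1 : ℚ)) :: u))).sum) := by
  have hc : ∀ k, ∃ x, k + 1 < p → x ∈ vdR p ∧
      (-1 : ℚ) ^ (k + 1) * ((p - 1).choose (k + 1) : ℚ) =
        1 - p * vdH (k + 1) + (p : ℚ) ^ 2 * x := by
    intro k
    by_cases hk : k + 1 < p
    · obtain ⟨x, h1, h2⟩ := vd_choose p (k + 1) hk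
      exact ⟨x, fun _ => ⟨h1, h2⟩⟩
    · exact ⟨0, fun h => absurd h hk⟩
  choose x hx using hc
  obtain ⟨y, hy, hyH⟩ := vd_wol p h
  set f := vdF (a :: s) with hf
  have hT : vdTr f (p - 1) = -vdSg f (p - 1)
      + p * ∑ k ∈ Finset.range (p - 1), vdH (k + 1) * f (k + 1)
      - (p : ℚ) ^ 2 * ∑ k ∈ Finset.range (p - 1), x k * f (k + 1) := by
    rw [vdTr, vdSg, Finset.mul_sum, Finset.mul_sum, ← Finset.sum_neg_distrib,
      ← Finset.sum_add_distrib, ← Finset.sum_sub_distrib]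
    refine Finset.sum_congr rfl fun k hk => ?_
    have := Finset.mem_range.mp hk
    have e := (hx k (by omega)).2
    rw [pow_succ] at e
    linear_combination (-f (k + 1)) * e
  have hparts := vd_parts f (p - 1)
  have hmain := hd.main (p - 1)
  rw [← hf] at hmain
  refine vdR_modEq p _ _ (∑ k ∈ Finset.range (p - 1), x k * f (k + 1) - y * vdSg f (p - 1)) ?_ ?_
  · refine (vdR p).sub_mem ((vdR p).sum_mem fun k hk => ?_) ((vdR p).mul_mem hy ?_)
    · have := Finset.mem_range.mp hk
      exact (vdR p).mul_mem (hx k (by omega)).1 (vdR_F p _ _ (by omega))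
    · rw [hf, ← vd_star_cons]
      exact vdR_star p _ _ (by omega)
  · rw [vd_coarse_one]
    simp only [vd_star_cons]
    rw [← hf, ← hmain, hT]
    rw [hyH] at hparts
    linear_combination (-(p : ℚ)) * hparts

/-- Theorem `thm:FMZVv-dualsuperb=2`, duality in superbity 2:
for every composition `𝐬` (written in the canonical form `vComp`) and all
sufficiently large primes `p`:
`-H⋆_{p-1}(𝐬^∨) ≡ H⋆_{p-1}(𝐬) + p Σ_{𝐭 ⪯ 𝐬} H_{p-1}(1,𝐭) (mod p²)`. -/
theorem v_duality_mod_p_sq (ℓ : ℕ) (hℓ : 0 < ℓ) (r t : ℕ → ℕ)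
    (hr : ∀ i < ℓ, 0 < r i) (ht : ∀ i < ℓ, 0 < t i) :
    ∃ N, ∀ p ≥ N, Nat.Prime p →
      RatModEq p 2 (-(AMHSstar (p - 1) (posComp (vDual ℓ r t))))
        (AMHSstar (p - 1) (posComp (vComp ℓ r t)) +
          (p : ℚ) * ((coarsenings (posComp (vComp ℓ r t))).map
            (fun u => AMHS (p - 1) ((1, (1 : ℚ)) :: u))).sum) := by
  obtain ⟨m, rfl⟩ : ∃ m, ℓ = m + 1 := ⟨ℓ - 1, by omega⟩
  have hd := VDual.comp m r t hr ht
  refine ⟨3, fun p hp3 hp => ?_⟩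
  have : Fact p.Prime := ⟨hp⟩
  generalize vComp (m + 1) r t = u at hd ⊢
  generalize vDual (m + 1) r t = v at hd ⊢
  cases u with
  | nil => cases hd
  | cons a s =>
    cases v with
    | nil => cases hd
    | cons b s' => exact vd_final p (by omega) a b s s' hd
end

section
/- For all sufficiently large primes p, writing β = B_{p−3}/3, the following congruences modulo p² hold: (1) H^⋆_{p−1}(1,3,1) ≡ H_{p−1}(1,3,1) ≡ 0; (2) H^⋆_{p−1}(2,1,2) ≡ H_{p−1}(2,1,2) ≡ −3pβ²; (3) H^⋆_{p−1}(2,3) ≡ H_{p−1}(2,3) ≡ 2H^⋆_{p−1}(4,1) ≡ 2H_{p−1}(4,1); (4) 2H^⋆_{p−1}(2,2,1) − 3H_{p−1}(4,1) ≡ 9pβ²; (5) 2H^⋆_{p−1}(1,1,3) ≡ −2H^⋆_{p−1}(3,1,1) ≡ −2H_{p−1}(1,1,3) ≡ 2H_{p−1}(3,1,1) ≡ H_{p−1}(4,1). -/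
open scoped BigOperators

namespace WF
section gen
variable {R : Type*} [CommRing R] (iv : ℕ → R)

/-- strict sums over a ring -/
def hs : List ℕ → ℕ → R
  | [], _ => 1
  | s :: t, n => ∑ k ∈ Finset.Icc 1 n, iv k ^ s * hs t (k - 1)

/-- star sums over a ring -/
def hS : List ℕ → ℕ → R
  | [], _ => 1
  | s :: t, n => ∑ k ∈ Finset.Icc 1 n, iv k ^ s * hS t k

lemma hs_zero (s : ℕ) (t : List ℕ) : hs iv (s :: t) 0 = 0 := by simp [hs]
lemma hS_zero (s : ℕ) (t : List ℕ) : hS iv (s :: t) 0 = 0 := by simp [hS]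
lemma hs_succ (s : ℕ) (t : List ℕ) (n : ℕ) :
    hs iv (s :: t) (n + 1) = hs iv (s :: t) n + iv (n + 1) ^ s * hs iv t n := by
  simp only [hs]
  rw [Finset.sum_Icc_succ_top (by omega)]; simp
lemma hS_succ (s : ℕ) (t : List ℕ) (n : ℕ) :
    hS iv (s :: t) (n + 1) = hS iv (s :: t) n + iv (n + 1) ^ s * hS iv t (n + 1) := by
  simp only [hS]
  rw [Finset.sum_Icc_succ_top (by omega)]

/-- evaluation of a formal sum of compositions -/
def ev (Q : List (List ℕ)) (n : ℕ) : R := (Q.map (fun l => hs iv l n)).sum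

lemma ev_nil (n : ℕ) : ev iv [] n = 0 := by simp [ev]
lemma ev_cons (l : List ℕ) (Q : List (List ℕ)) (n : ℕ) :
    ev iv (l :: Q) n = hs iv l n + ev iv Q n := by simp [ev]
lemma ev_append (P Q : List (List ℕ)) (n : ℕ) :
    ev iv (P ++ Q) n = ev iv P n + ev iv Q n := by simp [ev]
lemma ev_map_zero (a : ℕ) (Q : List (List ℕ)) : ev iv (Q.map (a :: ·)) 0 = 0 := by
  induction Q with
  | nil => simp [ev]
  | cons l Q ih => rw [List.map_cons, ev_cons, ih, hs_zero, add_zero]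
lemma ev_map_succ (a : ℕ) (Q : List (List ℕ)) (n : ℕ) :
    ev iv (Q.map (a :: ·)) (n + 1) = ev iv (Q.map (a :: ·)) n + iv (n + 1) ^ a * ev iv Q n := by
  induction Q with
  | nil => simp [ev]
  | cons l Q ih => rw [List.map_cons, ev_cons, ih, hs_succ, ev_cons, ev_cons]; ring
lemma ev_map_sum (a : ℕ) (Q : List (List ℕ)) (n : ℕ) :
    ev iv (Q.map (a :: ·)) n = ∑ k ∈ Finset.Icc 1 n, iv k ^ a * ev iv Q (k - 1) := by
  induction n with
  | zero => simp [ev_map_zero]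
  | succ n ih => rw [ev_map_succ, Finset.sum_Icc_succ_top (by omega), ih]; simp

/-- quasi-shuffle product -/
def qsh : List ℕ → List ℕ → List (List ℕ)
  | [], v => [v]
  | a :: u, [] => [a :: u]
  | a :: u, b :: v => (qsh u (b :: v)).map (a :: ·) ++ (qsh (a :: u) v).map (b :: ·)
      ++ (qsh u v).map ((a + b) :: ·)
termination_by u v => u.length + v.length

lemma stuffle (n : ℕ) : ∀ u v, hs iv u n * hs iv v n = ev iv (qsh u v) n := by
  induction n with
  | zero =>
    intro u v
    cases u with
    | nil => simp [qsh, ev, hs]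
    | cons a u =>
      cases v with
      | nil => simp [qsh, ev, hs]
      | cons b v => rw [qsh, ev_append, ev_append, ev_map_zero, ev_map_zero, ev_map_zero, hs_zero]; simp
  | succ n ih =>
    intro u v
    cases u with
    | nil => simp [qsh, ev, hs]
    | cons a u =>
      cases v with
      | nil => simp [qsh, ev, hs]
      | cons b v =>
        have h := ih (a :: u) (b :: v)
        rw [qsh, ev_append, ev_append] at h ⊢
        rw [ev_map_succ, ev_map_succ, ev_map_succ, ← ih, ← ih, ← ih, hs_succ, hs_succ]
        linear_combination h

/-- star sums as formal sums of strict sums -/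
def st : List ℕ → List (List ℕ)
  | [] => [[]]
  | [a] => [[a]]
  | a :: b :: t => (st (b :: t)).map (a :: ·) ++ st ((a + b) :: t)
termination_by l => l.length

lemma star_exp (l : List ℕ) : ∀ n, hS iv l n = ev iv (st l) n := by
  induction l using st.induct with
  | case1 => intro n; simp [st, ev, hs, hS]
  | case2 a => intro n; simp [st, ev, hs, hS]
  | case3 a b t ih1 ih2 =>
    intro n
    rw [st, ev_append, ev_map_sum, ← ih2, hS, hS, ← Finset.sum_add_distrib]
    refine Finset.sum_congr rfl fun k hk => ?_
    rw [Finset.mem_Icc] at hk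
    obtain ⟨m, rfl⟩ : ∃ m, k = m + 1 := ⟨k - 1, by omega⟩
    rw [Nat.add_sub_cancel, ← ih1, hS_succ, pow_add]; ring

/-- formal version of `∑ k, iv k ^ a * hs q k` -/
def lift : ℕ → List ℕ → List (List ℕ)
  | a, [] => [[a]]
  | a, b :: t => [a :: b :: t, (a + b) :: t]

lemma lift_ev (a : ℕ) (q : List ℕ) (n : ℕ) :
    ∑ k ∈ Finset.Icc 1 n, iv k ^ a * hs iv q k = ev iv (lift a q) n := by
  cases q with
  | nil => simp [lift, ev, hs]
  | cons b t =>
    simp only [lift, ev, List.map_cons, List.map_nil, List.sum_cons, List.sum_nil, add_zero]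
    rw [hs, hs, ← Finset.sum_add_distrib]
    refine Finset.sum_congr rfl fun k hk => ?_
    rw [Finset.mem_Icc] at hk
    obtain ⟨m, rfl⟩ : ∃ m, k = m + 1 := ⟨k - 1, by omega⟩
    rw [Nat.add_sub_cancel, hs_succ, pow_add]; ring

lemma ev_flatMap_lift (a : ℕ) (Q : List (List ℕ)) (n : ℕ) :
    ev iv (Q.flatMap (lift a)) n = ∑ k ∈ Finset.Icc 1 n, iv k ^ a * ev iv Q k := by
  induction Q with
  | nil => simp [ev]
  | cons l Q ih =>
    rw [List.flatMap_cons, ev_append, ih, ← lift_ev, ← Finset.sum_add_distrib]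
    exact Finset.sum_congr rfl fun k _ => by rw [ev_cons]; ring

lemma ev_flatMap_qsh (Q : List (List ℕ)) (n : ℕ) :
    ev iv (Q.flatMap (qsh [1])) n = hs iv [1] n * ev iv Q n := by
  induction Q with
  | nil => simp [ev]
  | cons l Q ih => rw [List.flatMap_cons, ev_append, ih, ← stuffle, ev_cons]; ring

/-- the `p`-term of the duality relation -/
def dualp (a : ℕ) (t : List ℕ) : List (List ℕ) := ((st t).flatMap (qsh [1])).flatMap (lift a)

lemma dualp_ev (a : ℕ) (t : List ℕ) (n : ℕ) :
    ev iv (dualp a t) n = ∑ k ∈ Finset.Icc 1 n, iv k ^ a * hS iv t k * hs iv [1] k := by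
  rw [dualp, ev_flatMap_lift]
  exact Finset.sum_congr rfl fun k _ => by rw [ev_flatMap_qsh, star_exp]; ring

/-! words -/
def sw : List Bool → ℕ → R
  | [], n => iv n
  | true :: w, n => iv n * sw w n
  | false :: w, n => iv n * ∑ k ∈ Finset.Icc 1 n, sw w k

/-- word of a composition -/
def lw : List ℕ → List Bool
  | [] => []
  | [a] => List.replicate (a - 1) true
  | a :: b :: t => List.replicate (a - 1) true ++ false :: lw (b :: t)

lemma sw_rep (m : ℕ) (w : List Bool) (n : ℕ) :
    sw iv (List.replicate m true ++ w) n = iv n ^ m * sw iv w n := by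
  induction m with
  | zero => simp
  | succ m ih => rw [List.replicate_succ, List.cons_append, sw, ih]; ring

lemma sw_lw (l : List ℕ) : ∀ a t, l = a :: t → (∀ x ∈ l, 0 < x) → ∀ n,
    sw iv (lw l) n = iv n ^ a * hS iv t n := by
  induction l with
  | nil => intro a t h; simp at h
  | cons a' l ih =>
    intro a t h hpos n
    obtain ⟨rfl, rfl⟩ := List.cons.inj h
    have ha : 0 < a' := hpos a' (by simp)
    have e : iv n ^ a' = iv n ^ (a' - 1) * iv n := by rw [← pow_succ]; congr 1; omega
    cases l with
    | nil =>
      have := sw_rep iv (a' - 1) [] n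
      rw [List.append_nil] at this
      rw [lw, this, sw, hS, e, mul_one]
    | cons b t =>
      rw [lw, sw_rep, sw, hS, e, mul_assoc]
      congr 2
      refine Finset.sum_congr rfl fun k _ => ?_
      exact ih b t rfl (fun x hx => hpos x (by simp [hx])) k

end gen
end WF

namespace WF
section dual
variable {R : Type*} [CommRing R] (iv : ℕ → R)

lemma sum_Icc_range (f : ℕ → R) (n : ℕ) :
    ∑ k ∈ Finset.Icc 1 n, f k = ∑ k ∈ Finset.range n, f (k + 1) := by
  induction n with
  | zero => simp
  | succ n ih => rw [Finset.sum_Icc_succ_top (by omega), Finset.sum_range_succ, ih]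

/-- binomial transform -/
def TT (f : ℕ → R) (m : ℕ) : R :=
  ∑ k ∈ Finset.range (m + 1), (-1) ^ k * (m.choose k : R) * f (k + 1)
/-- summed binomial transform -/
def UU (f : ℕ → R) (n : ℕ) : R :=
  ∑ k ∈ Finset.range n, (-1) ^ k * (n.choose (k + 1) : R) * f (k + 1)

lemma UU_eq (f : ℕ → R) (n : ℕ) : UU f n = ∑ m ∈ Finset.range n, TT f m := by
  induction n with
  | zero => simp [UU]
  | succ n ih =>
    rw [Finset.sum_range_succ, ← ih]
    have e : UU f n = ∑ k ∈ Finset.range (n + 1), (-1) ^ k * (n.choose (k + 1) : R) * f (k + 1) := by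
      rw [Finset.sum_range_succ]; simp [UU]
    rw [e, TT, UU, ← Finset.sum_add_distrib]
    refine Finset.sum_congr rfl fun k _ => ?_
    rw [Nat.choose_succ_succ]; push_cast; ring

lemma UU_sum (f : ℕ → R) (m : ℕ) :
    UU (fun n => ∑ k ∈ Finset.Icc 1 n, f k) (m + 1) = TT f m := by
  set F : ℕ → R := fun n => ∑ k ∈ Finset.Icc 1 n, f k with hF
  have hF0 : F 0 = 0 := by simp [hF]
  have hFs : ∀ n, F (n + 1) = F n + f (n + 1) := fun n => by
    simp only [hF]; rw [Finset.sum_Icc_succ_top (by omega)]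
  have h1 : UU F (m + 1) = ∑ k ∈ Finset.range (m + 1), (-1) ^ k * (m.choose k : R) * F (k + 1)
      + ∑ k ∈ Finset.range (m + 1), (-1) ^ k * (m.choose (k + 1) : R) * F (k + 1) := by
    rw [UU, ← Finset.sum_add_distrib]
    refine Finset.sum_congr rfl fun k _ => ?_
    rw [Nat.choose_succ_succ]; push_cast; ring
  have h2 : ∑ k ∈ Finset.range (m + 1), (-1) ^ k * (m.choose (k + 1) : R) * F (k + 1)
      = - ∑ k ∈ Finset.range (m + 1), (-1) ^ k * (m.choose k : R) * F k := by
    have e1 := Finset.sum_range_succ' (fun k => (-1) ^ k * (m.choose k : R) * F k) (m + 1)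
    have e2 := Finset.sum_range_succ (fun k => (-1) ^ k * (m.choose k : R) * F k) (m + 1)
    rw [e1] at e2
    simp only [hF0, Nat.choose_succ_self, Nat.cast_zero, mul_zero, zero_mul, add_zero] at e2
    rw [← e2, ← Finset.sum_neg_distrib]
    refine Finset.sum_congr rfl fun k _ => ?_
    ring
  rw [h1, h2, TT, ← sub_eq_add_neg, ← Finset.sum_sub_distrib]
  refine Finset.sum_congr rfl fun k _ => ?_
  rw [hFs]; ring

lemma UU_one (m : ℕ) : UU (fun _ => (1 : R)) (m + 1) = 1 := by
  rw [UU_eq, Finset.sum_eq_single 0]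
  · simp [TT]
  · intro j _ hj
    have := Int.alternating_sum_range_choose_of_ne hj
    have h2 := congrArg (Int.cast : ℤ → R) this
    push_cast at h2
    simpa [TT] using h2
  · simp

variable {iv} {p : ℕ} (hiv : ∀ k, 0 < k → k < p → (k : R) * iv k = 1)
include hiv

lemma TT_iv (f : ℕ → R) (m : ℕ) (hm : m + 1 < p) :
    TT (fun n => iv n * f n) m = iv (m + 1) * UU f (m + 1) := by
  rw [TT, UU, Finset.mul_sum]
  refine Finset.sum_congr rfl fun k hk => ?_
  rw [Finset.mem_range] at hk
  have h1 := hiv (m + 1) (by omega) hm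
  have h2 := hiv (k + 1) (by omega) (by omega)
  have h3 := congrArg (Nat.cast : ℕ → R) (Nat.add_one_mul_choose_eq m k)
  rw [Nat.cast_mul, Nat.cast_mul] at h3
  have h4 : (m.choose k : R) * iv (k + 1) = ((m + 1).choose (k + 1) : R) * iv (m + 1) := by
    linear_combination iv (m + 1) * iv (k + 1) * h3 - (m.choose k : R) * iv (k + 1) * h1
      + ((m + 1).choose (k + 1) : R) * iv (m + 1) * h2
  linear_combination (-1) ^ k * f (k + 1) * h4

lemma TT_sw (w : List Bool) : ∀ m, m + 1 < p →
    TT (sw iv w) m = sw iv (w.map (!·)) (m + 1) := by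
  induction w with
  | nil =>
    intro m hm
    have := TT_iv hiv (fun _ => 1) m hm
    rw [UU_one] at this
    simpa [sw] using this
  | cons b w ih =>
    intro m hm
    cases b with
    | true =>
      have := TT_iv hiv (sw iv w) m hm
      have e : sw iv (true :: w) = fun n => iv n * sw iv w n := by funext n; rw [sw]
      rw [e, this, UU_eq, List.map_cons]
      simp only [Bool.not_true]
      rw [sw, sum_Icc_range]
      congr 1
      refine Finset.sum_congr rfl fun k hk => ?_
      rw [Finset.mem_range] at hk
      exact ih k (by omega)
    | false =>
      have e : sw iv (false :: w) = fun n => iv n * ∑ k ∈ Finset.Icc 1 n, sw iv w k := by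
        funext n; rw [sw]
      rw [e, TT_iv hiv _ m hm, UU_sum, List.map_cons]
      simp only [Bool.not_false]
      rw [sw, ih m hm]

variable (hp2 : (p : R) ^ 2 = 0)
include hp2

lemma choose_p (k : ℕ) (hk : k < p) :
    (-1) ^ k * ((p - 1).choose k : R) = 1 - p * hs iv [1] k := by
  induction k with
  | zero => simp [hs]
  | succ k ih =>
    have ih := ih (by omega)
    have h2 := hiv (k + 1) (by omega) hk
    have h3 := congrArg (Nat.cast : ℕ → R) (Nat.choose_succ_right_eq (p - 1) k)
    have h5 : ((p - 1 - k : ℕ) : R) = p - (k + 1 : ℕ) := by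
      rw [eq_sub_iff_add_eq, ← Nat.cast_add]; congr 1; omega
    rw [Nat.cast_mul, Nat.cast_mul, h5] at h3
    rw [hs_succ]
    simp only [hs, pow_one, mul_one] at ih ⊢
    generalize ∑ x ∈ Finset.Icc 1 k, iv x = Z at *
    have h6 : ((p - 1).choose (k + 1) : R) = ((p - 1).choose k : R) * (p - (k + 1 : ℕ)) * iv (k + 1) := by
      rw [← h3]; linear_combination -((p - 1).choose (k + 1) : R) * h2
    rw [h6, pow_succ]
    linear_combination -((p - (k + 1 : ℕ)) * iv (k + 1)) * ih + (1 - p * Z) * h2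
      + Z * iv (k + 1) * hp2

lemma duality (a : ℕ) (t l' : List ℕ) (h1 : ∀ x ∈ a :: t, 0 < x)
    (h2 : l' ≠ []) (h3 : ∀ x ∈ l', 0 < x) (hw : lw l' = (lw (a :: t)).map (!·)) (hp : 0 < p) :
    ev iv (st l') (p - 1) + ev iv (st (a :: t)) (p - 1) = p * ev iv (dualp a t) (p - 1) := by
  obtain ⟨a', t', rfl⟩ := List.exists_cons_of_ne_nil h2
  have e1 : ev iv (st (a' :: t')) (p - 1) = UU (sw iv (lw (a :: t))) (p - 1) := by
    rw [UU_eq, ← star_exp, hS, sum_Icc_range]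
    refine Finset.sum_congr rfl fun k hk => ?_
    rw [Finset.mem_range] at hk
    rw [TT_sw hiv _ k (by omega), ← hw, sw_lw iv _ a' t' rfl h3]
  rw [e1, ← star_exp, hS, dualp_ev, UU, sum_Icc_range, sum_Icc_range, ← Finset.sum_add_distrib,
    Finset.mul_sum]
  refine Finset.sum_congr rfl fun k hk => ?_
  rw [Finset.mem_range] at hk
  have := choose_p hiv hp2 (k + 1) (by omega)
  rw [sw_lw iv _ a t rfl h1]
  rw [pow_succ] at this
  linear_combination -(iv (k + 1) ^ a * hS iv t (k + 1)) * this

end dual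

section rev
variable {R : Type*} [CommRing R]

/-- nested sums of functions -/
def W : List (ℕ → R) → ℕ → ℕ → R
  | [], _, _ => 1
  | f :: t, lo, hi => ∑ k ∈ Finset.Ioo lo hi, f k * W t lo k

lemma W_snoc (t : List (ℕ → R)) (f : ℕ → R) : ∀ lo hi,
    W (t ++ [f]) lo hi = ∑ k ∈ Finset.Ioo lo hi, f k * W t k hi := by
  induction t with
  | nil => intro lo hi; simp [W]
  | cons g t ih =>
    intro lo hi
    rw [List.cons_append, W]
    simp only [ih, W, Finset.mul_sum]
    rw [Finset.sum_comm' (t' := Finset.Ioo lo hi) (s' := fun k => Finset.Ioo k hi)]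
    · refine Finset.sum_congr rfl fun k _ => Finset.sum_congr rfl fun j _ => ?_
      ring
    · intro x y; simp only [Finset.mem_Ioo]; omega

lemma W_refl (p : ℕ) (l : List (ℕ → R)) : ∀ lo hi, hi ≤ p →
    W l lo hi = W (l.reverse.map (fun f k => f (p - k))) (p - hi) (p - lo) := by
  induction l with
  | nil => intro lo hi _; simp [W]
  | cons f t ih =>
    intro lo hi h
    rw [List.reverse_cons, List.map_append, List.map_singleton, W_snoc, W]
    refine Finset.sum_bij' (fun k _ => p - k) (fun k _ => p - k) ?_ ?_ ?_ ?_ ?_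
    · intro k hk; simp only [Finset.mem_Ioo] at *; omega
    · intro k hk; simp only [Finset.mem_Ioo] at *; omega
    · intro k hk; simp only [Finset.mem_Ioo] at *; omega
    · intro k hk; simp only [Finset.mem_Ioo] at *; omega
    · intro k hk; simp only [Finset.mem_Ioo] at hk
      rw [ih lo k (by omega), show p - (p - k) = k by omega]

lemma hs_W (iv : ℕ → R) (l : List ℕ) : ∀ m, 0 < m →
    hs iv l (m - 1) = W (l.map (fun s k => iv k ^ s)) 0 m := by
  induction l with
  | nil => intro m _; simp [hs, W]
  | cons s t ih =>
    intro m hm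
    rw [List.map_cons, W, hs]
    have : Finset.Icc 1 (m - 1) = Finset.Ioo 0 m := by ext x; simp; omega
    rw [this]
    refine Finset.sum_congr rfl fun k hk => ?_
    rw [Finset.mem_Ioo] at hk
    rw [ih k hk.1]

/-- formal derivation -/
def drv : List ℕ → List (ℕ × List ℕ)
  | [] => []
  | s :: t => (s, (s + 1) :: t) :: (drv t).map (fun x => (x.1, s :: x.2))

/-- evaluation with coefficients -/
def evc (iv : ℕ → R) (Q : List (ℕ × List ℕ)) (n : ℕ) : R :=
  (Q.map (fun x => (x.1 : R) * hs iv x.2 n)).sum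

lemma evc_map (iv : ℕ → R) (s : ℕ) (Q : List (ℕ × List ℕ)) (n : ℕ) :
    evc iv (Q.map (fun x => (x.1, s :: x.2))) n
      = ∑ k ∈ Finset.Icc 1 n, iv k ^ s * evc iv Q (k - 1) := by
  induction Q with
  | nil => simp [evc]
  | cons x Q ih =>
    simp only [evc, List.map_cons, List.sum_cons] at ih ⊢
    rw [ih, hs, Finset.mul_sum, ← Finset.sum_add_distrib]
    exact Finset.sum_congr rfl fun k _ => by ring

variable {iv : ℕ → R} {p : ℕ} (hiv : ∀ k, 0 < k → k < p → (k : R) * iv k = 1)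
  (hp2 : (p : R) ^ 2 = 0)
include hiv hp2

lemma iv_refl (k : ℕ) (h0 : 0 < k) (hk : k < p) (s : ℕ) :
    iv (p - k) ^ s = (-1) ^ s * (iv k ^ s + s * p * iv k ^ (s + 1)) := by
  have h1 := hiv k h0 hk
  have h2 := hiv (p - k) (by omega) (by omega)
  rw [Nat.cast_sub hk.le] at h2
  have h3 : iv (p - k) = -(iv k * (1 + p * iv k)) := by
    linear_combination -(iv k * (1 + p * iv k)) * h2 
      - iv (p - k) * (1 + p * iv k) * h1 + iv (p - k) * iv k ^ 2 * hp2 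
  induction s with
  | zero => simp
  | succ s ih =>
    rw [pow_succ, ih, h3]
    push_cast
    linear_combination (-1) ^ (s + 1) * s * iv k ^ (s + 3) * hp2

lemma W_exp (l : List ℕ) : ∀ m, 0 < m → m ≤ p →
    W (l.map (fun s k => iv (p - k) ^ s)) 0 m
      = (-1) ^ l.sum * (hs iv l (m - 1) + p * evc iv (drv l) (m - 1)) := by
  induction l with
  | nil => intro m _ _; simp [W, hs, evc, drv]
  | cons s t ih =>
    intro m hm hmp
    have e : evc iv (drv (s :: t)) (m - 1) = s * hs iv ((s + 1) :: t) (m - 1)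
        + ∑ k ∈ Finset.Icc 1 (m - 1), iv k ^ s * evc iv (drv t) (k - 1) := by
      rw [← evc_map]; simp [evc, drv]
    rw [e, hs, hs, List.map_cons, W, Finset.mul_sum, ← Finset.sum_add_distrib, Finset.mul_sum,
      ← Finset.sum_add_distrib, Finset.mul_sum]
    have : Finset.Icc 1 (m - 1) = Finset.Ioo 0 m := by ext x; simp; omega
    rw [this]
    refine Finset.sum_congr rfl fun k hk => ?_
    rw [Finset.mem_Ioo] at hk
    rw [ih k hk.1 (by omega), iv_refl hiv hp2 k hk.1 (by omega), List.sum_cons, pow_add]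
    linear_combination (-1) ^ s * (-1) ^ t.sum * s * iv k ^ (s + 1) * evc iv (drv t) (k - 1) * hp2

lemma reversal (l : List ℕ) (hp : 0 < p) :
    hs iv l (p - 1) = (-1) ^ l.reverse.sum *
      (hs iv l.reverse (p - 1) + p * evc iv (drv l.reverse) (p - 1)) := by
  rw [hs_W iv l p hp, W_refl p _ 0 p le_rfl, ← W_exp hiv hp2 l.reverse p hp le_rfl,
    ← List.map_reverse, List.map_map, Nat.sub_self, Nat.sub_zero]
  rfl
end rev
end WF

set_option linter.unusedSimpArgs false
set_option linter.unusedSectionVars false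
namespace WF
section algebra
variable {R : Type*} [CommRing R] {iv : ℕ → R} {p : ℕ}
  (hiv : ∀ k, 0 < k → k < p → (k : R) * iv k = 1) (hp2 : (p : R) ^ 2 = 0) (hp : 10 < p)
  {b : R} (hb : p * hs iv [2, 1] (p - 1) = p * (3 * b))

include hiv hp2 hp in
lemma rev_1 : hs iv [1] (p - 1) = -(hs iv [1] (p - 1) +
    p * (hs iv [2] (p - 1))) := by
  have h := reversal hiv hp2 [1] (by omega)
  simp only [List.reverse_cons, List.reverse_nil, drv, evc, List.map_cons, List.map_nil, List.cons_append, List.nil_append, List.append_nil,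
    List.sum_cons, List.sum_nil, Nat.reduceAdd,
    Nat.cast_ofNat, Nat.cast_one] at h
  linear_combination h

lemma st_1_1 : hs iv [1] (p - 1) * hs iv [1] (p - 1) =
    2 * hs iv [1, 1] (p - 1) + hs iv [2] (p - 1) := by
  have h := stuffle iv (p - 1) [1] [1]
  simp only [qsh, ev, List.map_cons, List.map_nil, List.cons_append, List.nil_append, List.append_nil,
    List.sum_cons, List.sum_nil, Nat.reduceAdd] at h
  linear_combination h

include hiv hp2 hp in
lemma dual_2 : 2 * hs iv [2] (p - 1) + hs iv [1, 1] (p - 1) =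
    p * (hs iv [2, 1] (p - 1) + hs iv [3] (p - 1)) := by
  have h := duality hiv hp2 2 [] [1, 1] (by simp) (by simp) (by simp) (by decide)
    (by omega)
  simp only [st, qsh, dualp, lift, ev, List.flatMap_cons, List.flatMap_nil, List.map_cons, List.map_nil, List.cons_append, List.nil_append, List.append_nil,
    List.sum_cons, List.sum_nil, Nat.reduceAdd] at h
  linear_combination h

include hiv hp2 hp in
lemma rev_3 : hs iv [3] (p - 1) = -(hs iv [3] (p - 1) +
    p * (3 * hs iv [4] (p - 1))) := by
  have h := reversal hiv hp2 [3] (by omega)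
  simp only [List.reverse_cons, List.reverse_nil, drv, evc, List.map_cons, List.map_nil, List.cons_append, List.nil_append, List.append_nil,
    List.sum_cons, List.sum_nil, Nat.reduceAdd,
    Nat.cast_ofNat, Nat.cast_one] at h
  linear_combination h

include hiv hp2 hp in
lemma rev_21 : hs iv [2, 1] (p - 1) = -(hs iv [1, 2] (p - 1) +
    p * (hs iv [2, 2] (p - 1) + 2 * hs iv [1, 3] (p - 1))) := by
  have h := reversal hiv hp2 [2, 1] (by omega)
  simp only [List.reverse_cons, List.reverse_nil, drv, evc, List.map_cons, List.map_nil, List.cons_append, List.nil_append, List.append_nil,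
    List.sum_cons, List.sum_nil, Nat.reduceAdd,
    Nat.cast_ofNat, Nat.cast_one] at h
  linear_combination h

lemma st_1_11 : hs iv [1] (p - 1) * hs iv [1, 1] (p - 1) =
    3 * hs iv [1, 1, 1] (p - 1) + hs iv [1, 2] (p - 1) + hs iv [2, 1] (p - 1) := by
  have h := stuffle iv (p - 1) [1] [1, 1]
  simp only [qsh, ev, List.map_cons, List.map_nil, List.cons_append, List.nil_append, List.append_nil,
    List.sum_cons, List.sum_nil, Nat.reduceAdd] at h
  linear_combination h

include hiv hp2 hp in
lemma dual_14 : hs iv [1, 4] (p - 1) + 2 * hs iv [5] (p - 1) + hs iv [2, 1, 1, 1] (p - 1) + hs iv [2, 1, 2] (p - 1) + hs iv [2, 2, 1] (p - 1) + hs iv [2, 3] (p - 1) + hs iv [3, 1, 1] (p - 1) + hs iv [3, 2] (p - 1) + hs iv [4, 1] (p - 1) =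
    p * (hs iv [1, 1, 4] (p - 1) + hs iv [2, 4] (p - 1) + hs iv [1, 4, 1] (p - 1) + hs iv [5, 1] (p - 1) + hs iv [1, 5] (p - 1) + hs iv [6] (p - 1)) := by
  have h := duality hiv hp2 1 [4] [2, 1, 1, 1] (by simp) (by simp) (by simp) (by decide)
    (by omega)
  simp only [st, qsh, dualp, lift, ev, List.flatMap_cons, List.flatMap_nil, List.map_cons, List.map_nil, List.cons_append, List.nil_append, List.append_nil,
    List.sum_cons, List.sum_nil, Nat.reduceAdd] at h
  linear_combination h

include hiv hp2 hp in
lemma dual_221 : hs iv [2, 2, 1] (p - 1) + hs iv [2, 3] (p - 1) + hs iv [4, 1] (p - 1) + 2 * hs iv [5] (p - 1) + hs iv [1, 2, 2] (p - 1) + hs iv [1, 4] (p - 1) + hs iv [3, 2] (p - 1) =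
    p * (hs iv [2, 1, 2, 1] (p - 1) + hs iv [3, 2, 1] (p - 1) + 2 * hs iv [2, 2, 1, 1] (p - 1) + 2 * hs iv [4, 1, 1] (p - 1) + hs iv [2, 2, 2] (p - 1) + hs iv [4, 2] (p - 1) + 2 * hs iv [2, 3, 1] (p - 1) + 2 * hs iv [5, 1] (p - 1) + hs iv [2, 1, 3] (p - 1) + hs iv [3, 3] (p - 1) + hs iv [2, 4] (p - 1) + hs iv [6] (p - 1)) := by
  have h := duality hiv hp2 2 [2, 1] [1, 2, 2] (by simp) (by simp) (by simp) (by decide)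
    (by omega)
  simp only [st, qsh, dualp, lift, ev, List.flatMap_cons, List.flatMap_nil, List.map_cons, List.map_nil, List.cons_append, List.nil_append, List.append_nil,
    List.sum_cons, List.sum_nil, Nat.reduceAdd] at h
  linear_combination h

include hiv hp2 hp in
lemma dual_23 : hs iv [2, 3] (p - 1) + 2 * hs iv [5] (p - 1) + hs iv [1, 2, 1, 1] (p - 1) + hs iv [1, 2, 2] (p - 1) + hs iv [1, 3, 1] (p - 1) + hs iv [1, 4] (p - 1) + hs iv [3, 1, 1] (p - 1) + hs iv [3, 2] (p - 1) + hs iv [4, 1] (p - 1) =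
    p * (hs iv [2, 1, 3] (p - 1) + hs iv [3, 3] (p - 1) + hs iv [2, 3, 1] (p - 1) + hs iv [5, 1] (p - 1) + hs iv [2, 4] (p - 1) + hs iv [6] (p - 1)) := by
  have h := duality hiv hp2 2 [3] [1, 2, 1, 1] (by simp) (by simp) (by simp) (by decide)
    (by omega)
  simp only [st, qsh, dualp, lift, ev, List.flatMap_cons, List.flatMap_nil, List.map_cons, List.map_nil, List.cons_append, List.nil_append, List.append_nil,
    List.sum_cons, List.sum_nil, Nat.reduceAdd] at h
  linear_combination h

include hiv hp2 hp in
lemma dual_32 : hs iv [3, 2] (p - 1) + 2 * hs iv [5] (p - 1) + hs iv [1, 1, 2, 1] (p - 1) + hs iv [1, 1, 3] (p - 1) + hs iv [1, 3, 1] (p - 1) + hs iv [1, 4] (p - 1) + hs iv [2, 2, 1] (p - 1) + hs iv [2, 3] (p - 1) + hs iv [4, 1] (p - 1) =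
    p * (hs iv [3, 1, 2] (p - 1) + hs iv [4, 2] (p - 1) + hs iv [3, 2, 1] (p - 1) + hs iv [5, 1] (p - 1) + hs iv [3, 3] (p - 1) + hs iv [6] (p - 1)) := by
  have h := duality hiv hp2 3 [2] [1, 1, 2, 1] (by simp) (by simp) (by simp) (by decide)
    (by omega)
  simp only [st, qsh, dualp, lift, ev, List.flatMap_cons, List.flatMap_nil, List.map_cons, List.map_nil, List.cons_append, List.nil_append, List.append_nil,
    List.sum_cons, List.sum_nil, Nat.reduceAdd] at h
  linear_combination h

include hiv hp2 hp in
lemma dual_41 : hs iv [4, 1] (p - 1) + 2 * hs iv [5] (p - 1) + hs iv [1, 1, 1, 2] (p - 1) + hs iv [1, 1, 3] (p - 1) + hs iv [1, 2, 2] (p - 1) + hs iv [1, 4] (p - 1) + hs iv [2, 1, 2] (p - 1) + hs iv [2, 3] (p - 1) + hs iv [3, 2] (p - 1) =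
    p * (2 * hs iv [4, 1, 1] (p - 1) + 2 * hs iv [5, 1] (p - 1) + hs iv [4, 2] (p - 1) + hs iv [6] (p - 1)) := by
  have h := duality hiv hp2 4 [1] [1, 1, 1, 2] (by simp) (by simp) (by simp) (by decide)
    (by omega)
  simp only [st, qsh, dualp, lift, ev, List.flatMap_cons, List.flatMap_nil, List.map_cons, List.map_nil, List.cons_append, List.nil_append, List.append_nil,
    List.sum_cons, List.sum_nil, Nat.reduceAdd] at h
  linear_combination h

include hiv hp2 hp in
lemma dual_5 : 2 * hs iv [5] (p - 1) + hs iv [1, 1, 1, 1, 1] (p - 1) + hs iv [1, 1, 1, 2] (p - 1) + hs iv [1, 1, 2, 1] (p - 1) + hs iv [1, 1, 3] (p - 1) + hs iv [1, 2, 1, 1] (p - 1) + hs iv [1, 2, 2] (p - 1) + hs iv [1, 3, 1] (p - 1) + hs iv [1, 4] (p - 1) + hs iv [2, 1, 1, 1] (p - 1) + hs iv [2, 1, 2] (p - 1) + hs iv [2, 2, 1] (p - 1) + hs iv [2, 3] (p - 1) + hs iv [3, 1, 1] (p - 1) + hs iv [3, 2] (p - 1) + hs iv [4, 1] (p - 1)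 =
    p * (hs iv [5, 1] (p - 1) + hs iv [6] (p - 1)) := by
  have h := duality hiv hp2 5 [] [1, 1, 1, 1, 1] (by simp) (by simp) (by simp) (by decide)
    (by omega)
  simp only [st, qsh, dualp, lift, ev, List.flatMap_cons, List.flatMap_nil, List.map_cons, List.map_nil, List.cons_append, List.nil_append, List.append_nil,
    List.sum_cons, List.sum_nil, Nat.reduceAdd] at h
  linear_combination h

include hiv hp2 hp in
lemma rev_113 : hs iv [1, 1, 3] (p - 1) = -(hs iv [3, 1, 1] (p - 1) +
    p * (3 * hs iv [4, 1, 1] (p - 1) + hs iv [3, 2, 1] (p - 1) + hs iv [3, 1, 2] (p - 1))) := by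
  have h := reversal hiv hp2 [1, 1, 3] (by omega)
  simp only [List.reverse_cons, List.reverse_nil, drv, evc, List.map_cons, List.map_nil, List.cons_append, List.nil_append, List.append_nil,
    List.sum_cons, List.sum_nil, Nat.reduceAdd,
    Nat.cast_ofNat, Nat.cast_one] at h
  linear_combination h

include hiv hp2 hp in
lemma rev_122 : hs iv [1, 2, 2] (p - 1) = -(hs iv [2, 2, 1] (p - 1) +
    p * (2 * hs iv [3, 2, 1] (p - 1) + 2 * hs iv [2, 3, 1] (p - 1) + hs iv [2, 2, 2] (p - 1))) := by
  have h := reversal hiv hp2 [1, 2, 2] (by omega)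
  simp only [List.reverse_cons, List.reverse_nil, drv, evc, List.map_cons, List.map_nil, List.cons_append, List.nil_append, List.append_nil,
    List.sum_cons, List.sum_nil, Nat.reduceAdd,
    Nat.cast_ofNat, Nat.cast_one] at h
  linear_combination h

include hiv hp2 hp in
lemma rev_131 : hs iv [1, 3, 1] (p - 1) = -(hs iv [1, 3, 1] (p - 1) +
    p * (hs iv [2, 3, 1] (p - 1) + 3 * hs iv [1, 4, 1] (p - 1) + hs iv [1, 3, 2] (p - 1))) := by
  have h := reversal hiv hp2 [1, 3, 1] (by omega)
  simp only [List.reverse_cons, List.reverse_nil, drv, evc, List.map_cons, List.map_nil, List.cons_append, List.nil_append, List.append_nil,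
    List.sum_cons, List.sum_nil, Nat.reduceAdd,
    Nat.cast_ofNat, Nat.cast_one] at h
  linear_combination h

include hiv hp2 hp in
lemma rev_14 : hs iv [1, 4] (p - 1) = -(hs iv [4, 1] (p - 1) +
    p * (4 * hs iv [5, 1] (p - 1) + hs iv [4, 2] (p - 1))) := by
  have h := reversal hiv hp2 [1, 4] (by omega)
  simp only [List.reverse_cons, List.reverse_nil, drv, evc, List.map_cons, List.map_nil, List.cons_append, List.nil_append, List.append_nil,
    List.sum_cons, List.sum_nil, Nat.reduceAdd,
    Nat.cast_ofNat, Nat.cast_one] at h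
  linear_combination h

include hiv hp2 hp in
lemma rev_212 : hs iv [2, 1, 2] (p - 1) = -(hs iv [2, 1, 2] (p - 1) +
    p * (2 * hs iv [3, 1, 2] (p - 1) + hs iv [2, 2, 2] (p - 1) + 2 * hs iv [2, 1, 3] (p - 1))) := by
  have h := reversal hiv hp2 [2, 1, 2] (by omega)
  simp only [List.reverse_cons, List.reverse_nil, drv, evc, List.map_cons, List.map_nil, List.cons_append, List.nil_append, List.append_nil,
    List.sum_cons, List.sum_nil, Nat.reduceAdd,
    Nat.cast_ofNat, Nat.cast_one] at h
  linear_combination h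

include hiv hp2 hp in
lemma rev_221 : hs iv [2, 2, 1] (p - 1) = -(hs iv [1, 2, 2] (p - 1) +
    p * (hs iv [2, 2, 2] (p - 1) + 2 * hs iv [1, 3, 2] (p - 1) + 2 * hs iv [1, 2, 3] (p - 1))) := by
  have h := reversal hiv hp2 [2, 2, 1] (by omega)
  simp only [List.reverse_cons, List.reverse_nil, drv, evc, List.map_cons, List.map_nil, List.cons_append, List.nil_append, List.append_nil,
    List.sum_cons, List.sum_nil, Nat.reduceAdd,
    Nat.cast_ofNat, Nat.cast_one] at h
  linear_combination h

include hiv hp2 hp in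
lemma rev_23 : hs iv [2, 3] (p - 1) = -(hs iv [3, 2] (p - 1) +
    p * (3 * hs iv [4, 2] (p - 1) + 2 * hs iv [3, 3] (p - 1))) := by
  have h := reversal hiv hp2 [2, 3] (by omega)
  simp only [List.reverse_cons, List.reverse_nil, drv, evc, List.map_cons, List.map_nil, List.cons_append, List.nil_append, List.append_nil,
    List.sum_cons, List.sum_nil, Nat.reduceAdd,
    Nat.cast_ofNat, Nat.cast_one] at h
  linear_combination h

include hiv hp2 hp in
lemma rev_311 : hs iv [3, 1, 1] (p - 1) = -(hs iv [1, 1, 3] (p - 1) +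
    p * (hs iv [2, 1, 3] (p - 1) + hs iv [1, 2, 3] (p - 1) + 3 * hs iv [1, 1, 4] (p - 1))) := by
  have h := reversal hiv hp2 [3, 1, 1] (by omega)
  simp only [List.reverse_cons, List.reverse_nil, drv, evc, List.map_cons, List.map_nil, List.cons_append, List.nil_append, List.append_nil,
    List.sum_cons, List.sum_nil, Nat.reduceAdd,
    Nat.cast_ofNat, Nat.cast_one] at h
  linear_combination h

include hiv hp2 hp in
lemma rev_32 : hs iv [3, 2] (p - 1) = -(hs iv [2, 3] (p - 1) +
    p * (2 * hs iv [3, 3] (p - 1) + 3 * hs iv [2, 4] (p - 1))) := by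
  have h := reversal hiv hp2 [3, 2] (by omega)
  simp only [List.reverse_cons, List.reverse_nil, drv, evc, List.map_cons, List.map_nil, List.cons_append, List.nil_append, List.append_nil,
    List.sum_cons, List.sum_nil, Nat.reduceAdd,
    Nat.cast_ofNat, Nat.cast_one] at h
  linear_combination h

include hiv hp2 hp in
lemma rev_41 : hs iv [4, 1] (p - 1) = -(hs iv [1, 4] (p - 1) +
    p * (hs iv [2, 4] (p - 1) + 4 * hs iv [1, 5] (p - 1))) := by
  have h := reversal hiv hp2 [4, 1] (by omega)
  simp only [List.reverse_cons, List.reverse_nil, drv, evc, List.map_cons, List.map_nil, List.cons_append, List.nil_append, List.append_nil,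
    List.sum_cons, List.sum_nil, Nat.reduceAdd,
    Nat.cast_ofNat, Nat.cast_one] at h
  linear_combination h

include hiv hp2 hp in
lemma rev_5 : hs iv [5] (p - 1) = -(hs iv [5] (p - 1) +
    p * (5 * hs iv [6] (p - 1))) := by
  have h := reversal hiv hp2 [5] (by omega)
  simp only [List.reverse_cons, List.reverse_nil, drv, evc, List.map_cons, List.map_nil, List.cons_append, List.nil_append, List.append_nil,
    List.sum_cons, List.sum_nil, Nat.reduceAdd,
    Nat.cast_ofNat, Nat.cast_one] at h
  linear_combination h

lemma st_1_211 : hs iv [1] (p - 1) * hs iv [2, 1, 1] (p - 1) =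
    hs iv [1, 2, 1, 1] (p - 1) + 3 * hs iv [2, 1, 1, 1] (p - 1) + hs iv [2, 1, 2] (p - 1) + hs iv [2, 2, 1] (p - 1) + hs iv [3, 1, 1] (p - 1) := by
  have h := stuffle iv (p - 1) [1] [2, 1, 1]
  simp only [qsh, ev, List.map_cons, List.map_nil, List.cons_append, List.nil_append, List.append_nil,
    List.sum_cons, List.sum_nil, Nat.reduceAdd] at h
  linear_combination h

lemma st_1_31 : hs iv [1] (p - 1) * hs iv [3, 1] (p - 1) =
    hs iv [1, 3, 1] (p - 1) + 2 * hs iv [3, 1, 1] (p - 1) + hs iv [3, 2] (p - 1) + hs iv [4, 1] (p - 1) := by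
  have h := stuffle iv (p - 1) [1] [3, 1]
  simp only [qsh, ev, List.map_cons, List.map_nil, List.cons_append, List.nil_append, List.append_nil,
    List.sum_cons, List.sum_nil, Nat.reduceAdd] at h
  linear_combination h

lemma st_1_4 : hs iv [1] (p - 1) * hs iv [4] (p - 1) =
    hs iv [1, 4] (p - 1) + hs iv [4, 1] (p - 1) + hs iv [5] (p - 1) := by
  have h := stuffle iv (p - 1) [1] [4]
  simp only [qsh, ev, List.map_cons, List.map_nil, List.cons_append, List.nil_append, List.append_nil,
    List.sum_cons, List.sum_nil, Nat.reduceAdd] at h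
  linear_combination h

lemma st_11_111 : hs iv [1, 1] (p - 1) * hs iv [1, 1, 1] (p - 1) =
    10 * hs iv [1, 1, 1, 1, 1] (p - 1) + 3 * hs iv [1, 1, 1, 2] (p - 1) + 3 * hs iv [1, 1, 2, 1] (p - 1) + 3 * hs iv [1, 2, 1, 1] (p - 1) + hs iv [1, 2, 2] (p - 1) + 3 * hs iv [2, 1, 1, 1] (p - 1) + hs iv [2, 1, 2] (p - 1) + hs iv [2, 2, 1] (p - 1) := by
  have h := stuffle iv (p - 1) [1, 1] [1, 1, 1]
  simp only [qsh, ev, List.map_cons, List.map_nil, List.cons_append, List.nil_append, List.append_nil,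
    List.sum_cons, List.sum_nil, Nat.reduceAdd] at h
  linear_combination h

lemma st_11_21 : hs iv [1, 1] (p - 1) * hs iv [2, 1] (p - 1) =
    hs iv [1, 1, 2, 1] (p - 1) + 2 * hs iv [1, 2, 1, 1] (p - 1) + hs iv [1, 2, 2] (p - 1) + hs iv [1, 3, 1] (p - 1) + 3 * hs iv [2, 1, 1, 1] (p - 1) + hs iv [2, 1, 2] (p - 1) + hs iv [2, 2, 1] (p - 1) + 2 * hs iv [3, 1, 1] (p - 1) + hs iv [3, 2] (p - 1) := by
  have h := stuffle iv (p - 1) [1, 1] [2, 1]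
  simp only [qsh, ev, List.map_cons, List.map_nil, List.cons_append, List.nil_append, List.append_nil,
    List.sum_cons, List.sum_nil, Nat.reduceAdd] at h
  linear_combination h

lemma st_11_3 : hs iv [1, 1] (p - 1) * hs iv [3] (p - 1) =
    hs iv [1, 1, 3] (p - 1) + hs iv [1, 3, 1] (p - 1) + hs iv [1, 4] (p - 1) + hs iv [3, 1, 1] (p - 1) + hs iv [4, 1] (p - 1) := by
  have h := stuffle iv (p - 1) [1, 1] [3]
  simp only [qsh, ev, List.map_cons, List.map_nil, List.cons_append, List.nil_append, List.append_nil,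
    List.sum_cons, List.sum_nil, Nat.reduceAdd] at h
  linear_combination h

lemma st_2_111 : hs iv [2] (p - 1) * hs iv [1, 1, 1] (p - 1) =
    hs iv [2, 1, 1, 1] (p - 1) + hs iv [1, 2, 1, 1] (p - 1) + hs iv [1, 1, 2, 1] (p - 1) + hs iv [1, 1, 1, 2] (p - 1) + hs iv [1, 1, 3] (p - 1) + hs iv [1, 3, 1] (p - 1) + hs iv [3, 1, 1] (p - 1) := by
  have h := stuffle iv (p - 1) [2] [1, 1, 1]
  simp only [qsh, ev, List.map_cons, List.map_nil, List.cons_append, List.nil_append, List.append_nil,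
    List.sum_cons, List.sum_nil, Nat.reduceAdd] at h
  linear_combination h

lemma st_2_12 : hs iv [2] (p - 1) * hs iv [1, 2] (p - 1) =
    hs iv [2, 1, 2] (p - 1) + 2 * hs iv [1, 2, 2] (p - 1) + hs iv [1, 4] (p - 1) + hs iv [3, 2] (p - 1) := by
  have h := stuffle iv (p - 1) [2] [1, 2]
  simp only [qsh, ev, List.map_cons, List.map_nil, List.cons_append, List.nil_append, List.append_nil,
    List.sum_cons, List.sum_nil, Nat.reduceAdd] at h
  linear_combination h

lemma st_2_21 : hs iv [2] (p - 1) * hs iv [2, 1] (p - 1) =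
    2 * hs iv [2, 2, 1] (p - 1) + hs iv [2, 1, 2] (p - 1) + hs iv [2, 3] (p - 1) + hs iv [4, 1] (p - 1) := by
  have h := stuffle iv (p - 1) [2] [2, 1]
  simp only [qsh, ev, List.map_cons, List.map_nil, List.cons_append, List.nil_append, List.append_nil,
    List.sum_cons, List.sum_nil, Nat.reduceAdd] at h
  linear_combination h

lemma st_2_3 : hs iv [2] (p - 1) * hs iv [3] (p - 1) =
    hs iv [2, 3] (p - 1) + hs iv [3, 2] (p - 1) + hs iv [5] (p - 1) := by
  have h := stuffle iv (p - 1) [2] [3]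
  simp only [qsh, ev, List.map_cons, List.map_nil, List.cons_append, List.nil_append, List.append_nil,
    List.sum_cons, List.sum_nil, Nat.reduceAdd] at h
  linear_combination h

include hiv hp2 hp in
lemma rev_321 : hs iv [3, 2, 1] (p - 1) = (hs iv [1, 2, 3] (p - 1) +
    p * (hs iv [2, 2, 3] (p - 1) + 2 * hs iv [1, 3, 3] (p - 1) + 3 * hs iv [1, 2, 4] (p - 1))) := by
  have h := reversal hiv hp2 [3, 2, 1] (by omega)
  simp only [List.reverse_cons, List.reverse_nil, drv, evc, List.map_cons, List.map_nil, List.cons_append, List.nil_append, List.append_nil,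
    List.sum_cons, List.sum_nil, Nat.reduceAdd,
    Nat.cast_ofNat, Nat.cast_one] at h
  linear_combination h

include hiv hp2 hp in
lemma rev_411 : hs iv [4, 1, 1] (p - 1) = (hs iv [1, 1, 4] (p - 1) +
    p * (hs iv [2, 1, 4] (p - 1) + hs iv [1, 2, 4] (p - 1) + 4 * hs iv [1, 1, 5] (p - 1))) := by
  have h := reversal hiv hp2 [4, 1, 1] (by omega)
  simp only [List.reverse_cons, List.reverse_nil, drv, evc, List.map_cons, List.map_nil, List.cons_append, List.nil_append, List.append_nil,
    List.sum_cons, List.sum_nil, Nat.reduceAdd,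
    Nat.cast_ofNat, Nat.cast_one] at h
  linear_combination h

lemma st_21_21 : hs iv [2, 1] (p - 1) * hs iv [2, 1] (p - 1) =
    2 * hs iv [2, 1, 2, 1] (p - 1) + 4 * hs iv [2, 2, 1, 1] (p - 1) + 2 * hs iv [2, 2, 2] (p - 1) + 2 * hs iv [2, 3, 1] (p - 1) + 2 * hs iv [4, 1, 1] (p - 1) + hs iv [4, 2] (p - 1) := by
  have h := stuffle iv (p - 1) [2, 1] [2, 1]
  simp only [qsh, ev, List.map_cons, List.map_nil, List.cons_append, List.nil_append, List.append_nil,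
    List.sum_cons, List.sum_nil, Nat.reduceAdd] at h
  linear_combination h

lemma st_21_3 : hs iv [2, 1] (p - 1) * hs iv [3] (p - 1) =
    hs iv [2, 1, 3] (p - 1) + hs iv [2, 3, 1] (p - 1) + hs iv [2, 4] (p - 1) + hs iv [3, 2, 1] (p - 1) + hs iv [5, 1] (p - 1) := by
  have h := stuffle iv (p - 1) [2, 1] [3]
  simp only [qsh, ev, List.map_cons, List.map_nil, List.cons_append, List.nil_append, List.append_nil,
    List.sum_cons, List.sum_nil, Nat.reduceAdd] at h
  linear_combination h

lemma st_3_3 : hs iv [3] (p - 1) * hs iv [3] (p - 1) =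
    2 * hs iv [3, 3] (p - 1) + hs iv [6] (p - 1) := by
  have h := stuffle iv (p - 1) [3] [3]
  simp only [qsh, ev, List.map_cons, List.map_nil, List.cons_append, List.nil_append, List.append_nil,
    List.sum_cons, List.sum_nil, Nat.reduceAdd] at h
  linear_combination h


include hiv hp in
lemma cancelN {x y : R} (h : 3780 * (x - y) = 0) : x = y := by
  have h2 := hiv 2 (by omega) (by omega)
  have h3 := hiv 3 (by omega) (by omega)
  have h5 := hiv 5 (by omega) (by omega)
  have h7 := hiv 7 (by omega) (by omega)
  push_cast at h2 h3 h5 h7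
  have e : (3780 : R) * (iv 2 ^ 2 * iv 3 ^ 3 * iv 5 * iv 7) = 1 := by
    calc (3780 : R) * (iv 2 ^ 2 * iv 3 ^ 3 * iv 5 * iv 7)
        = (2 * iv 2) ^ 2 * (3 * iv 3) ^ 3 * (5 * iv 5) * (7 * iv 7) := by ring
      _ = 1 := by rw [h2, h3, h5, h7]; ring
  linear_combination (iv 2 ^ 2 * iv 3 ^ 3 * iv 5 * iv 7) * h - (x - y) * e

include hiv hp2 hp in
lemma ph1 : p * hs iv [1] (p - 1) = 0 := by
  have h := rev_1 hiv hp2 hp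
  apply cancelN hiv hp
  linear_combination 1890 * p * h - 1890 * hs iv [2] (p - 1) * hp2
include hiv hp2 hp in
lemma ph2 : p * hs iv [2] (p - 1) = 0 := by
  have h := ph1 hiv hp2 hp
  have h1 := st_1_1 (iv := iv) (p := p)
  have h2 := dual_2 hiv hp2 hp
  apply cancelN hiv hp
  linear_combination (exp := 1) 2520 * p * h2 + 1260 * p * h1 - 1260 * hs iv [1] (p - 1) * h + 2520 * (hs iv [2, 1] (p - 1) + hs iv [3] (p - 1)) * hp2
include hiv hp2 hp in
lemma vh1 : hs iv [1] (p - 1) = 0 := by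
  have h := rev_1 hiv hp2 hp
  have h2 := ph2 hiv hp2 hp
  apply cancelN hiv hp
  linear_combination 1890 * h - 1890 * h2
include hiv hp2 hp in
lemma ph3 : p * hs iv [3] (p - 1) = 0 := by
  have h := rev_3 hiv hp2 hp
  apply cancelN hiv hp
  linear_combination 1890 * p * h - 1890 * 3 * hs iv [4] (p - 1) * hp2
include hiv hp2 hp hb in
lemma ph12 : p * hs iv [1, 2] (p - 1) = -(p * (3 * b)) := by
  have h := rev_21 hiv hp2 hp
  linear_combination p * h - hb - (hs iv [2, 2] (p - 1) + 2 * hs iv [1, 3] (p - 1)) * hp2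
include hiv hp2 hp hb in
lemma ph111 : p * hs iv [1, 1, 1] (p - 1) = 0 := by
  have h := ph12 hiv hp2 hp hb
  have h1 := vh1 hiv hp2 hp
  have h2 := st_1_11 (iv := iv) (p := p)
  apply cancelN hiv hp
  linear_combination -1260 * p * h2 + 1260 * p * hs iv [1, 1] (p - 1) * h1 - 1260 * h - 1260 * hb
include hiv hp2 hp hb in
lemma vh2 : hs iv [2] (p - 1) = 2 * p * b := by
  have h1 := vh1 hiv hp2 hp
  have h2 := st_1_1 (iv := iv) (p := p)
  have h3 := dual_2 hiv hp2 hp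
  have h4 := ph3 hiv hp2 hp
  have h5 := ph12 hiv hp2 hp hb
  apply cancelN hiv hp
  linear_combination 2520 * h3 + 1260 * h2 + 2520 * h4 + 2520 * hb - 1260 * hs iv [1] (p - 1) * h1
include hiv hp2 hp hb in
lemma vh11 : hs iv [1, 1] (p - 1) = -(p * b) := by
  have h1 := vh1 hiv hp2 hp
  have h2 := st_1_1 (iv := iv) (p := p)
  have h3 := vh2 hiv hp2 hp hb
  apply cancelN hiv hp
  linear_combination -1890 * h2 + 1890 * hs iv [1] (p - 1) * h1 - 1890 * h3

include hiv hp2 hp hb in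
lemma r5st_1_211 : hs iv [1, 2, 1, 1] (p - 1) + 3 * hs iv [2, 1, 1, 1] (p - 1) + hs iv [2, 1, 2] (p - 1) + hs iv [2, 2, 1] (p - 1) + hs iv [3, 1, 1] (p - 1) = 0 * (p * b ^ 2) := by
  linear_combination -st_1_211 (iv := iv) (p := p) + hs iv [2, 1, 1] (p - 1) * (vh1 hiv hp2 hp)

include hiv hp2 hp hb in
lemma r5st_1_31 : hs iv [1, 3, 1] (p - 1) + 2 * hs iv [3, 1, 1] (p - 1) + hs iv [3, 2] (p - 1) + hs iv [4, 1] (p - 1) = 0 * (p * b ^ 2) := by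
  linear_combination -st_1_31 (iv := iv) (p := p) + hs iv [3, 1] (p - 1) * (vh1 hiv hp2 hp)

include hiv hp2 hp hb in
lemma r5st_1_4 : hs iv [1, 4] (p - 1) + hs iv [4, 1] (p - 1) + hs iv [5] (p - 1) = 0 * (p * b ^ 2) := by
  linear_combination -st_1_4 (iv := iv) (p := p) + hs iv [4] (p - 1) * (vh1 hiv hp2 hp)

include hiv hp2 hp hb in
lemma r5st_11_111 : 10 * hs iv [1, 1, 1, 1, 1] (p - 1) + 3 * hs iv [1, 1, 1, 2] (p - 1) + 3 * hs iv [1, 1, 2, 1] (p - 1) + 3 * hs iv [1, 2, 1, 1] (p - 1) + hs iv [1, 2, 2] (p - 1) + 3 * hs iv [2, 1, 1, 1] (p - 1) + hs iv [2, 1, 2] (p - 1) + hs iv [2, 2, 1] (p - 1) = 0 * (p * b ^ 2) := by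
  linear_combination -st_11_111 (iv := iv) (p := p) + hs iv [1, 1, 1] (p - 1) * (vh11 hiv hp2 hp hb) + -1 * b * (ph111 hiv hp2 hp hb)

include hiv hp2 hp hb in
lemma r5st_11_21 : hs iv [1, 1, 2, 1] (p - 1) + 2 * hs iv [1, 2, 1, 1] (p - 1) + hs iv [1, 2, 2] (p - 1) + hs iv [1, 3, 1] (p - 1) + 3 * hs iv [2, 1, 1, 1] (p - 1) + hs iv [2, 1, 2] (p - 1) + hs iv [2, 2, 1] (p - 1) + 2 * hs iv [3, 1, 1] (p - 1) + hs iv [3, 2] (p - 1) = -3 * (p * b ^ 2) := by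
  linear_combination -st_11_21 (iv := iv) (p := p) + hs iv [2, 1] (p - 1) * (vh11 hiv hp2 hp hb) + -1 * b * (hb)

include hiv hp2 hp hb in
lemma r5st_11_3 : hs iv [1, 1, 3] (p - 1) + hs iv [1, 3, 1] (p - 1) + hs iv [1, 4] (p - 1) + hs iv [3, 1, 1] (p - 1) + hs iv [4, 1] (p - 1) = 0 * (p * b ^ 2) := by
  linear_combination -st_11_3 (iv := iv) (p := p) + hs iv [3] (p - 1) * (vh11 hiv hp2 hp hb) + -1 * b * (ph3 hiv hp2 hp)

include hiv hp2 hp hb in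
lemma r5st_2_111 : hs iv [2, 1, 1, 1] (p - 1) + hs iv [1, 2, 1, 1] (p - 1) + hs iv [1, 1, 2, 1] (p - 1) + hs iv [1, 1, 1, 2] (p - 1) + hs iv [1, 1, 3] (p - 1) + hs iv [1, 3, 1] (p - 1) + hs iv [3, 1, 1] (p - 1) = 0 * (p * b ^ 2) := by
  linear_combination -st_2_111 (iv := iv) (p := p) + hs iv [1, 1, 1] (p - 1) * (vh2 hiv hp2 hp hb) + 2 * b * (ph111 hiv hp2 hp hb)

include hiv hp2 hp hb in
lemma r5st_2_12 : hs iv [2, 1, 2] (p - 1) + 2 * hs iv [1, 2, 2] (p - 1) + hs iv [1, 4] (p - 1) + hs iv [3, 2] (p - 1) = -6 * (p * b ^ 2) := by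
  linear_combination -st_2_12 (iv := iv) (p := p) + hs iv [1, 2] (p - 1) * (vh2 hiv hp2 hp hb) + 2 * b * (ph12 hiv hp2 hp hb)

include hiv hp2 hp hb in
lemma r5st_2_21 : 2 * hs iv [2, 2, 1] (p - 1) + hs iv [2, 1, 2] (p - 1) + hs iv [2, 3] (p - 1) + hs iv [4, 1] (p - 1) = 6 * (p * b ^ 2) := by
  linear_combination -st_2_21 (iv := iv) (p := p) + hs iv [2, 1] (p - 1) * (vh2 hiv hp2 hp hb) + 2 * b * (hb)

include hiv hp2 hp hb in
lemma r5st_2_3 : hs iv [2, 3] (p - 1) + hs iv [3, 2] (p - 1) + hs iv [5] (p - 1) = 0 * (p * b ^ 2) := by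
  linear_combination -st_2_3 (iv := iv) (p := p) + hs iv [3] (p - 1) * (vh2 hiv hp2 hp hb) + 2 * b * (ph3 hiv hp2 hp)

include hiv hp2 hp in
lemma r6rev_321 : p * hs iv [3, 2, 1] (p - 1) = p * hs iv [1, 2, 3] (p - 1) := by
  linear_combination p * rev_321 hiv hp2 hp + (hs iv [2, 2, 3] (p - 1) + 2 * hs iv [1, 3, 3] (p - 1) + 3 * hs iv [1, 2, 4] (p - 1)) * hp2

include hiv hp2 hp in
lemma r6rev_411 : p * hs iv [4, 1, 1] (p - 1) = p * hs iv [1, 1, 4] (p - 1) := by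
  linear_combination p * rev_411 hiv hp2 hp + (hs iv [2, 1, 4] (p - 1) + hs iv [1, 2, 4] (p - 1) + 4 * hs iv [1, 1, 5] (p - 1)) * hp2

include hiv hp2 hp hb in
lemma r6st_21_21 : p * (2 * hs iv [2, 1, 2, 1] (p - 1) + 4 * hs iv [2, 2, 1, 1] (p - 1) + 2 * hs iv [2, 2, 2] (p - 1) + 2 * hs iv [2, 3, 1] (p - 1) + 2 * hs iv [4, 1, 1] (p - 1) + hs iv [4, 2] (p - 1)) = 9 * (p * b ^ 2) := by
  linear_combination -p * st_21_21 (iv := iv) (p := p) + hs iv [2, 1] (p - 1) * (hb) + 3 * b * (hb)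

include hiv hp2 hp hb in
lemma r6st_21_3 : p * (hs iv [2, 1, 3] (p - 1) + hs iv [2, 3, 1] (p - 1) + hs iv [2, 4] (p - 1) + hs iv [3, 2, 1] (p - 1) + hs iv [5, 1] (p - 1)) = 0 * (p * b ^ 2) := by
  linear_combination -p * st_21_3 (iv := iv) (p := p) + hs iv [3] (p - 1) * (hb) + 3 * b * (ph3 hiv hp2 hp)

include hiv hp2 hp hb in
lemma r6st_3_3 : p * (2 * hs iv [3, 3] (p - 1) + hs iv [6] (p - 1)) = 0 * (p * b ^ 2) := by
  linear_combination -p * st_3_3 (iv := iv) (p := p) + hs iv [3] (p - 1) * (ph3 hiv hp2 hp) + 0 * b * (ph3 hiv hp2 hp)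

include hiv hp2 hp hb in
lemma target0 : hS iv [1, 3, 1] (p - 1) = hs iv [1, 3, 1] (p - 1) := by
  rw [star_exp iv [1, 3, 1]]
  simp only [st, ev, List.map_cons, List.map_nil, List.cons_append, List.nil_append, List.append_nil,
    List.sum_cons, List.sum_nil, Nat.reduceAdd]
  apply cancelN hiv hp
  linear_combination (3780) * r5st_1_4 hiv hp2 hp hb

include hiv hp2 hp hb in
lemma target1 : hs iv [1, 3, 1] (p - 1) = 0 := by
  apply cancelN hiv hp
  linear_combination (792) * r5st_11_111 hiv hp2 hp hb
    + (414) * r5st_2_21 hiv hp2 hp hb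
    + (-9534) * r5st_2_3 hiv hp2 hp hb
    + (-5490) * r5st_1_4 hiv hp2 hp hb
    + (-5184) * r5st_11_3 hiv hp2 hp hb
    + (4194) * r5st_2_12 hiv hp2 hp hb
    + (7560) * r5st_1_211 hiv hp2 hp hb
    + (5544) * r5st_2_111 hiv hp2 hp hb
    + (-7920) * dual_5 hiv hp2 hp
    + (312) * rev_5 hiv hp2 hp
    + (-720) * rev_14 hiv hp2 hp
    + (2760) * rev_23 hiv hp2 hp
    + (5640) * r6st_3_3 hiv hp2 hp hb
    + (7560) * dual_23 hiv hp2 hp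
    + (-5040) * r6rev_321 hiv hp2 hp
    + (10080) * r6st_21_3 hiv hp2 hp hb
    + (3780) * r5st_1_31 hiv hp2 hp hb
    + (-5040) * rev_311 hiv hp2 hp
    + (-840) * rev_32 hiv hp2 hp
    + (1260) * rev_212 hiv hp2 hp
    + (5040) * rev_113 hiv hp2 hp
    + (-15120) * r6rev_411 hiv hp2 hp
    + (-1260) * rev_122 hiv hp2 hp
    + (-7560) * r5st_11_21 hiv hp2 hp hb
    + (7560) * dual_32 hiv hp2 hp

include hiv hp2 hp hb in
lemma target2 : hS iv [2, 1, 2] (p - 1) = hs iv [2, 1, 2] (p - 1) := by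
  rw [star_exp iv [2, 1, 2]]
  simp only [st, ev, List.map_cons, List.map_nil, List.cons_append, List.nil_append, List.append_nil,
    List.sum_cons, List.sum_nil, Nat.reduceAdd]
  apply cancelN hiv hp
  linear_combination (3780) * r5st_2_3 hiv hp2 hp hb

include hiv hp2 hp hb in
lemma target3 : hs iv [2, 1, 2] (p - 1) = -3 * p * b ^ 2 := by
  apply cancelN hiv hp
  linear_combination (624) * r5st_2_12 hiv hp2 hp hb
    + (-3084) * r5st_11_3 hiv hp2 hp hb
    + (624) * r5st_2_21 hiv hp2 hp hb
    + (-6244) * r5st_2_3 hiv hp2 hp hb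
    + (-3180) * r5st_1_4 hiv hp2 hp hb
    + (84) * r5st_2_111 hiv hp2 hp hb
    + (2520) * dual_23 hiv hp2 hp
    + (872) * rev_5 hiv hp2 hp
    + (-520) * r6st_3_3 hiv hp2 hp hb
    + (-840) * r6rev_321 hiv hp2 hp
    + (-840) * r6st_21_3 hiv hp2 hp hb
    + (1170) * rev_14 hiv hp2 hp
    + (870) * rev_23 hiv hp2 hp
    + (910) * rev_32 hiv hp2 hp
    + (420) * rev_212 hiv hp2 hp
    + (1680) * rev_113 hiv hp2 hp
    + (-2520) * r6rev_411 hiv hp2 hp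
    + (372) * r5st_11_111 hiv hp2 hp hb
    + (-3720) * dual_5 hiv hp2 hp
    + (2520) * dual_14 hiv hp2 hp
    + (630) * rev_41 hiv hp2 hp
    + (840) * rev_131 hiv hp2 hp
    + (-420) * rev_221 hiv hp2 hp
    + (2520) * dual_32 hiv hp2 hp
    + (2520) * dual_41 hiv hp2 hp
    + (-2520) * dual_221 hiv hp2 hp
    + (-1260) * r6st_21_21 hiv hp2 hp hb

include hiv hp2 hp hb in
lemma target4 : hS iv [2, 3] (p - 1) = hs iv [2, 3] (p - 1) := by
  rw [star_exp iv [2, 3]]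
  simp only [st, ev, List.map_cons, List.map_nil, List.cons_append, List.nil_append, List.append_nil,
    List.sum_cons, List.sum_nil, Nat.reduceAdd]
  apply cancelN hiv hp
  linear_combination (-1350) * r5st_1_4 hiv hp2 hp hb
    + (-810) * r5st_11_3 hiv hp2 hp hb
    + (-1215) * r5st_2_12 hiv hp2 hp hb
    + (-1215) * r5st_2_21 hiv hp2 hp hb
    + (-1260) * r5st_2_3 hiv hp2 hp hb
    + (-1890) * r5st_2_111 hiv hp2 hp hb
    + (-270) * r5st_11_111 hiv hp2 hp hb
    + (2700) * dual_5 hiv hp2 hp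
    + (495) * rev_5 hiv hp2 hp
    + (675) * rev_14 hiv hp2 hp
    + (-225) * rev_23 hiv hp2 hp
    + (225) * r6st_3_3 hiv hp2 hp hb

include hiv hp2 hp hb in
lemma target5 : hs iv [2, 3] (p - 1) = 2 * hS iv [4, 1] (p - 1) := by
  rw [star_exp iv [4, 1]]
  simp only [st, ev, List.map_cons, List.map_nil, List.cons_append, List.nil_append, List.append_nil,
    List.sum_cons, List.sum_nil, Nat.reduceAdd]
  apply cancelN hiv hp
  linear_combination (-5325) * r5st_1_4 hiv hp2 hp hb
    + (5352) * r5st_11_3 hiv hp2 hp hb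
    + (5047) * r5st_2_3 hiv hp2 hp hb
    + (-7560) * r5st_1_31 hiv hp2 hp hb
    + (3780) * r5st_11_21 hiv hp2 hp hb
    + (-7560) * r5st_1_211 hiv hp2 hp hb
    + (384) * r5st_11_111 hiv hp2 hp hb
    + (888) * r5st_2_21 hiv hp2 hp hb
    + (888) * r5st_2_12 hiv hp2 hp hb
    + (5208) * r5st_2_111 hiv hp2 hp hb
    + (-3840) * dual_5 hiv hp2 hp
    + (199) * rev_5 hiv hp2 hp
    + (720) * rev_14 hiv hp2 hp
    + (-2760) * rev_23 hiv hp2 hp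
    + (-4835) * r6st_3_3 hiv hp2 hp hb
    + (-2520) * dual_23 hiv hp2 hp
    + (4620) * r6rev_321 hiv hp2 hp
    + (-6720) * r6st_21_3 hiv hp2 hp hb
    + (7560) * rev_311 hiv hp2 hp
    + (4445) * rev_32 hiv hp2 hp
    + (-420) * rev_212 hiv hp2 hp
    + (-5460) * rev_113 hiv hp2 hp
    + (13860) * r6rev_411 hiv hp2 hp
    + (1890) * rev_122 hiv hp2 hp
    + (8820) * dual_14 hiv hp2 hp
    + (2205) * rev_41 hiv hp2 hp
    + (2940) * rev_131 hiv hp2 hp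
    + (-1470) * rev_221 hiv hp2 hp
    + (-6300) * dual_32 hiv hp2 hp
    + (-2520) * dual_41 hiv hp2 hp
    + (2520) * dual_221 hiv hp2 hp
    + (1260) * r6st_21_21 hiv hp2 hp hb

include hiv hp2 hp hb in
lemma target6 : 2 * hS iv [4, 1] (p - 1) = 2 * hs iv [4, 1] (p - 1) := by
  rw [star_exp iv [4, 1]]
  simp only [st, ev, List.map_cons, List.map_nil, List.cons_append, List.nil_append, List.append_nil,
    List.sum_cons, List.sum_nil, Nat.reduceAdd]
  apply cancelN hiv hp
  linear_combination (-2700) * r5st_1_4 hiv hp2 hp hb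
    + (-1620) * r5st_11_3 hiv hp2 hp hb
    + (-2430) * r5st_2_12 hiv hp2 hp hb
    + (-2430) * r5st_2_21 hiv hp2 hp hb
    + (-2520) * r5st_2_3 hiv hp2 hp hb
    + (-3780) * r5st_2_111 hiv hp2 hp hb
    + (-540) * r5st_11_111 hiv hp2 hp hb
    + (5400) * dual_5 hiv hp2 hp
    + (990) * rev_5 hiv hp2 hp
    + (1350) * rev_14 hiv hp2 hp
    + (-450) * rev_23 hiv hp2 hp
    + (450) * r6st_3_3 hiv hp2 hp hb

include hiv hp2 hp hb in
lemma target7 : 2 * hS iv [2, 2, 1] (p - 1) - 3 * hs iv [4, 1] (p - 1) = 9 * p * b ^ 2 := by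
  rw [star_exp iv [2, 2, 1]]
  simp only [st, ev, List.map_cons, List.map_nil, List.cons_append, List.nil_append, List.append_nil,
    List.sum_cons, List.sum_nil, Nat.reduceAdd]
  apply cancelN hiv hp
  linear_combination (6251) * r5st_2_3 hiv hp2 hp hb
    + (-4596) * r5st_2_12 hiv hp2 hp hb
    + (-816) * r5st_2_21 hiv hp2 hp hb
    + (-7545) * r5st_1_4 hiv hp2 hp hb
    + (3780) * r5st_11_21 hiv hp2 hp hb
    + (-7560) * r5st_1_31 hiv hp2 hp hb
    + (-1068) * r5st_11_111 hiv hp2 hp hb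
    + (10680) * dual_5 hiv hp2 hp
    + (1307) * rev_5 hiv hp2 hp
    + (2250) * rev_14 hiv hp2 hp
    + (-4530) * rev_23 hiv hp2 hp
    + (-3415) * r6st_3_3 hiv hp2 hp hb
    + (5196) * r5st_11_3 hiv hp2 hp hb
    + (-2436) * r5st_2_111 hiv hp2 hp hb
    + (-5040) * dual_23 hiv hp2 hp
    + (5460) * r6rev_321 hiv hp2 hp
    + (-5880) * r6st_21_3 hiv hp2 hp hb
    + (7560) * rev_311 hiv hp2 hp
    + (3535) * rev_32 hiv hp2 hp
    + (-840) * rev_212 hiv hp2 hp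
    + (-7140) * rev_113 hiv hp2 hp
    + (16380) * r6rev_411 hiv hp2 hp
    + (1890) * rev_122 hiv hp2 hp
    + (-7560) * r5st_1_211 hiv hp2 hp hb
    + (6300) * dual_14 hiv hp2 hp
    + (1575) * rev_41 hiv hp2 hp
    + (2100) * rev_131 hiv hp2 hp
    + (-1050) * rev_221 hiv hp2 hp
    + (-8820) * dual_32 hiv hp2 hp
    + (-5040) * dual_41 hiv hp2 hp
    + (5040) * dual_221 hiv hp2 hp
    + (2520) * r6st_21_21 hiv hp2 hp hb

include hiv hp2 hp hb in
lemma target8 : 2 * hS iv [1, 1, 3] (p - 1) = -2 * hS iv [3, 1, 1] (p - 1) := by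
  rw [star_exp iv [3, 1, 1]]
  rw [star_exp iv [1, 1, 3]]
  simp only [st, ev, List.map_cons, List.map_nil, List.cons_append, List.nil_append, List.append_nil,
    List.sum_cons, List.sum_nil, Nat.reduceAdd]
  apply cancelN hiv hp
  linear_combination (8280) * r5st_1_4 hiv hp2 hp hb
    + (24108) * r5st_2_3 hiv hp2 hp hb
    + (-15120) * r5st_1_211 hiv hp2 hp hb
    + (-2124) * r5st_11_111 hiv hp2 hp hb
    + (21240) * dual_5 hiv hp2 hp
    + (366) * rev_5 hiv hp2 hp
    + (2790) * rev_14 hiv hp2 hp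
    + (-5970) * rev_23 hiv hp2 hp
    + (-10830) * r6st_3_3 hiv hp2 hp hb
    + (16308) * r5st_11_3 hiv hp2 hp hb
    + (-10818) * r5st_2_12 hiv hp2 hp hb
    + (-3258) * r5st_2_21 hiv hp2 hp hb
    + (-14868) * r5st_2_111 hiv hp2 hp hb
    + (-15120) * dual_23 hiv hp2 hp
    + (10080) * r6rev_321 hiv hp2 hp
    + (-20160) * r6st_21_3 hiv hp2 hp hb
    + (-7560) * r5st_1_31 hiv hp2 hp hb
    + (10080) * rev_311 hiv hp2 hp
    + (1680) * rev_32 hiv hp2 hp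
    + (-2520) * rev_212 hiv hp2 hp
    + (-10080) * rev_113 hiv hp2 hp
    + (30240) * r6rev_411 hiv hp2 hp
    + (2520) * rev_122 hiv hp2 hp
    + (15120) * r5st_11_21 hiv hp2 hp hb
    + (-15120) * dual_32 hiv hp2 hp

include hiv hp2 hp hb in
lemma target9 : -2 * hS iv [3, 1, 1] (p - 1) = -2 * hs iv [1, 1, 3] (p - 1) := by
  rw [star_exp iv [3, 1, 1]]
  simp only [st, ev, List.map_cons, List.map_nil, List.cons_append, List.nil_append, List.append_nil,
    List.sum_cons, List.sum_nil, Nat.reduceAdd]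
  apply cancelN hiv hp
  linear_combination (-7560) * r5st_1_4 hiv hp2 hp hb
    + (-7560) * r5st_1_31 hiv hp2 hp hb
    + (7560) * r5st_11_3 hiv hp2 hp hb

include hiv hp2 hp hb in
lemma target10 : -2 * hs iv [1, 1, 3] (p - 1) = 2 * hs iv [3, 1, 1] (p - 1) := by
  apply cancelN hiv hp
  linear_combination (15120) * r5st_1_211 hiv hp2 hp hb
    + (2124) * r5st_11_111 hiv hp2 hp hb
    + (-21240) * dual_5 hiv hp2 hp
    + (-366) * rev_5 hiv hp2 hp
    + (-720) * r5st_1_4 hiv hp2 hp hb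
    + (-16548) * r5st_2_3 hiv hp2 hp hb
    + (-2790) * rev_14 hiv hp2 hp
    + (5970) * rev_23 hiv hp2 hp
    + (10830) * r6st_3_3 hiv hp2 hp hb
    + (-16308) * r5st_11_3 hiv hp2 hp hb
    + (10818) * r5st_2_12 hiv hp2 hp hb
    + (3258) * r5st_2_21 hiv hp2 hp hb
    + (14868) * r5st_2_111 hiv hp2 hp hb
    + (15120) * dual_23 hiv hp2 hp
    + (-10080) * r6rev_321 hiv hp2 hp
    + (20160) * r6st_21_3 hiv hp2 hp hb
    + (7560) * r5st_1_31 hiv hp2 hp hb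
    + (-10080) * rev_311 hiv hp2 hp
    + (-1680) * rev_32 hiv hp2 hp
    + (2520) * rev_212 hiv hp2 hp
    + (10080) * rev_113 hiv hp2 hp
    + (-30240) * r6rev_411 hiv hp2 hp
    + (-2520) * rev_122 hiv hp2 hp
    + (-15120) * r5st_11_21 hiv hp2 hp hb
    + (15120) * dual_32 hiv hp2 hp

include hiv hp2 hp hb in
lemma target11 : 2 * hs iv [3, 1, 1] (p - 1) = hs iv [4, 1] (p - 1) := by
  apply cancelN hiv hp
  linear_combination (-15120) * r5st_1_211 hiv hp2 hp hb
    + (11340) * r5st_11_21 hiv hp2 hp hb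
    + (-7560) * r5st_1_31 hiv hp2 hp hb
    + (-1218) * r5st_11_111 hiv hp2 hp hb
    + (12180) * dual_5 hiv hp2 hp
    + (1372) * rev_5 hiv hp2 hp
    + (-3885) * r5st_1_4 hiv hp2 hp hb
    + (7021) * r5st_2_3 hiv hp2 hp hb
    + (3465) * rev_14 hiv hp2 hp
    + (-6195) * rev_23 hiv hp2 hp
    + (-9800) * r6st_3_3 hiv hp2 hp hb
    + (8106) * r5st_11_3 hiv hp2 hp hb
    + (-6951) * r5st_2_12 hiv hp2 hp hb
    + (-3171) * r5st_2_21 hiv hp2 hp hb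
    + (-6006) * r5st_2_111 hiv hp2 hp hb
    + (-10080) * dual_23 hiv hp2 hp
    + (9660) * r6rev_321 hiv hp2 hp
    + (-16800) * r6st_21_3 hiv hp2 hp hb
    + (12600) * rev_311 hiv hp2 hp
    + (5285) * rev_32 hiv hp2 hp
    + (-1680) * rev_212 hiv hp2 hp
    + (-10500) * rev_113 hiv hp2 hp
    + (28980) * r6rev_411 hiv hp2 hp
    + (3150) * rev_122 hiv hp2 hp
    + (8820) * dual_14 hiv hp2 hp
    + (2205) * rev_41 hiv hp2 hp
    + (2940) * rev_131 hiv hp2 hp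
    + (-1470) * rev_221 hiv hp2 hp
    + (-13860) * dual_32 hiv hp2 hp
    + (-2520) * dual_41 hiv hp2 hp
    + (2520) * dual_221 hiv hp2 hp
    + (1260) * r6st_21_21 hiv hp2 hp hb

end algebra
end WF

namespace WF
section transfer

lemma map_hs {R S : Type*} [CommRing R] [CommRing S] (φ : R →+* S) (iv : ℕ → R) (l : List ℕ) :
    ∀ n, φ (hs iv l n) = hs (fun k => φ (iv k)) l n := by
  induction l with
  | nil => intro n; simp [hs]
  | cons s t ih => intro n; simp [hs, map_sum, ih]

lemma map_hS {R S : Type*} [CommRing R] [CommRing S] (φ : R →+* S) (iv : ℕ → R) (l : List ℕ) :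
    ∀ n, φ (hS iv l n) = hS (fun k => φ (iv k)) l n := by
  induction l with
  | nil => intro n; simp [hS]
  | cons s t ih => intro n; simp [hS, map_sum, ih]

variable (p : ℕ) [hpf : Fact p.Prime]

/-- inverses of natural numbers in the p-adic integers -/
noncomputable def ivp (k : ℕ) : ℤ_[p] := (k : ℤ_[p]).inv

lemma ivp_mul (k : ℕ) (h0 : 0 < k) (h1 : k < p) : (k : ℤ_[p]) * ivp p k = 1 := by
  apply PadicInt.mul_inv
  rw [PadicInt.norm_natCast_eq_one_iff]
  exact (Nat.coprime_of_lt_prime h0.ne' h1 hpf.out)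

lemma ivp_coe (k : ℕ) (h0 : 0 < k) (h1 : k < p) :
    ((ivp p k : ℤ_[p]) : ℚ_[p]) = ((k : ℚ_[p]))⁻¹ := by
  have h := congrArg (fun x : ℤ_[p] => (x : ℚ_[p])) (ivp_mul p k h0 h1)
  simp only [PadicInt.coe_mul, PadicInt.coe_natCast, PadicInt.coe_one] at h
  exact eq_inv_of_mul_eq_one_right h

lemma coe_hs (l : List ℕ) : ∀ n, n < p →
    ((hs (ivp p) l n : ℤ_[p]) : ℚ_[p]) = ((AMHS n (posComp l) : ℚ) : ℚ_[p]) := by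
  induction l with
  | nil => intro n _; simp [hs, posComp, AMHS]
  | cons s t ih =>
    intro n hn
    have e : posComp (s :: t) = (s, 1) :: posComp t := rfl
    rw [e]
    simp only [hs, AMHS, PadicInt.coe_sum, Rat.cast_sum]
    refine Finset.sum_congr rfl fun k hk => ?_
    rw [Finset.mem_Icc] at hk
    rw [PadicInt.coe_mul, PadicInt.coe_pow, ih _ (by omega), ivp_coe p k (by omega) (by omega)]
    simp

lemma coe_hS (l : List ℕ) : ∀ n, n < p →
    ((hS (ivp p) l n : ℤ_[p]) : ℚ_[p]) = ((AMHSstar n (posComp l) : ℚ) : ℚ_[p]) := by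
  induction l with
  | nil => intro n _; simp [hS, posComp, AMHSstar]
  | cons s t ih =>
    intro n hn
    have e : posComp (s :: t) = (s, 1) :: posComp t := rfl
    rw [e]
    simp only [hS, AMHSstar, PadicInt.coe_sum, Rat.cast_sum]
    refine Finset.sum_congr rfl fun k hk => ?_
    rw [Finset.mem_Icc] at hk
    rw [PadicInt.coe_mul, PadicInt.coe_pow, ih _ (by omega), ivp_coe p k (by omega) (by omega)]
    simp

lemma bridge (x y : ℤ_[p]) (a b : ℚ) (hx : (x : ℚ_[p]) = (a : ℚ_[p]))
    (hy : (y : ℚ_[p]) = (b : ℚ_[p]))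
    (h : PadicInt.toZModPow 2 x = PadicInt.toZModPow 2 y) : RatModEq p 2 a b := by
  by_cases hab : a = b
  · exact Or.inl hab
  right
  have h1 : x - y ∈ RingHom.ker (PadicInt.toZModPow (p := p) 2) := by
    rw [RingHom.mem_ker, map_sub, h, sub_self]
  rw [PadicInt.ker_toZModPow, ← PadicInt.norm_le_pow_iff_mem_span_pow] at h1
  have h2 : ‖((a - b : ℚ) : ℚ_[p])‖ ≤ (p : ℝ) ^ (-((2 : ℕ) : ℤ)) := by
    rw [Rat.cast_sub, ← hx, ← hy, ← PadicInt.coe_sub]; exact h1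
  have hne : a - b ≠ 0 := sub_ne_zero.mpr hab
  rw [Padic.eq_padicNorm, padicNorm.eq_zpow_of_nonzero hne] at h2
  push_cast at h2
  have hp1 : (1 : ℝ) < p := by exact_mod_cast hpf.out.one_lt
  have h3 := (zpow_le_zpow_iff_right₀ hp1).mp h2
  push_cast; omega

lemma bern_int (i : ℕ) : i + 1 < p → ∃ z : ℤ_[p], (z : ℚ_[p]) = ((bernoulli i : ℚ) : ℚ_[p]) := by
  induction i using Nat.strong_induction_on with
  | _ i ih =>
    intro hi
    have h := sum_bernoulli (i + 1)
    rw [Finset.sum_range_succ] at h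
    have ih' : ∀ j : ℕ, ∃ z : ℤ_[p], j < i → (z : ℚ_[p]) = ((bernoulli j : ℚ) : ℚ_[p]) := by
      intro j
      by_cases hj : j < i
      · obtain ⟨z, hz⟩ := ih j hj (by omega); exact ⟨z, fun _ => hz⟩
      · exact ⟨0, fun h => absurd h hj⟩
    choose z hz using ih'
    refine ⟨((if i + 1 = 1 then 1 else 0) - ∑ k ∈ Finset.range i, ((i + 1).choose k : ℤ_[p]) * z k) *
      ivp p (i + 1), ?_⟩
    have h' := congrArg (fun x : ℚ => (x : ℚ_[p])) h
    simp only [Rat.cast_add, Rat.cast_sum, Rat.cast_mul, Rat.cast_natCast] at h'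
    rw [PadicInt.coe_mul, ivp_coe p _ (by omega) hi, PadicInt.coe_sub, PadicInt.coe_sum]
    have e : ∑ k ∈ Finset.range i, ((((i + 1).choose k : ℤ_[p]) * z k : ℤ_[p]) : ℚ_[p]) =
        ∑ k ∈ Finset.range i, ((i + 1).choose k : ℚ_[p]) * ((bernoulli k : ℚ) : ℚ_[p]) := by
      refine Finset.sum_congr rfl fun k hk => ?_
      rw [PadicInt.coe_mul, hz k (Finset.mem_range.mp hk)]; simp
    rw [e]
    have e2 : (((if i + 1 = 1 then 1 else 0 : ℤ_[p])) : ℚ_[p]) =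
        (((if i + 1 = 1 then 1 else 0 : ℚ)) : ℚ_[p]) := by split_ifs <;> simp
    rw [e2, ← h']
    have : ((i + 1 : ℕ) : ℚ_[p]) ≠ 0 := by exact_mod_cast Nat.succ_ne_zero i
    simp only [Nat.choose_succ_self_right]
    field_simp
    ring

end transfer

lemma powsum (p : ℕ) [hpf : Fact p.Prime] (m : ℕ) :
    ∑ k ∈ Finset.Icc 1 (p - 1), (k : ZMod p) ^ m = if p - 1 ∣ m then -1 else 0 := by
  have h := FiniteField.sum_pow_units (ZMod p) m
  rw [ZMod.card] at h
  rw [← h]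
  symm
  refine Finset.sum_bij (fun (x : (ZMod p)ˣ) _ => (x : ZMod p).val) ?_ ?_ ?_ ?_
  · intro x _
    have h1 := ZMod.val_lt (x : ZMod p)
    have h2 : (x : ZMod p).val ≠ 0 := by
      rw [Ne, ZMod.val_eq_zero]; exact x.ne_zero
    rw [Finset.mem_Icc]; omega
  · intro x _ y _ hxy
    exact Units.ext (ZMod.val_injective p hxy)
  · intro k hk
    rw [Finset.mem_Icc] at hk
    have hk0 : (k : ZMod p) ≠ 0 := by
      rw [Ne, ZMod.natCast_eq_zero_iff]
      intro hd; have := Nat.le_of_dvd (by omega) hd; omega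
    refine ⟨Units.mk0 (k : ZMod p) hk0, Finset.mem_univ _, ?_⟩
    simp only [Units.val_mk0]
    exact ZMod.val_cast_of_lt (by omega)
  · intro x _
    simp

lemma faulhaber (q : ℕ) [hpf : Fact (q + 3).Prime] (z : ℕ → ℤ_[q + 3])
    (hz : ∀ i, i < q + 2 → (z i : ℚ_[q + 3]) = ((bernoulli i : ℚ) : ℚ_[q + 3])) (k : ℕ) :
    ((q + 2 : ℕ) : ℤ_[q + 3]) * ∑ j ∈ Finset.range k, (j : ℤ_[q + 3]) ^ (q + 1) =
      ∑ i ∈ Finset.range (q + 2), z i * ((q + 2).choose i : ℤ_[q + 3]) *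
        (k : ℤ_[q + 3]) ^ (q + 2 - i) := by
  have h := sum_range_pow k (q + 1)
  have hne : ((q + 2 : ℕ) : ℚ) ≠ 0 := by positivity
  have h2 : ((q + 2 : ℕ) : ℚ) * ∑ j ∈ Finset.range k, (j : ℚ) ^ (q + 1) =
      ∑ i ∈ Finset.range (q + 2), bernoulli i * ((q + 2).choose i : ℚ) *
        (k : ℚ) ^ (q + 2 - i) := by
    rw [h, Finset.mul_sum]
    refine Finset.sum_congr rfl fun i _ => ?_
    push_cast at hne ⊢
    have : ((q : ℚ) + 1 + 1) ≠ 0 := by rw [add_assoc]; norm_num; exact hne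
    field_simp
    ring
  have h3 := congrArg (fun x : ℚ => (x : ℚ_[q + 3])) h2
  simp only [Rat.cast_sum, Rat.cast_mul, Rat.cast_natCast, Rat.cast_pow] at h3
  refine PadicInt.ext ?_
  rw [PadicInt.coe_mul, PadicInt.coe_sum, PadicInt.coe_sum]
  simp only [PadicInt.coe_mul, PadicInt.coe_pow, PadicInt.coe_natCast]
  rw [h3]
  refine Finset.sum_congr rfl fun i hi => ?_
  rw [hz i (Finset.mem_range.mp hi)]

lemma h21_mod (q : ℕ) [hpf : Fact (q + 3).Prime] (z : ℕ → ℤ_[q + 3])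
    (hz : ∀ i, i < q + 2 → (z i : ℚ_[q + 3]) = ((bernoulli i : ℚ) : ℚ_[q + 3])) (hq : 0 < q) :
    PadicInt.toZMod (hs (ivp (q + 3)) [2, 1] (q + 2)) = PadicInt.toZMod (z q) := by
  have hiv : ∀ k, 0 < k → k < q + 3 →
      PadicInt.toZMod (ivp (q + 3) k) = (k : ZMod (q + 3)) ^ (q + 1) := by
    intro k h0 h1
    have e := congrArg PadicInt.toZMod (ivp_mul (q + 3) k h0 h1)
    rw [map_mul, map_natCast, map_one] at e
    have hk0 : (k : ZMod (q + 3)) ≠ 0 := by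
      intro h; rw [h, zero_mul] at e; exact zero_ne_one e
    have f := ZMod.pow_card_sub_one_eq_one hk0
    apply mul_left_cancel₀ hk0
    rw [e, ← pow_succ']; exact f.symm
  have hL : PadicInt.toZMod (hs (ivp (q + 3)) [2, 1] (q + 2)) =
      ∑ k ∈ Finset.Icc 1 (q + 2), (k : ZMod (q + 3)) ^ q *
        PadicInt.toZMod (∑ j ∈ Finset.range k, (j : ℤ_[q + 3]) ^ (q + 1)) := by
    simp only [hs, map_sum, map_mul, map_pow, mul_one, pow_one, map_natCast]
    refine Finset.sum_congr rfl fun k hk => ?_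
    rw [Finset.mem_Icc] at hk
    have hk0 : (k : ZMod (q + 3)) ≠ 0 := by
      rw [Ne, ZMod.natCast_eq_zero_iff]
      intro hd; have := Nat.le_of_dvd (by omega) hd; omega
    have f : (k : ZMod (q + 3)) ^ (q + 2) = 1 := ZMod.pow_card_sub_one_eq_one hk0
    have e1 : PadicInt.toZMod (ivp (q + 3) k) ^ 2 = (k : ZMod (q + 3)) ^ q := by
      rw [hiv k (by omega) (by omega), ← pow_mul, show (q + 1) * 2 = q + (q + 2) by ring, pow_add,
        f, mul_one]
    rw [e1]
    congr 1
    obtain ⟨m, rfl⟩ : ∃ m, k = m + 1 := ⟨k - 1, by omega⟩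
    rw [Finset.sum_range_succ', Nat.add_sub_cancel, sum_Icc_range]
    simp only [Nat.cast_zero, ne_eq, Nat.succ_ne_zero, not_false_eq_true, zero_pow, add_zero]
    refine Finset.sum_congr rfl fun j hj => ?_
    have := Finset.mem_range.mp hj
    rw [hiv _ (by omega) (by omega)]
  have hm : ((q + 2 : ℕ) : ZMod (q + 3)) = -1 := by
    have : ((q + 3 : ℕ) : ZMod (q + 3)) = 0 := ZMod.natCast_self _
    push_cast at this ⊢
    linear_combination this
  have hF : ∀ k : ℕ, PadicInt.toZMod (∑ j ∈ Finset.range k, (j : ℤ_[q + 3]) ^ (q + 1)) =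
      - ∑ i ∈ Finset.range (q + 2), PadicInt.toZMod (z i) * ((q + 2).choose i : ZMod (q + 3)) *
        (k : ZMod (q + 3)) ^ (q + 2 - i) := by
    intro k
    have e := congrArg PadicInt.toZMod (faulhaber q z hz k)
    rw [map_mul, map_natCast, hm, map_sum (PadicInt.toZMod) _ (Finset.range (q + 2))] at e
    simp only [map_mul, map_pow, map_natCast] at e
    linear_combination -e
  rw [hL]
  simp only [hF, mul_neg, Finset.sum_neg_distrib, Finset.mul_sum]
  rw [Finset.sum_comm]
  have hS : ∀ i ∈ Finset.range (q + 2), ∑ k ∈ Finset.Icc 1 (q + 2), (k : ZMod (q + 3)) ^ q *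
      (PadicInt.toZMod (z i) * ((q + 2).choose i : ZMod (q + 3)) *
        (k : ZMod (q + 3)) ^ (q + 2 - i)) =
      if i = q then - (PadicInt.toZMod (z i) * ((q + 2).choose i : ZMod (q + 3))) else 0 := by
    intro i hi
    have hi := Finset.mem_range.mp hi
    have e : ∀ k : ℕ, (k : ZMod (q + 3)) ^ q *
      (PadicInt.toZMod (z i) * ((q + 2).choose i : ZMod (q + 3)) *
        (k : ZMod (q + 3)) ^ (q + 2 - i)) =
        (PadicInt.toZMod (z i) * ((q + 2).choose i : ZMod (q + 3))) *
          (k : ZMod (q + 3)) ^ (q + (q + 2 - i)) := by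
      intro k; rw [pow_add]; ring
    simp only [e]
    rw [← Finset.mul_sum]
    have := powsum (q + 3) (q + (q + 2 - i))
    rw [show q + 3 - 1 = q + 2 by omega] at this
    rw [this]
    by_cases h : i = q
    · subst h
      rw [if_pos (by simp), if_pos rfl]; ring
    · rw [if_neg, if_neg h, mul_zero]
      rintro ⟨c, hc⟩
      have : c = 1 := by
        rcases c with _ | _ | c
        · omega
        · rfl
        · exfalso
          have : (q + 2) * (c + 1 + 1) = (q + 2) * c + 2 * (q + 2) := by ring
          omega
      subst this; omega
  rw [Finset.sum_congr rfl hS]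
  rw [Finset.sum_ite_eq' (Finset.range (q + 2)) q, if_pos (by simp)]
  have hc : ((q + 2).choose q : ZMod (q + 3)) = 1 := by
    have h1 : (q + 2).choose q * 2 = (q + 2) * (q + 1) := by
      have : (q + 2).choose q = (q + 2).choose 2 := by
        rw [← Nat.choose_symm (show q ≤ q + 2 by omega)]; congr 1; omega
      rw [this, Nat.choose_two_right, Nat.div_mul_cancel]
      · rfl
      · exact (Nat.even_mul_pred_self (q + 2)).two_dvd
    have h2 := congrArg (fun n : ℕ => (n : ZMod (q + 3))) h1
    simp only [Nat.cast_mul] at h2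
    rw [hm] at h2
    have h20 : ((2 : ℕ) : ZMod (q + 3)) ≠ 0 := by
      rw [Ne, ZMod.natCast_eq_zero_iff]
      intro hd; have := Nat.le_of_dvd (by omega) hd; omega
    apply mul_right_cancel₀ h20
    rw [h2]
    push_cast at hm ⊢
    linear_combination -hm
  rw [hc]; ring

lemma hb_aux (p : ℕ) [hpf : Fact p.Prime] (x y : ℤ_[p])
    (h : PadicInt.toZMod x = PadicInt.toZMod y) :
    (p : ZMod (p ^ 2)) * PadicInt.toZModPow 2 x = p * PadicInt.toZModPow 2 y := by
  have h1 : x - y ∈ RingHom.ker (PadicInt.toZMod (p := p)) := by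
    rw [RingHom.mem_ker, map_sub, h, sub_self]
  rw [PadicInt.ker_toZMod, PadicInt.maximalIdeal_eq_span_p, Ideal.mem_span_singleton] at h1
  obtain ⟨c, hc⟩ := h1
  have e := congrArg (PadicInt.toZModPow (p := p) 2) hc
  rw [map_sub, map_mul, map_natCast] at e
  have hp2 : (p : ZMod (p ^ 2)) ^ 2 = 0 := by
    rw [← Nat.cast_pow]; exact ZMod.natCast_self _
  linear_combination (p : ZMod (p ^ 2)) * e + PadicInt.toZModPow 2 c * hp2

lemma setup (p : ℕ) [hpf : Fact p.Prime] (hp : 10 < p) :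
    ∃ b : ℤ_[p], (b : ℚ_[p]) = ((bernoulli (p - 3) / 3 : ℚ) : ℚ_[p]) ∧
      (p : ZMod (p ^ 2)) * hs (fun k => PadicInt.toZModPow 2 (ivp p k)) [2, 1] (p - 1) =
        p * (3 * PadicInt.toZModPow 2 b) := by
  obtain ⟨q, rfl⟩ : ∃ q, p = q + 3 := ⟨p - 3, by omega⟩
  have hz' : ∀ i : ℕ, ∃ z : ℤ_[q + 3], i < q + 2 →
      (z : ℚ_[q + 3]) = ((bernoulli i : ℚ) : ℚ_[q + 3]) := by
    intro i
    by_cases hi : i < q + 2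
    · obtain ⟨z, hz⟩ := bern_int (q + 3) i (by omega); exact ⟨z, fun _ => hz⟩
    · exact ⟨0, fun h => absurd h hi⟩
  choose z hz using hz'
  refine ⟨z q * ivp (q + 3) 3, ?_, ?_⟩
  · rw [PadicInt.coe_mul, hz q (by omega), ivp_coe (q + 3) 3 (by omega) (by omega)]
    simp [div_eq_mul_inv]
  · rw [← map_hs]
    have h := hb_aux (q + 3) _ _ (h21_mod q z hz (by omega))
    rw [show q + 3 - 1 = q + 2 by omega, h]
    have e := congrArg (PadicInt.toZModPow (p := q + 3) 2)
      (ivp_mul (q + 3) 3 (by omega) (by omega))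
    rw [map_mul, map_natCast, map_one] at e
    push_cast at e
    rw [map_mul]
    linear_combination (-((q + 3 : ℕ) : ZMod ((q + 3) ^ 2)) * PadicInt.toZModPow 2 (z q)) * e

end WF

/-- Theorem `thm:wt5FMZVleve2IDs`, weight-5 FMZVs of superbity 2.
For all sufficiently large primes `p`, with `β = B_{p-3}/3`, modulo `p²`:
(1) `H⋆(1,3,1) ≡ H(1,3,1) ≡ 0`;
(2) `H⋆(2,1,2) ≡ H(2,1,2) ≡ -3pβ²`;
(3) `H⋆(2,3) ≡ H(2,3) ≡ 2H⋆(4,1) ≡ 2H(4,1)`;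
(4) `2H⋆(2,2,1) - 3H(4,1) ≡ 9pβ²`;
(5) `2H⋆(1,1,3) ≡ -2H⋆(3,1,1) ≡ -2H(1,1,3) ≡ 2H(3,1,1) ≡ H(4,1)`
(all sums with upper index `p-1`). -/
theorem weight_five_superbity_two :
    ∃ N, ∀ p ≥ N, Nat.Prime p →
      (RatModEq p 2 (AMHSstar (p - 1) (posComp [1, 3, 1])) (AMHS (p - 1) (posComp [1, 3, 1])) ∧
        RatModEq p 2 (AMHS (p - 1) (posComp [1, 3, 1])) 0) ∧
      (RatModEq p 2 (AMHSstar (p - 1) (posComp [2, 1, 2])) (AMHS (p - 1) (posComp [2, 1, 2])) ∧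
        RatModEq p 2 (AMHS (p - 1) (posComp [2, 1, 2]))
          (-3 * (p : ℚ) * (bernoulli (p - 3) / 3) ^ 2)) ∧
      (RatModEq p 2 (AMHSstar (p - 1) (posComp [2, 3])) (AMHS (p - 1) (posComp [2, 3])) ∧
        RatModEq p 2 (AMHS (p - 1) (posComp [2, 3])) (2 * AMHSstar (p - 1) (posComp [4, 1])) ∧
        RatModEq p 2 (2 * AMHSstar (p - 1) (posComp [4, 1]))
          (2 * AMHS (p - 1) (posComp [4, 1]))) ∧
      RatModEq p 2 (2 * AMHSstar (p - 1) (posComp [2, 2, 1]) - 3 * AMHS (p - 1) (posComp [4, 1]))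
        (9 * (p : ℚ) * (bernoulli (p - 3) / 3) ^ 2) ∧
      (RatModEq p 2 (2 * AMHSstar (p - 1) (posComp [1, 1, 3]))
          (-2 * AMHSstar (p - 1) (posComp [3, 1, 1])) ∧
        RatModEq p 2 (-2 * AMHSstar (p - 1) (posComp [3, 1, 1]))
          (-2 * AMHS (p - 1) (posComp [1, 1, 3])) ∧
        RatModEq p 2 (-2 * AMHS (p - 1) (posComp [1, 1, 3]))
          (2 * AMHS (p - 1) (posComp [3, 1, 1])) ∧
        RatModEq p 2 (2 * AMHS (p - 1) (posComp [3, 1, 1]))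
          (AMHS (p - 1) (posComp [4, 1]))) := by
  refine ⟨11, fun p hp hpp => ?_⟩
  have : Fact p.Prime := ⟨hpp⟩
  have hp' : 10 < p := hp
  obtain ⟨b, hbc, hb⟩ := WF.setup p hp'
  have hiv : ∀ k, 0 < k → k < p →
      (k : ZMod (p ^ 2)) * (fun k => PadicInt.toZModPow 2 (WF.ivp p k)) k = 1 := by
    intro k h0 h1
    have e := congrArg (PadicInt.toZModPow (p := p) 2) (WF.ivp_mul p k h0 h1)
    rwa [map_mul, map_natCast, map_one] at e
  have hp2 : (p : ZMod (p ^ 2)) ^ 2 = 0 := by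
    rw [← Nat.cast_pow]; exact ZMod.natCast_self _
  have hlt : p - 1 < p := by omega
  have hs := fun l => WF.coe_hs p l (p - 1) hlt
  have hS := fun l => WF.coe_hS p l (p - 1) hlt
  have ms := fun l => WF.map_hs (PadicInt.toZModPow (p := p) 2) (WF.ivp p) l (p - 1)
  have mS := fun l => WF.map_hS (PadicInt.toZModPow (p := p) 2) (WF.ivp p) l (p - 1)
  have c2 : ((2 : ℤ_[p]) : ℚ_[p]) = 2 := map_ofNat (PadicInt.Coe.ringHom (p := p)) 2
  have c3 : ((3 : ℤ_[p]) : ℚ_[p]) = 3 := map_ofNat (PadicInt.Coe.ringHom (p := p)) 3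
  have c9 : ((9 : ℤ_[p]) : ℚ_[p]) = 9 := map_ofNat (PadicInt.Coe.ringHom (p := p)) 9
  have two : ∀ (x : ℤ_[p]) (a : ℚ), (x : ℚ_[p]) = (a : ℚ_[p]) →
      ((2 * x : ℤ_[p]) : ℚ_[p]) = ((2 * a : ℚ) : ℚ_[p]) := by
    intro x a h; push_cast; rw [h, c2]
  have mtwo : ∀ (x : ℤ_[p]) (a : ℚ), (x : ℚ_[p]) = (a : ℚ_[p]) →
      ((-2 * x : ℤ_[p]) : ℚ_[p]) = ((-2 * a : ℚ) : ℚ_[p]) := by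
    intro x a h; push_cast; rw [h, c2]
  have f2 : PadicInt.toZModPow (p := p) 2 2 = 2 := map_ofNat _ 2
  have f3 : PadicInt.toZModPow (p := p) 2 3 = 3 := map_ofNat _ 3
  have f9 : PadicInt.toZModPow (p := p) 2 9 = 9 := map_ofNat _ 9
  refine ⟨⟨?_, ?_⟩, ⟨?_, ?_⟩, ⟨?_, ?_, ?_⟩, ?_, ?_, ?_, ?_, ?_⟩
  · refine WF.bridge p _ _ _ _ (hS _) (hs _) ?_
    rw [ms, mS]; exact WF.target0 hiv hp2 hp' hb
  · refine WF.bridge p _ 0 _ _ (hs _) (by simp) ?_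
    rw [ms, map_zero]; exact WF.target1 hiv hp2 hp' hb
  · refine WF.bridge p _ _ _ _ (hS _) (hs _) ?_
    rw [ms, mS]; exact WF.target2 hiv hp2 hp' hb
  · refine WF.bridge p _ (-3 * p * b ^ 2) _ _ (hs _) (by push_cast; rw [hbc, c3]; push_cast; ring) ?_
    rw [ms, map_mul, map_mul, map_pow, map_neg, f3, map_natCast]
    exact WF.target3 hiv hp2 hp' hb
  · refine WF.bridge p _ _ _ _ (hS _) (hs _) ?_
    rw [ms, mS]; exact WF.target4 hiv hp2 hp' hb
  · refine WF.bridge p _ _ _ _ (hs _) (two _ _ (hS _)) ?_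
    rw [map_mul, f2, ms, mS]; exact WF.target5 hiv hp2 hp' hb
  · refine WF.bridge p _ _ _ _ (two _ _ (hS _)) (two _ _ (hs _)) ?_
    rw [map_mul, map_mul, f2, ms, mS]; exact WF.target6 hiv hp2 hp' hb
  · refine WF.bridge p (2 * WF.hS (WF.ivp p) [2, 2, 1] (p - 1) - 3 * WF.hs (WF.ivp p) [4, 1] (p - 1))
      (9 * p * b ^ 2) _ _ (by push_cast; rw [hs, hS, c2, c3]) (by push_cast; rw [hbc, c9]; push_cast; ring) ?_
    rw [map_sub, map_mul, map_mul, map_mul, map_mul, map_pow, f2, f3, f9, map_natCast, ms, mS]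
    exact WF.target7 hiv hp2 hp' hb
  · refine WF.bridge p _ _ _ _ (two _ _ (hS _)) (mtwo _ _ (hS _)) ?_
    rw [map_mul, map_mul, map_neg, f2, mS, mS]; exact WF.target8 hiv hp2 hp' hb
  · refine WF.bridge p _ _ _ _ (mtwo _ _ (hS _)) (mtwo _ _ (hs _)) ?_
    rw [map_mul, map_mul, map_neg, f2, ms, mS]; exact WF.target9 hiv hp2 hp' hb
  · refine WF.bridge p _ _ _ _ (mtwo _ _ (hs _)) (two _ _ (hs _)) ?_
    rw [map_mul, map_mul, map_neg, f2, ms, ms]; exact WF.target10 hiv hp2 hp' hb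
  · refine WF.bridge p _ _ _ _ (two _ _ (hs _)) (hs _) ?_
    rw [map_mul, f2, ms, ms]; exact WF.target11 hiv hp2 hp' hb
end

section
/- For all sufficiently large primes p, writing β = B_{p−3}/3, the following congruences modulo p hold: H_{p−1}(1,3,2) ≡ −(9/2)β², H_{p−1}(1,4,1) ≡ 3β², H_{p−1}(1,1,4) ≡ −(3/2)β², H_{p−1}(2,1,3) ≡ (3/2)β², H_{p−1}(2,3,1) ≡ −(9/2)β², H_{p−1}(3,1,2) ≡ (3/2)β², H_{p−1}(3,2,1) ≡ 3β², H_{p−1}(4,1,1) ≡ −(3/2)β², H_{p−1}(1,2,3) ≡ 3β². Moreover, for each composition 𝐬 listed above one has H^⋆_{p−1}(𝐬) ≡ H_{p−1}(𝐬) (mod p). -/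
open scoped BigOperators

/-- `q` is `p`-integral and reduces to `z` modulo `p`. -/
def Red (p : ℕ) (q : ℚ) (z : ZMod p) : Prop :=
  ∃ a b : ℤ, (b : ZMod p) ≠ 0 ∧ q * b = a ∧ z * b = a

theorem Red.add {p : ℕ} [Fact p.Prime] {q q' : ℚ} {z z' : ZMod p} (h : Red p q z)
    (h' : Red p q' z') : Red p (q + q') (z + z') := by
  obtain ⟨a, b, hb, h1, h2⟩ := h
  obtain ⟨a', b', hb', h1', h2'⟩ := h'
  refine ⟨a * b' + a' * b, b * b', ?_, ?_, ?_⟩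
  · push_cast; exact mul_ne_zero hb hb'
  · push_cast; rw [← h1, ← h1']; ring
  · push_cast; rw [← h2, ← h2']; ring

theorem Red.mul {p : ℕ} [Fact p.Prime] {q q' : ℚ} {z z' : ZMod p} (h : Red p q z)
    (h' : Red p q' z') : Red p (q * q') (z * z') := by
  obtain ⟨a, b, hb, h1, h2⟩ := h
  obtain ⟨a', b', hb', h1', h2'⟩ := h'
  refine ⟨a * a', b * b', ?_, ?_, ?_⟩
  · push_cast; exact mul_ne_zero hb hb'
  · push_cast; rw [← h1, ← h1']; ring
  · push_cast; rw [← h2, ← h2']; ring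

theorem Red.int {p : ℕ} [Fact p.Prime] (n : ℤ) : Red p (n : ℚ) (n : ZMod p) :=
  ⟨n, 1, by simp, by simp, by simp⟩

theorem Red.nat {p : ℕ} [Fact p.Prime] (n : ℕ) : Red p (n : ℚ) (n : ZMod p) :=
  ⟨n, 1, by simp, by simp, by simp⟩

theorem Red.neg {p : ℕ} [Fact p.Prime] {q : ℚ} {z : ZMod p} (h : Red p q z) :
    Red p (-q) (-z) := by
  have := (Red.int (p := p) (-1)).mul h
  simpa using this

theorem Red.sub {p : ℕ} [Fact p.Prime] {q q' : ℚ} {z z' : ZMod p} (h : Red p q z)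
    (h' : Red p q' z') : Red p (q - q') (z - z') := by
  simpa [sub_eq_add_neg] using h.add h'.neg

theorem Red.pow {p : ℕ} [Fact p.Prime] {q : ℚ} {z : ZMod p} (h : Red p q z) (n : ℕ) :
    Red p (q ^ n) (z ^ n) := by
  induction n with
  | zero => simpa using Red.nat (p := p) 1
  | succ n ih => rw [pow_succ, pow_succ]; exact ih.mul h

theorem Red.inv {p : ℕ} [Fact p.Prime] {q : ℚ} {z : ZMod p} (h : Red p q z) (hz : z ≠ 0) :
    Red p q⁻¹ z⁻¹ := by
  obtain ⟨a, b, hb, h1, h2⟩ := h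
  have ha : (a : ZMod p) ≠ 0 := by rw [← h2]; exact mul_ne_zero hz hb
  have hq : q ≠ 0 := by
    rintro rfl
    apply ha
    have : (a : ℚ) = 0 := by rw [← h1]; simp
    have : a = 0 := by exact_mod_cast this
    simp [this]
  refine ⟨b, a, ha, ?_, ?_⟩
  · rw [← h1]; field_simp
  · rw [← h2]; field_simp

theorem Red.div {p : ℕ} [Fact p.Prime] {q q' : ℚ} {z z' : ZMod p} (h : Red p q z)
    (h' : Red p q' z') (hz : z' ≠ 0) : Red p (q / q') (z / z') := by
  rw [div_eq_mul_inv, div_eq_mul_inv]; exact h.mul (h'.inv hz)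

theorem Red.sum {p : ℕ} [Fact p.Prime] {ι : Type} (s : Finset ι) (f : ι → ℚ) (g : ι → ZMod p)
    (h : ∀ i ∈ s, Red p (f i) (g i)) : Red p (∑ i ∈ s, f i) (∑ i ∈ s, g i) := by
  classical
  induction s using Finset.induction_on with
  | empty => simpa using Red.nat (p := p) 0
  | insert a s ha ih =>
    rw [Finset.sum_insert ha, Finset.sum_insert ha]
    exact (h a (by simp)).add (ih fun i hi => h i (by simp [hi]))

theorem Red.zero_eq {p : ℕ} [Fact p.Prime] {z : ZMod p} (h : Red p 0 z) : z = 0 := by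
  obtain ⟨a, b, hb, h1, h2⟩ := h
  have : (a : ℚ) = 0 := by rw [← h1]; simp
  have : a = 0 := by exact_mod_cast this
  subst this
  simpa [hb] using h2

theorem Red.unique {p : ℕ} [Fact p.Prime] {q : ℚ} {z z' : ZMod p} (h : Red p q z)
    (h' : Red p q z') : z = z' := by
  have := h.sub h'
  rw [sub_self] at this
  exact sub_eq_zero.1 this.zero_eq

theorem Red.modEq {p : ℕ} [Fact p.Prime] {q q' : ℚ} {z : ZMod p} (h : Red p q z)
    (h' : Red p q' z) : RatModEq p 1 q q' := by
  have h3 := h.sub h'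
  rw [sub_self] at h3
  unfold RatModEq
  by_cases hq : q = q'
  · exact Or.inl hq
  right
  have hne : q - q' ≠ 0 := sub_ne_zero.2 hq
  obtain ⟨a, b, hb, h1, h2⟩ := h3
  have hb0 : b ≠ 0 := by rintro rfl; simp at hb
  have hbq : (b : ℚ) ≠ 0 := by exact_mod_cast hb0
  have ha0 : a ≠ 0 := by
    rintro rfl
    simp [hne, hb0] at h1
  have hpa : (p : ℤ) ∣ a := by
    rw [← ZMod.intCast_zmod_eq_zero_iff_dvd] 
    rw [← h2]; simp
  have hpb : ¬ (p : ℤ) ∣ b := by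
    rw [← ZMod.intCast_zmod_eq_zero_iff_dvd] 
    exact hb
  have e := padicValRat.mul (p := p) hne hbq
  rw [h1, padicValRat.of_int, padicValRat.of_int, padicValInt.eq_zero_of_not_dvd hpb] at e
  have : 1 ≤ padicValInt p a := by
    have := (padicValInt_dvd_iff (p := p) 1 a).1 (by simpa using hpa)
    tauto
  have : (1 : ℤ) ≤ (padicValInt p a : ℤ) := by exact_mod_cast this
  simp at e ⊢
  omega

/-- Multiple harmonic sums modulo `p`. -/
def Hz (p : ℕ) : ℕ → List ℕ → ZMod p
  | _, [] => 1
  | n, s :: t => ∑ k ∈ Finset.range n, (((k + 1 : ℕ) : ZMod p)⁻¹) ^ s * Hz p k t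

theorem Hz_nil (p n : ℕ) : Hz p n [] = 1 := by simp [Hz]

theorem Hz_zero (p s : ℕ) (t : List ℕ) : Hz p 0 (s :: t) = 0 := by simp [Hz]

theorem Hz_succ (p n s : ℕ) (t : List ℕ) :
    Hz p (n + 1) (s :: t) = Hz p n (s :: t) + (((n + 1 : ℕ) : ZMod p)⁻¹) ^ s * Hz p n t := by
  simp [Hz, Finset.sum_range_succ]

theorem natCast_ne {p k : ℕ} (h0 : 0 < k) (h : k < p) : (k : ZMod p) ≠ 0 := by
  rw [Ne, ZMod.natCast_eq_zero_iff]
  exact fun hd => absurd (Nat.le_of_dvd h0 hd) (by omega)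

theorem AMHS_succ (n s : ℕ) (t : List ℕ) :
    AMHS (n + 1) (posComp (s :: t)) = AMHS n (posComp (s :: t)) +
      (((n + 1 : ℕ) : ℚ)⁻¹) ^ s * AMHS n (posComp t) := by
  simp only [posComp, List.map_cons, AMHS]
  rw [Finset.sum_Icc_succ_top (by omega)]
  simp

theorem AMHS_zero (s : ℕ) (t : List ℕ) : AMHS 0 (posComp (s :: t)) = 0 := by
  simp [posComp, AMHS]

theorem AMHS_nil (n : ℕ) : AMHS n (posComp []) = 1 := by
  simp [posComp, AMHS]

theorem amhsStar_succ (n s : ℕ) (t : List ℕ) :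
    AMHSstar (n + 1) (posComp (s :: t)) = AMHSstar n (posComp (s :: t)) +
      (((n + 1 : ℕ) : ℚ)⁻¹) ^ s * AMHSstar (n + 1) (posComp t) := by
  simp only [posComp, List.map_cons, AMHSstar]
  rw [Finset.sum_Icc_succ_top (by omega)]
  simp

theorem amhsStar_zero (s : ℕ) (t : List ℕ) : AMHSstar 0 (posComp (s :: t)) = 0 := by
  simp [posComp, AMHSstar]

theorem amhsStar_nil (n : ℕ) : AMHSstar n (posComp []) = 1 := by
  simp [posComp, AMHSstar]

theorem amhsStar_one (n a : ℕ) : AMHSstar n (posComp [a]) = AMHS n (posComp [a]) := by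
  induction n with
  | zero => rw [amhsStar_zero, AMHS_zero]
  | succ n ih => rw [amhsStar_succ, AMHS_succ, ih, amhsStar_nil, AMHS_nil]

theorem amhsStar_two (n a b : ℕ) : AMHSstar n (posComp [a, b]) =
    AMHS n (posComp [a, b]) + AMHS n (posComp [a + b]) := by
  induction n with
  | zero => simp [amhsStar_zero, AMHS_zero]
  | succ n ih =>
    rw [amhsStar_succ, amhsStar_one, ih]
    simp only [AMHS_succ, AMHS_nil]
    ring

theorem amhsStar_three (n a b c : ℕ) : AMHSstar n (posComp [a, b, c]) =
    AMHS n (posComp [a, b, c]) + AMHS n (posComp [a + b, c]) + AMHS n (posComp [a, b + c])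
      + AMHS n (posComp [a + b + c]) := by
  induction n with
  | zero => simp [amhsStar_zero, AMHS_zero]
  | succ n ih =>
    rw [amhsStar_succ, amhsStar_two, ih]
    simp only [AMHS_succ, AMHS_nil]
    ring

theorem red_AMHS {p : ℕ} [Fact p.Prime] (n : ℕ) : ∀ (l : List ℕ), n < p →
    Red p (AMHS n (posComp l)) (Hz p n l) := by
  induction n with
  | zero =>
    intro l _
    cases l with
    | nil => rw [AMHS_nil, Hz_nil]; simpa using Red.nat (p := p) 1
    | cons s t => rw [AMHS_zero, Hz_zero]; simpa using Red.nat (p := p) 0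
  | succ n ih =>
    intro l hn
    cases l with
    | nil => rw [AMHS_nil, Hz_nil]; simpa using Red.nat (p := p) 1
    | cons s t =>
      rw [AMHS_succ, Hz_succ]
      exact (ih _ (by omega)).add ((((Red.nat (n + 1)).inv
        (natCast_ne (by omega) hn)).pow s).mul (ih _ (by omega)))

/-- Stuffle product of compositions. -/
def stf : List ℕ → List ℕ → List (List ℕ)
  | [], v => [v]
  | a :: u, [] => [a :: u]
  | a :: u, b :: v =>
    (stf u (b :: v)).map (a :: ·) ++ (stf (a :: u) v).map (b :: ·) ++
      (stf u v).map ((a + b) :: ·)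
termination_by u v => u.length + v.length

theorem map_Hz_zero (p a : ℕ) (L : List (List ℕ)) :
    (List.map (Hz p 0) (L.map (a :: ·))).sum = 0 := by
  induction L with
  | nil => simp
  | cons x L ih => simp only [List.map_cons, List.sum_cons, ih, Hz_zero, add_zero]

theorem map_Hz_succ (p n a : ℕ) (L : List (List ℕ)) :
    (List.map (Hz p (n + 1)) (L.map (a :: ·))).sum = (List.map (Hz p n) (L.map (a :: ·))).sum
      + (((n + 1 : ℕ) : ZMod p)⁻¹) ^ a * (List.map (Hz p n) L).sum := by
  induction L with
  | nil => simp
  | cons x L ih =>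
    simp only [List.map_cons, List.sum_cons, ih, Hz_succ]
    ring

theorem stuffle (p n : ℕ) : ∀ u v : List ℕ,
    ((stf u v).map (Hz p n)).sum = Hz p n u * Hz p n v := by
  induction n with
  | zero =>
    intro u v
    match u, v with
    | [], v => simp [stf, Hz_nil]
    | a :: u, [] => simp [stf, Hz_nil]
    | a :: u, b :: v =>
      simp only [stf, List.map_append, List.sum_append, map_Hz_zero, Hz_zero]
      simp
  | succ n ih =>
    intro u v
    match u, v with
    | [], v => simp [stf, Hz_nil]
    | a :: u, [] => simp [stf, Hz_nil]
    | a :: u, b :: v =>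
      have h0 := ih (a :: u) (b :: v)
      simp only [stf, List.map_append, List.sum_append] at h0
      simp only [stf, List.map_append, List.sum_append, map_Hz_succ, Hz_succ, ih]
      have h1 := ih u (b :: v)
      have h2 := ih (a :: u) v
      linear_combination h0

open PowerSeries in
/-- Generating series of a word in the letters `x₀ = false`, `x₁ = true`. -/
noncomputable def PW (p : ℕ) : List Bool → PowerSeries (ZMod p)
  | [] => 1
  | false :: w => PowerSeries.mk fun n => (n : ZMod p)⁻¹ * coeff n (PW p w)
  | true :: w => PowerSeries.mk fun n =>
      (n : ZMod p)⁻¹ * ∑ m ∈ Finset.range n, coeff m (PW p w)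

/-- The Euler derivation. -/
noncomputable def eul {p : ℕ} (f : PowerSeries (ZMod p)) : PowerSeries (ZMod p) :=
  PowerSeries.mk fun n => (n : ZMod p) * PowerSeries.coeff n f

theorem eul_mul {p : ℕ} (f g : PowerSeries (ZMod p)) : eul (f * g) = eul f * g + f * eul g := by
  ext n
  simp only [eul, PowerSeries.coeff_mk, PowerSeries.coeff_mul, map_add, Finset.mul_sum]
  rw [← Finset.sum_add_distrib]
  refine Finset.sum_congr rfl fun x hx => ?_
  rw [← Finset.HasAntidiagonal.mem_antidiagonal.1 hx]
  push_cast
  ring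

/-- The series `t + t² + ⋯`. -/
noncomputable def geo (p : ℕ) : PowerSeries (ZMod p) :=
  PowerSeries.mk fun n => if n = 0 then 0 else 1

theorem coeff_geo_mul {p : ℕ} (f : PowerSeries (ZMod p)) (n : ℕ) :
    PowerSeries.coeff n (geo p * f) = ∑ m ∈ Finset.range n, PowerSeries.coeff m f := by
  rw [mul_comm, PowerSeries.coeff_mul,
    Finset.Nat.sum_antidiagonal_eq_sum_range_succ
      (fun i j => PowerSeries.coeff i f * PowerSeries.coeff j (geo p)), Finset.sum_range_succ]
  simp only [geo, PowerSeries.coeff_mk]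
  simp only [Nat.sub_self, if_true, mul_zero, add_zero]
  refine Finset.sum_congr rfl fun x hx => ?_
  rw [if_neg (by have := Finset.mem_range.1 hx; omega), mul_one]

/-- The operator attached to a letter. -/
noncomputable def opl (p : ℕ) : Bool → PowerSeries (ZMod p)
  | false => 1
  | true => geo p

/-- Words ending in `x₁`. -/
def okw : List Bool → Prop
  | [] => True
  | false :: w => w ≠ [] ∧ okw w
  | true :: w => okw w

theorem coeff_zero_PW (p : ℕ) [Fact p.Prime] (a : Bool) (w : List Bool) :
    PowerSeries.coeff 0 (PW p (a :: w)) = 0 := by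
  cases a <;> simp [PW]

theorem coeff_PW_cons (p : ℕ) [Fact p.Prime] (a : Bool) (w : List Bool) (n : ℕ) :
    PowerSeries.coeff n (PW p (a :: w)) =
      (n : ZMod p)⁻¹ * PowerSeries.coeff n (opl p a * PW p w) := by
  cases a
  · simp [PW, opl]
  · simp only [PW, opl, PowerSeries.coeff_mk, coeff_geo_mul]

theorem okw_tail {a : Bool} {w : List Bool} (h : okw (a :: w)) : okw w := by
  cases a
  · exact h.2
  · exact h

theorem eul_PW {p : ℕ} [Fact p.Prime] {a : Bool} {w : List Bool} (h : okw (a :: w)) {n : ℕ}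
    (hn : n < p) : PowerSeries.coeff n (eul (PW p (a :: w))) =
      PowerSeries.coeff n (opl p a * PW p w) := by
  simp only [eul, PowerSeries.coeff_mk]
  rw [coeff_PW_cons]
  rcases Nat.eq_zero_or_pos n with rfl | h0
  · cases a
    · obtain ⟨b, w', rfl⟩ := List.exists_cons_of_ne_nil h.1
      simp only [opl, one_mul, coeff_zero_PW, mul_zero]
    · simp only [opl]
      rw [coeff_geo_mul]
      simp
  · have := natCast_ne h0 hn
    field_simp

/-- Shuffle product of words. -/
def shf : List Bool → List Bool → List (List Bool)
  | [], v => [v]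
  | a :: u, [] => [a :: u]
  | a :: u, b :: v => (shf u (b :: v)).map (a :: ·) ++ (shf (a :: u) v).map (b :: ·)
termination_by u v => u.length + v.length

theorem coeff_mul_congr {p : ℕ} {f f' : PowerSeries (ZMod p)} (g : PowerSeries (ZMod p)) (n : ℕ)
    (h : ∀ m ≤ n, PowerSeries.coeff m f = PowerSeries.coeff m f') :
    PowerSeries.coeff n (f * g) = PowerSeries.coeff n (f' * g) := by
  rw [PowerSeries.coeff_mul, PowerSeries.coeff_mul]
  refine Finset.sum_congr rfl fun x hx => ?_
  rw [h _ (by have := Finset.HasAntidiagonal.mem_antidiagonal.1 hx; omega)]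

theorem coeff_opl_congr {p : ℕ} {f f' : PowerSeries (ZMod p)} (a : Bool) (n : ℕ)
    (h : ∀ m ≤ n, PowerSeries.coeff m f = PowerSeries.coeff m f') :
    PowerSeries.coeff n (opl p a * f) = PowerSeries.coeff n (opl p a * f') := by
  rw [mul_comm, mul_comm _ f']
  exact coeff_mul_congr _ _ h

theorem shuffle_series (p : ℕ) [Fact p.Prime] (N : ℕ) : ∀ u v : List Bool,
    u.length + v.length ≤ N → okw u → okw v → ∀ n < p,
    PowerSeries.coeff n (PW p u * PW p v) =
      PowerSeries.coeff n ((shf u v).map (PW p)).sum := by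
  induction N with
  | zero =>
    intro u v hl hu hv n hn
    have h1 : u = [] := List.length_eq_zero_iff.1 (by omega)
    subst h1
    simp [shf, PW]
  | succ N ih =>
    intro u v hl hu hv n hn
    match u, v with
    | [], v => simp [shf, PW]
    | a :: u, [] => simp [shf, PW]
    | a :: u, b :: v =>
      have key : ∀ (c : Bool) (L : List (List Bool)),
          PowerSeries.coeff n ((L.map (c :: ·)).map (PW p)).sum =
            (n : ZMod p)⁻¹ * PowerSeries.coeff n (opl p c * (L.map (PW p)).sum) := by
        intro c L
        induction L with
        | nil => simp
        | cons x L ihL =>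
          simp only [List.map_cons, List.sum_cons, map_add, ihL, coeff_PW_cons, mul_add]
      simp only [shf, List.map_append, List.sum_append, map_add, key]
      simp only [List.length_cons] at hl
      rw [← coeff_opl_congr a n (fun m hm => ih u (b :: v) (by simp only [List.length_cons]; omega)
          (okw_tail hu) hv m (by omega)),
        ← coeff_opl_congr b n (fun m hm => ih (a :: u) v (by simp only [List.length_cons]; omega)
          hu (okw_tail hv) m (by omega))]
      have e : (n : ZMod p) * PowerSeries.coeff n (PW p (a :: u) * PW p (b :: v)) =
          PowerSeries.coeff n (opl p a * (PW p u * PW p (b :: v))) +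
          PowerSeries.coeff n (opl p b * (PW p (a :: u) * PW p v)) := by
        have := congrArg (PowerSeries.coeff n) (eul_mul (PW p (a :: u)) (PW p (b :: v)))
        rw [eul, PowerSeries.coeff_mk, map_add] at this
        rw [this, coeff_mul_congr _ n (fun m hm => eul_PW hu (by omega)),
          mul_comm (PW p (a :: u)) (eul _),
          coeff_mul_congr _ n (fun m hm => eul_PW hv (by omega))]
        congr 2 <;> ring
      rcases Nat.eq_zero_or_pos n with rfl | h0
      · rw [PowerSeries.coeff_mul]
        simp [coeff_zero_PW]
      · rw [← mul_add, ← e]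
        have := natCast_ne h0 hn
        field_simp

/-- The word of a composition. -/
def wdc : List ℕ → List Bool
  | [] => []
  | s :: t => List.replicate (s - 1) false ++ true :: wdc t

theorem okw_wdc : ∀ t, okw (wdc t)
  | [] => trivial
  | s :: t => by
    have : ∀ k, okw (List.replicate k false ++ true :: wdc t) := by
      intro k
      induction k with
      | zero => exact okw_wdc t
      | succ k ih =>
        rw [List.replicate_succ]
        exact ⟨by simp, ih⟩
    exact this _

theorem coeff_wdc (p : ℕ) [Fact p.Prime] (s : ℕ) (hs : 0 < s) (t : List ℕ) (n : ℕ) :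
    PowerSeries.coeff n (PW p (wdc (s :: t))) = ((n : ZMod p)⁻¹) ^ s *
      ∑ m ∈ Finset.range n, PowerSeries.coeff m (PW p (wdc t)) := by
  obtain ⟨k, rfl⟩ : ∃ k, s = k + 1 := ⟨s - 1, by omega⟩
  simp only [wdc, Nat.add_sub_cancel]
  induction k with
  | zero => simp [PW]
  | succ k ih =>
    rw [List.replicate_succ, List.cons_append]
    simp only [PW, PowerSeries.coeff_mk]
    rw [ih (by omega)]
    ring

theorem sum_coeff_wdc (p : ℕ) [Fact p.Prime] : ∀ (t : List ℕ), (∀ s ∈ t, 0 < s) → ∀ n,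
    ∑ m ∈ Finset.range (n + 1), PowerSeries.coeff m (PW p (wdc t)) = Hz p n t
  | [], _, n => by
    simp [wdc, PW, Hz_nil, PowerSeries.coeff_one]
  | s :: t, h, n => by
    have hs : 0 < s := h s (by simp)
    have ih := sum_coeff_wdc p t (fun x hx => h x (by simp [hx]))
    rw [Finset.sum_range_succ', coeff_wdc p s hs]
    simp only [Hz, Finset.range_zero, Finset.sum_empty, mul_zero, add_zero]
    refine Finset.sum_congr rfl fun k _ => ?_
    rw [coeff_wdc p s hs, ih]

theorem sum_coeff_mul {p : ℕ} (f g : PowerSeries (ZMod p)) (N : ℕ) :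
    ∑ n ∈ Finset.range (N + 1), PowerSeries.coeff n (f * g) =
      ∑ k ∈ Finset.range (N + 1), PowerSeries.coeff k f *
        ∑ m ∈ Finset.range (N - k + 1), PowerSeries.coeff m g := by
  induction N with
  | zero => simp
  | succ N ih =>
    rw [Finset.sum_range_succ, ih, PowerSeries.coeff_mul,
      Finset.Nat.sum_antidiagonal_eq_sum_range_succ
        (fun i j => PowerSeries.coeff i f * PowerSeries.coeff j g),
      Finset.sum_range_succ _ (N + 1), Finset.sum_range_succ _ (N + 1), ← add_assoc,
      ← Finset.sum_add_distrib]
    congr 1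
    · refine Finset.sum_congr rfl fun k hk => ?_
      have := Finset.mem_range.1 hk
      rw [show N + 1 - k = N - k + 1 by omega, Finset.sum_range_succ _ (N - k + 1)]
      ring
    · simp

theorem shuffle_rel (p : ℕ) [Fact p.Prime] (a : ℕ) (ha : 0 < a) (v : List ℕ)
    (hv : ∀ s ∈ v, 0 < s) (L : List (List ℕ)) (hL : ∀ l ∈ L, ∀ s ∈ l, 0 < s)
    (h : shf (wdc [a]) (wdc v) = L.map wdc) :
    (L.map (Hz p (p - 1))).sum = (-1) ^ a * Hz p (p - 1) (a :: v) := by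
  have hp : 0 < p := (Fact.out : p.Prime).pos
  have e1 : (L.map (Hz p (p - 1))).sum =
      ∑ n ∈ Finset.range (p - 1 + 1), PowerSeries.coeff n (PW p (wdc [a]) * PW p (wdc v)) := by
    have : ∀ n ∈ Finset.range (p - 1 + 1),
        PowerSeries.coeff n (PW p (wdc [a]) * PW p (wdc v)) =
          PowerSeries.coeff n ((L.map wdc).map (PW p)).sum := by
      intro n hn
      rw [shuffle_series p _ _ _ le_rfl (okw_wdc _) (okw_wdc _) n
        (by have := Finset.mem_range.1 hn; omega), h]
    rw [Finset.sum_congr rfl this]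
    clear this h
    induction L with
    | nil => simp
    | cons x L ih =>
      simp only [List.map_cons, List.sum_cons, map_add, Finset.sum_add_distrib]
      rw [ih (fun l hl => hL l (by simp [hl])), sum_coeff_wdc p x (hL x (by simp))]
  rw [e1, sum_coeff_mul, Finset.sum_range_succ', coeff_wdc p a ha]
  simp only [Finset.range_zero, Finset.sum_empty, mul_zero, zero_mul, add_zero]
  rw [Hz, ← Finset.sum_range_reflect, Finset.mul_sum]
  refine Finset.sum_congr rfl fun k hk => ?_
  have hk := Finset.mem_range.1 hk
  rw [coeff_wdc p a ha, sum_coeff_wdc p [] (by simp), sum_coeff_wdc p v hv, Hz_nil, mul_one,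
    show p - 1 - (p - 1 - 1 - k + 1) = k by omega]
  have : ((p - 1 - 1 - k + 1 : ℕ) : ZMod p) = -((k + 1 : ℕ) : ZMod p) := by
    rw [eq_neg_iff_add_eq_zero, ← Nat.cast_add, show p - 1 - 1 - k + 1 + (k + 1) = p by omega]
    simp
  rw [this, inv_neg, neg_pow, mul_assoc]

theorem sum_pow_range (p : ℕ) [Fact p.Prime] (i : ℕ) (hi : i < p - 1) :
    ∑ j ∈ Finset.range p, (j : ZMod p) ^ i = 0 := by
  have hp : 0 < p := (Fact.out : p.Prime).pos
  have h := FiniteField.sum_pow_lt_card_sub_one (ZMod p) i (by rw [ZMod.card]; exact hi)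
  rw [← h]
  refine Finset.sum_bij' (fun j _ => (j : ZMod p)) (fun x _ => x.val) ?_ ?_ ?_ ?_ ?_
  · intro a _; exact Finset.mem_univ _
  · intro a _; exact Finset.mem_range.2 (ZMod.val_lt a)
  · intro a ha; exact ZMod.val_cast_of_lt (Finset.mem_range.1 ha)
  · intro a _; simp
  · intro a _; rfl

theorem inv_pow_eq {p : ℕ} [Fact p.Prime] {x : ZMod p} (hx : x ≠ 0) {s : ℕ} (hs : s ≤ p - 1) :
    (x⁻¹) ^ s = x ^ (p - 1 - s) := by
  have := ZMod.pow_card_sub_one_eq_one hx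
  rw [inv_pow, inv_eq_iff_eq_inv, eq_comm, inv_eq_iff_eq_inv, eq_comm] 
  apply inv_eq_of_mul_eq_one_left
  rw [← pow_add, show p - 1 - s + s = p - 1 by omega, this]

theorem Hz_one (p : ℕ) [Fact p.Prime] (s : ℕ) (h0 : 0 < s) (hs : s < p - 1) :
    Hz p (p - 1) [s] = 0 := by
  have h := sum_pow_range p (p - 1 - s) (by omega)
  obtain ⟨q, rfl⟩ : ∃ q, p = q + 1 := ⟨p - 1, by omega⟩
  rw [Finset.sum_range_succ'] at h
  simp only [Nat.cast_zero] at h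
  rw [zero_pow (by omega), add_zero] at h
  rw [← h]
  simp only [Hz, mul_one, Nat.add_sub_cancel]
  refine Finset.sum_congr rfl fun k hk => ?_
  have hk := Finset.mem_range.1 hk
  rw [inv_pow_eq (natCast_ne (by omega) (by omega)) (by omega)]
  simp

theorem red_bernoulli (p : ℕ) [Fact p.Prime] (i : ℕ) : i + 1 < p →
    ∃ z, Red p (bernoulli i) z := by
  induction i using Nat.strong_induction_on with
  | _ i ih =>
    intro hi
    have h := sum_bernoulli (i + 1)
    rw [Finset.sum_range_succ] at h
    have hS : ∃ z, Red p (∑ k ∈ Finset.range i, ((i + 1).choose k : ℚ) * bernoulli k) z := by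
      have : ∀ k : ℕ, ∃ z, k < i → Red p (bernoulli k) z := by
        intro k
        by_cases hk : k < i
        · obtain ⟨z, hz⟩ := ih k hk (by omega)
          exact ⟨z, fun _ => hz⟩
        · exact ⟨0, fun h => absurd h hk⟩
      choose g hg using this
      exact ⟨_, Red.sum _ _ (fun k => ((i + 1).choose k : ZMod p) * g k) fun k hk =>
        (Red.nat _).mul (hg k (Finset.mem_range.1 hk))⟩
    obtain ⟨z, hz⟩ := hS
    have hC : ∃ c, Red p (if i + 1 = 1 then (1 : ℚ) else 0) c := by
      split_ifs
      · exact ⟨1, by simpa using Red.nat (p := p) 1⟩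
      · exact ⟨0, by simpa using Red.nat (p := p) 0⟩
    obtain ⟨c, hc⟩ := hC
    have hne : ((i + 1 : ℕ) : ℚ) ≠ 0 := by positivity
    have e : bernoulli i = ((if i + 1 = 1 then (1 : ℚ) else 0) -
        ∑ k ∈ Finset.range i, ((i + 1).choose k : ℚ) * bernoulli k) / ((i + 1 : ℕ) : ℚ) := by
      rw [eq_div_iff hne, ← h, Nat.choose_succ_self_right]
      ring
    rw [e]
    exact ⟨_, (hc.sub hz).div (Red.nat (i + 1)) (natCast_ne (by omega) hi)⟩

theorem Hz_one_two (p : ℕ) [Fact p.Prime] (hp : 5 ≤ p) (b : ZMod p)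
    (hb : Red p (bernoulli (p - 3)) b) : Hz p (p - 1) [1, 2] = -b := by
  obtain ⟨r, rfl⟩ : ∃ r, p = r + 3 := ⟨p - 3, by omega⟩
  simp only [Nat.add_sub_cancel] at hb
  have : ∀ k : ℕ, ∃ z, k ≤ r → Red (r + 3) (bernoulli k) z := by
    intro k
    by_cases hk : k ≤ r
    · obtain ⟨z, hz⟩ := red_bernoulli (r + 3) k (by omega)
      exact ⟨z, fun _ => hz⟩
    · exact ⟨0, fun h => absurd h hk⟩
  choose g hg using this
  have hgb : g r = b := (hg r le_rfl).unique hb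
  have hc : ((r + 1 : ℕ) : ZMod (r + 3)) ≠ 0 := natCast_ne (by omega) (by omega)
  have faul : ∀ n : ℕ, ∑ k ∈ Finset.range n, (k : ZMod (r + 3)) ^ r =
      ∑ i ∈ Finset.range (r + 1), g i * ((r + 1).choose i : ZMod (r + 3)) *
        (n : ZMod (r + 3)) ^ (r + 1 - i) / ((r + 1 : ℕ) : ZMod (r + 3)) := by
    intro n
    have h1 := sum_range_pow n r
    have h2 : Red (r + 3) (∑ k ∈ Finset.range n, (k : ℚ) ^ r)
        (∑ k ∈ Finset.range n, (k : ZMod (r + 3)) ^ r) :=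
      Red.sum _ _ _ fun k _ => (Red.nat k).pow r
    rw [h1] at h2
    refine h2.unique (Red.sum _ _ _ fun i hi => ?_)
    have := Finset.mem_range.1 hi
    have h3 := (((hg i (by omega)).mul (Red.nat ((r + 1).choose i))).mul
      ((Red.nat n).pow (r + 1 - i))).div (Red.nat (r + 1)) hc
    simpa using h3
  have inner : ∀ k < r + 2, Hz (r + 3) k [2] =
      ∑ j ∈ Finset.range (k + 1), (j : ZMod (r + 3)) ^ r := by
    intro k hk
    rw [Finset.sum_range_succ', Nat.cast_zero, zero_pow (by omega), add_zero]
    simp only [Hz, mul_one]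
    refine Finset.sum_congr rfl fun j hj => ?_
    have hj := Finset.mem_range.1 hj
    rw [inv_pow_eq (natCast_ne (by omega) (by omega)) (by omega)]
    simp
  have e : Hz (r + 3) (r + 3 - 1) [1, 2] = ∑ i ∈ Finset.range (r + 1),
      g i * ((r + 1).choose i : ZMod (r + 3)) / ((r + 1 : ℕ) : ZMod (r + 3)) *
        ∑ k ∈ Finset.range (r + 2), ((k + 1 : ℕ) : ZMod (r + 3)) ^ (r - i) := by
    simp only [Finset.mul_sum]
    rw [Finset.sum_comm, Hz]
    refine Finset.sum_congr rfl fun k hk => ?_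
    have hk := Finset.mem_range.1 hk
    rw [inner k hk, faul, Finset.mul_sum]
    refine Finset.sum_congr rfl fun i hi => ?_
    have hi := Finset.mem_range.1 hi
    have hk0 : ((k + 1 : ℕ) : ZMod (r + 3)) ≠ 0 := natCast_ne (by omega) (by omega)
    rw [show r + 1 - i = (r - i) + 1 by omega, pow_succ]
    field_simp
    ring
  rw [e, Finset.sum_range_succ, Finset.sum_eq_zero, Nat.sub_self]
  · simp only [pow_zero, Finset.sum_const, Finset.card_range, nsmul_eq_mul, mul_one, zero_add,
      Nat.choose_succ_self_right, hgb]
    have : ((r + 2 : ℕ) : ZMod (r + 3)) = -1 := by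
      rw [eq_neg_iff_add_eq_zero]
      have := ZMod.natCast_self (r + 3)
      rw [← this]; push_cast; ring
    rw [this]
    field_simp
  · intro i hi
    have hi := Finset.mem_range.1 hi
    have h := sum_pow_range (r + 3) (r - i) (by omega)
    rw [Finset.sum_range_succ', Nat.cast_zero, zero_pow (by omega), add_zero] at h
    rw [h, mul_zero]

theorem stuffle_list (p n : ℕ) (u v : List ℕ) (L : List (List ℕ)) (h : stf u v = L) :
    (L.map (Hz p n)).sum = Hz p n u * Hz p n v := by
  rw [← h, stuffle]

set_option maxHeartbeats 4000000 in
theorem core_relations (p : ℕ) [Fact p.Prime] (hp : 10000 ≤ p) (b : ZMod p)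
    (hb : Hz p (p - 1) [1, 2] = -b) :
    Hz p (p - 1) [1, 5] = 0 ∧
    Hz p (p - 1) [2, 4] = 0 ∧
    Hz p (p - 1) [3, 3] = 0 ∧
    Hz p (p - 1) [4, 2] = 0 ∧
    Hz p (p - 1) [5, 1] = 0 ∧
    6 * Hz p (p - 1) [1, 3, 2] = -3 * b ^ 2 ∧
    6 * Hz p (p - 1) [1, 4, 1] = 2 * b ^ 2 ∧
    6 * Hz p (p - 1) [1, 1, 4] = -1 * b ^ 2 ∧
    6 * Hz p (p - 1) [2, 1, 3] = 1 * b ^ 2 ∧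
    6 * Hz p (p - 1) [2, 3, 1] = -3 * b ^ 2 ∧
    6 * Hz p (p - 1) [3, 1, 2] = 1 * b ^ 2 ∧
    6 * Hz p (p - 1) [3, 2, 1] = 2 * b ^ 2 ∧
    6 * Hz p (p - 1) [4, 1, 1] = -1 * b ^ 2 ∧
    6 * Hz p (p - 1) [1, 2, 3] = 2 * b ^ 2 := by
  have z1 := Hz_one p 1 (by norm_num) (by omega)
  have z2 := Hz_one p 2 (by norm_num) (by omega)
  have z3 := Hz_one p 3 (by norm_num) (by omega)
  have z6 := Hz_one p 6 (by norm_num) (by omega)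
  have hb21 : Hz p (p - 1) [2, 1] = b := by
    have h := stuffle_list p (p - 1) [1] [2] [[1, 2], [2, 1], [3]] (by simp [stf])
    simp only [List.map_cons, List.map_nil, List.sum_cons, List.sum_nil] at h
    linear_combination h - hb - z3 + Hz p (p - 1) [2] * z1
  have r0 := stuffle_list p (p - 1) [2, 1] [2, 1]
    [[2, 1, 2, 1], [2, 2, 1, 1], [2, 2, 1, 1], [2, 2, 2], [2, 3, 1], [2, 2, 1, 1], [2, 2, 1, 1], [2, 2, 2], [2, 1, 2, 1], [2, 3, 1], [4, 1, 1], [4, 1, 1], [4, 2]] (by simp [stf])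
  have r1 := stuffle_list p (p - 1) [1] [1, 1, 3]
    [[1, 1, 1, 3], [1, 1, 1, 3], [1, 1, 1, 3], [1, 1, 3, 1], [1, 1, 4], [1, 2, 3], [2, 1, 3]] (by simp [stf])
  have r2 := stuffle_list p (p - 1) [1] [1, 3, 1]
    [[1, 1, 3, 1], [1, 1, 3, 1], [1, 3, 1, 1], [1, 3, 1, 1], [1, 3, 2], [1, 4, 1], [2, 3, 1]] (by simp [stf])
  have r3 := stuffle_list p (p - 1) [1] [3, 1, 1]
    [[1, 3, 1, 1], [3, 1, 1, 1], [3, 1, 1, 1], [3, 1, 1, 1], [3, 1, 2], [3, 2, 1], [4, 1, 1]] (by simp [stf])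
  have r4 := shuffle_rel p 2 (by norm_num) [2, 1, 1] (by simp)
    [[2, 2, 1, 1], [3, 1, 1, 1], [3, 1, 1, 1], [3, 1, 1, 1], [3, 1, 1, 1], [3, 1, 1, 1], [3, 1, 1, 1], [3, 1, 1, 1], [3, 1, 1, 1], [2, 2, 1, 1], [2, 2, 1, 1], [2, 2, 1, 1], [2, 1, 2, 1], [2, 1, 2, 1], [2, 1, 1, 2]] (by simp) (by simp [shf, wdc])
  have r5 := shuffle_rel p 1 (by norm_num) [1, 1, 3] (by simp)
    [[1, 1, 1, 3], [1, 1, 1, 3], [1, 1, 1, 3], [1, 1, 2, 2], [1, 1, 3, 1], [1, 1, 3, 1]] (by simp) (by simp [shf, wdc])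
  have r6 := shuffle_rel p 1 (by norm_num) [1, 2, 2] (by simp)
    [[1, 1, 2, 2], [1, 1, 2, 2], [1, 2, 1, 2], [1, 2, 1, 2], [1, 2, 2, 1], [1, 2, 2, 1]] (by simp) (by simp [shf, wdc])
  have r7 := shuffle_rel p 1 (by norm_num) [1, 3, 1] (by simp)
    [[1, 1, 3, 1], [1, 1, 3, 1], [1, 2, 2, 1], [1, 3, 1, 1], [1, 3, 1, 1], [1, 3, 1, 1]] (by simp) (by simp [shf, wdc])
  have r8 := shuffle_rel p 1 (by norm_num) [2, 1, 2] (by simp)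
    [[1, 2, 1, 2], [2, 1, 1, 2], [2, 1, 1, 2], [2, 1, 1, 2], [2, 1, 2, 1], [2, 1, 2, 1]] (by simp) (by simp [shf, wdc])
  have r9 := shuffle_rel p 1 (by norm_num) [2, 2, 1] (by simp)
    [[1, 2, 2, 1], [2, 1, 2, 1], [2, 1, 2, 1], [2, 2, 1, 1], [2, 2, 1, 1], [2, 2, 1, 1]] (by simp) (by simp [shf, wdc])
  have r10 := shuffle_rel p 1 (by norm_num) [3, 1, 1] (by simp)
    [[1, 3, 1, 1], [2, 2, 1, 1], [3, 1, 1, 1], [3, 1, 1, 1], [3, 1, 1, 1], [3, 1, 1, 1]] (by simp) (by simp [shf, wdc])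
  have r11 := stuffle_list p (p - 1) [2] [3, 1]
    [[2, 3, 1], [3, 2, 1], [3, 1, 2], [3, 3], [5, 1]] (by simp [stf])
  have r12 := stuffle_list p (p - 1) [1] [1, 4]
    [[1, 1, 4], [1, 1, 4], [1, 4, 1], [1, 5], [2, 4]] (by simp [stf])
  have r13 := stuffle_list p (p - 1) [1] [4, 1]
    [[1, 4, 1], [4, 1, 1], [4, 1, 1], [4, 2], [5, 1]] (by simp [stf])
  have r14 := shuffle_rel p 1 (by norm_num) [1, 4] (by simp)
    [[1, 1, 4], [1, 1, 4], [1, 2, 3], [1, 3, 2], [1, 4, 1], [1, 4, 1]] (by simp) (by simp [shf, wdc])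
  have r15 := shuffle_rel p 1 (by norm_num) [2, 3] (by simp)
    [[1, 2, 3], [2, 1, 3], [2, 1, 3], [2, 2, 2], [2, 3, 1], [2, 3, 1]] (by simp) (by simp [shf, wdc])
  have r16 := shuffle_rel p 1 (by norm_num) [3, 2] (by simp)
    [[1, 3, 2], [2, 2, 2], [3, 1, 2], [3, 1, 2], [3, 2, 1], [3, 2, 1]] (by simp) (by simp [shf, wdc])
  have r17 := shuffle_rel p 1 (by norm_num) [4, 1] (by simp)
    [[1, 4, 1], [2, 3, 1], [3, 2, 1], [4, 1, 1], [4, 1, 1], [4, 1, 1]] (by simp) (by simp [shf, wdc])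
  have r18 := shuffle_rel p 2 (by norm_num) [2, 2] (by simp)
    [[2, 2, 2], [3, 1, 2], [3, 1, 2], [3, 2, 1], [3, 2, 1], [3, 1, 2], [3, 1, 2], [3, 2, 1], [3, 2, 1], [2, 2, 2], [2, 3, 1], [2, 3, 1], [2, 3, 1], [2, 3, 1], [2, 2, 2]] (by simp) (by simp [shf, wdc])
  have r19 := stuffle_list p (p - 1) [2] [2, 2]
    [[2, 2, 2], [2, 2, 2], [2, 2, 2], [2, 4], [4, 2]] (by simp [stf])
  have r20 := shuffle_rel p 2 (by norm_num) [3, 1] (by simp)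
    [[2, 3, 1], [3, 2, 1], [4, 1, 1], [4, 1, 1], [4, 1, 1], [3, 2, 1], [4, 1, 1], [4, 1, 1], [4, 1, 1], [4, 1, 1], [4, 1, 1], [4, 1, 1], [3, 2, 1], [3, 2, 1], [3, 1, 2]] (by simp) (by simp [shf, wdc])
  have r21 := stuffle_list p (p - 1) [1] [5]
    [[1, 5], [5, 1], [6]] (by simp [stf])
  have r22 := stuffle_list p (p - 1) [2] [4]
    [[2, 4], [4, 2], [6]] (by simp [stf])
  have r23 := shuffle_rel p 3 (by norm_num) [3] (by simp)
    [[3, 3], [4, 2], [5, 1], [5, 1], [4, 2], [5, 1], [5, 1], [5, 1], [5, 1], [4, 2], [4, 2], [5, 1], [5, 1], [5, 1], [5, 1], [4, 2], [5, 1], [5, 1], [4, 2], [3, 3]] (by simp) (by simp [shf, wdc])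
  have r24 := stuffle_list p (p - 1) [3] [3]
    [[3, 3], [3, 3], [6]] (by simp [stf])
  simp only [List.map_cons, List.map_nil, List.sum_cons, List.sum_nil, add_zero] at r0 r1 r2 r3 r4 r5 r6 r7 r8 r9 r10 r11 r12 r13 r14 r15 r16 r17 r18 r19 r20 r21 r22 r23 r24
  refine ⟨?_, ?_, ?_, ?_, ?_, ?_, ?_, ?_, ?_, ?_, ?_, ?_, ?_, ?_⟩
  · have hD : ((12 : ℕ) : ZMod p) ≠ 0 := natCast_ne (by norm_num) (by omega)
    refine mul_left_cancel₀ hD ?_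
    push_cast
    linear_combination (-12) * r11 + (-12) * Hz p (p - 1) [3, 1] * z2 + (3) * r18 + (-2) * r19 + (-2) * Hz p (p - 1) [2, 2] * z2 + (12) * r21 + (12) * Hz p (p - 1) [5] * z1 + (2) * r22 + (2) * Hz p (p - 1) [4] * z2 + (6) * r24 + (6) * Hz p (p - 1) [3] * z3 + (-20) * z6
  · have hD : ((12 : ℕ) : ZMod p) ≠ 0 := natCast_ne (by norm_num) (by omega)
    refine mul_left_cancel₀ hD ?_
    push_cast
    linear_combination (24) * r11 + (24) * Hz p (p - 1) [3, 1] * z2 + (-6) * r18 + (4) * r19 + (4) * Hz p (p - 1) [2, 2] * z2 + (8) * r22 + (8) * Hz p (p - 1) [4] * z2 + (-2) * r23 + (-9) * r24 + (-9) * Hz p (p - 1) [3] * z3 + (1) * z6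
  · have hD : ((2 : ℕ) : ZMod p) ≠ 0 := natCast_ne (by norm_num) (by omega)
    refine mul_left_cancel₀ hD ?_
    push_cast
    linear_combination (1) * r24 + (1) * Hz p (p - 1) [3] * z3 + (-1) * z6
  · have hD : ((12 : ℕ) : ZMod p) ≠ 0 := natCast_ne (by norm_num) (by omega)
    refine mul_left_cancel₀ hD ?_
    push_cast
    linear_combination (-24) * r11 + (-24) * Hz p (p - 1) [3, 1] * z2 + (6) * r18 + (-4) * r19 + (-4) * Hz p (p - 1) [2, 2] * z2 + (4) * r22 + (4) * Hz p (p - 1) [4] * z2 + (2) * r23 + (9) * r24 + (9) * Hz p (p - 1) [3] * z3 + (-13) * z6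
  · have hD : ((12 : ℕ) : ZMod p) ≠ 0 := natCast_ne (by norm_num) (by omega)
    refine mul_left_cancel₀ hD ?_
    push_cast
    linear_combination (12) * r11 + (12) * Hz p (p - 1) [3, 1] * z2 + (-3) * r18 + (2) * r19 + (2) * Hz p (p - 1) [2, 2] * z2 + (-2) * r22 + (-2) * Hz p (p - 1) [4] * z2 + (-6) * r24 + (-6) * Hz p (p - 1) [3] * z3 + (8) * z6
  · have hD : ((48 : ℕ) : ZMod p) ≠ 0 := natCast_ne (by norm_num) (by omega)
    refine mul_left_cancel₀ hD ?_
    push_cast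
    linear_combination (-144) * r0 + (-144) * (Hz p (p - 1) [2, 1] + b) * hb21 + (48) * r1 + (48) * Hz p (p - 1) [1, 1, 3] * z1 + (408) * r2 + (408) * Hz p (p - 1) [1, 3, 1] * z1 + (-240) * r3 + (-240) * Hz p (p - 1) [3, 1, 1] * z1 + (36) * r4 + (-36) * r5 + (12) * r6 + (-264) * r7 + (-12) * r8 + (120) * r9 + (108) * r10 + (-24) * r12 + (-24) * Hz p (p - 1) [1, 4] * z1 + (264) * r13 + (264) * Hz p (p - 1) [4, 1] * z1 + (-24) * r15 + (-60) * r16 + (-324) * r17 + (63) * r18 + (82) * r19 + (82) * Hz p (p - 1) [2, 2] * z2 + (108) * r20 + (24) * r21 + (24) * Hz p (p - 1) [5] * z1 + (-58) * r22 + (-58) * Hz p (p - 1) [4] * z2 + (-24) * r23 + (36) * r24 + (36) * Hz p (p - 1) [3] * z3 + (-2) * z6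
  · have hD : ((72 : ℕ) : ZMod p) ≠ 0 := natCast_ne (by norm_num) (by omega)
    refine mul_left_cancel₀ hD ?_
    push_cast
    linear_combination (144) * r0 + (144) * (Hz p (p - 1) [2, 1] + b) * hb21 + (-48) * r1 + (-48) * Hz p (p - 1) [1, 1, 3] * z1 + (-408) * r2 + (-408) * Hz p (p - 1) [1, 3, 1] * z1 + (240) * r3 + (240) * Hz p (p - 1) [3, 1, 1] * z1 + (-36) * r4 + (36) * r5 + (-12) * r6 + (264) * r7 + (12) * r8 + (-120) * r9 + (-108) * r10 + (24) * r12 + (24) * Hz p (p - 1) [1, 4] * z1 + (-264) * r13 + (-264) * Hz p (p - 1) [4, 1] * z1 + (24) * r15 + (204) * r16 + (540) * r17 + (-117) * r18 + (-94) * r19 + (-94) * Hz p (p - 1) [2, 2] * z2 + (-180) * r20 + (-24) * r21 + (-24) * Hz p (p - 1) [5] * z1 + (70) * r22 + (70) * Hz p (p - 1) [4] * z2 + (24) * r23 + (-36) * r24 + (-36) * Hz p (p - 1) [3] * z3 + (-10) * z6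
  · have hD : ((144 : ℕ) : ZMod p) ≠ 0 := natCast_ne (by norm_num) (by omega)
    refine mul_left_cancel₀ hD ?_
    push_cast
    linear_combination (-144) * r0 + (-144) * (Hz p (p - 1) [2, 1] + b) * hb21 + (48) * r1 + (48) * Hz p (p - 1) [1, 1, 3] * z1 + (408) * r2 + (408) * Hz p (p - 1) [1, 3, 1] * z1 + (-240) * r3 + (-240) * Hz p (p - 1) [3, 1, 1] * z1 + (36) * r4 + (-36) * r5 + (12) * r6 + (-264) * r7 + (-12) * r8 + (120) * r9 + (108) * r10 + (-432) * r11 + (-432) * Hz p (p - 1) [3, 1] * z2 + (408) * r12 + (408) * Hz p (p - 1) [1, 4] * z1 + (264) * r13 + (264) * Hz p (p - 1) [4, 1] * z1 + (-24) * r15 + (-204) * r16 + (-540) * r17 + (225) * r18 + (22) * r19 + (22) * Hz p (p - 1) [2, 2] * z2 + (180) * r20 + (-408) * r21 + (-408) * Hz p (p - 1) [5] * z1 + (-430) * r22 + (-430) * Hz p (p - 1) [4] * z2 + (48) * r23 + (144) * r24 + (144) * Hz p (p - 1) [3] * z3 + (694) * z6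
  · have hD : ((144 : ℕ) : ZMod p) ≠ 0 := natCast_ne (by norm_num) (by omega)
    refine mul_left_cancel₀ hD ?_
    push_cast
    linear_combination (144) * r0 + (144) * (Hz p (p - 1) [2, 1] + b) * hb21 + (-48) * r1 + (-48) * Hz p (p - 1) [1, 1, 3] * z1 + (-408) * r2 + (-408) * Hz p (p - 1) [1, 3, 1] * z1 + (240) * r3 + (240) * Hz p (p - 1) [3, 1, 1] * z1 + (-36) * r4 + (36) * r5 + (-12) * r6 + (264) * r7 + (12) * r8 + (-120) * r9 + (-108) * r10 + (-1296) * r11 + (-1296) * Hz p (p - 1) [3, 1] * z2 + (1320) * r12 + (1320) * Hz p (p - 1) [1, 4] * z1 + (-264) * r13 + (-264) * Hz p (p - 1) [4, 1] * z1 + (-864) * r14 + (456) * r15 + (636) * r16 + (540) * r17 + (-9) * r18 + (-454) * r19 + (-454) * Hz p (p - 1) [2, 2] * z2 + (-180) * r20 + (-1320) * r21 + (-1320) * Hz p (p - 1) [5] * z1 + (-866) * r22 + (-866) * Hz p (p - 1) [4] * z2 + (240) * r23 + (288) * r24 + (288) * Hz p (p - 1) [3] * z3 + (1898) * z6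
  · have hD : ((48 : ℕ) : ZMod p) ≠ 0 := natCast_ne (by norm_num) (by omega)
    refine mul_left_cancel₀ hD ?_
    push_cast
    linear_combination (-144) * r0 + (-144) * (Hz p (p - 1) [2, 1] + b) * hb21 + (48) * r1 + (48) * Hz p (p - 1) [1, 1, 3] * z1 + (408) * r2 + (408) * Hz p (p - 1) [1, 3, 1] * z1 + (-240) * r3 + (-240) * Hz p (p - 1) [3, 1, 1] * z1 + (36) * r4 + (-36) * r5 + (12) * r6 + (-264) * r7 + (-12) * r8 + (120) * r9 + (108) * r10 + (-24) * r12 + (-24) * Hz p (p - 1) [1, 4] * z1 + (264) * r13 + (264) * Hz p (p - 1) [4, 1] * z1 + (-24) * r15 + (-204) * r16 + (-324) * r17 + (135) * r18 + (82) * r19 + (82) * Hz p (p - 1) [2, 2] * z2 + (108) * r20 + (24) * r21 + (24) * Hz p (p - 1) [5] * z1 + (-58) * r22 + (-58) * Hz p (p - 1) [4] * z2 + (-24) * r23 + (36) * r24 + (36) * Hz p (p - 1) [3] * z3 + (-2) * z6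
  · have hD : ((144 : ℕ) : ZMod p) ≠ 0 := natCast_ne (by norm_num) (by omega)
    refine mul_left_cancel₀ hD ?_
    push_cast
    linear_combination (144) * r0 + (144) * (Hz p (p - 1) [2, 1] + b) * hb21 + (-48) * r1 + (-48) * Hz p (p - 1) [1, 1, 3] * z1 + (-408) * r2 + (-408) * Hz p (p - 1) [1, 3, 1] * z1 + (240) * r3 + (240) * Hz p (p - 1) [3, 1, 1] * z1 + (-36) * r4 + (36) * r5 + (-12) * r6 + (264) * r7 + (12) * r8 + (-120) * r9 + (-108) * r10 + (1296) * r11 + (1296) * Hz p (p - 1) [3, 1] * z2 + (24) * r12 + (24) * Hz p (p - 1) [1, 4] * z1 + (1032) * r13 + (1032) * Hz p (p - 1) [4, 1] * z1 + (24) * r15 + (204) * r16 + (-324) * r17 + (-225) * r18 + (-22) * r19 + (-22) * Hz p (p - 1) [2, 2] * z2 + (-180) * r20 + (-24) * r21 + (-24) * Hz p (p - 1) [5] * z1 + (-2) * r22 + (-2) * Hz p (p - 1) [4] * z2 + (-192) * r23 + (-360) * r24 + (-360) * Hz p (p - 1) [3] * z3 + (386) * z6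
  · have hD : ((36 : ℕ) : ZMod p) ≠ 0 := natCast_ne (by norm_num) (by omega)
    refine mul_left_cancel₀ hD ?_
    push_cast
    linear_combination (72) * r0 + (72) * (Hz p (p - 1) [2, 1] + b) * hb21 + (-24) * r1 + (-24) * Hz p (p - 1) [1, 1, 3] * z1 + (-204) * r2 + (-204) * Hz p (p - 1) [1, 3, 1] * z1 + (120) * r3 + (120) * Hz p (p - 1) [3, 1, 1] * z1 + (-18) * r4 + (18) * r5 + (-6) * r6 + (132) * r7 + (6) * r8 + (-60) * r9 + (-54) * r10 + (-324) * r11 + (-324) * Hz p (p - 1) [3, 1] * z2 + (12) * r12 + (12) * Hz p (p - 1) [1, 4] * z1 + (-456) * r13 + (-456) * Hz p (p - 1) [4, 1] * z1 + (12) * r15 + (102) * r16 + (324) * r17 + (9) * r18 + (-92) * r19 + (-92) * Hz p (p - 1) [2, 2] * z2 + (-36) * r20 + (-12) * r21 + (-12) * Hz p (p - 1) [5] * z1 + (80) * r22 + (80) * Hz p (p - 1) [4] * z2 + (66) * r23 + (63) * r24 + (63) * Hz p (p - 1) [3] * z3 + (-131) * z6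
  · have hD : ((144 : ℕ) : ZMod p) ≠ 0 := natCast_ne (by norm_num) (by omega)
    refine mul_left_cancel₀ hD ?_
    push_cast
    linear_combination (-144) * r0 + (-144) * (Hz p (p - 1) [2, 1] + b) * hb21 + (48) * r1 + (48) * Hz p (p - 1) [1, 1, 3] * z1 + (408) * r2 + (408) * Hz p (p - 1) [1, 3, 1] * z1 + (-240) * r3 + (-240) * Hz p (p - 1) [3, 1, 1] * z1 + (36) * r4 + (-36) * r5 + (12) * r6 + (-264) * r7 + (-12) * r8 + (120) * r9 + (108) * r10 + (432) * r11 + (432) * Hz p (p - 1) [3, 1] * z2 + (-24) * r12 + (-24) * Hz p (p - 1) [1, 4] * z1 + (696) * r13 + (696) * Hz p (p - 1) [4, 1] * z1 + (-24) * r15 + (-204) * r16 + (-540) * r17 + (9) * r18 + (166) * r19 + (166) * Hz p (p - 1) [2, 2] * z2 + (180) * r20 + (24) * r21 + (24) * Hz p (p - 1) [5] * z1 + (-142) * r22 + (-142) * Hz p (p - 1) [4] * z2 + (-96) * r23 + (-72) * r24 + (-72) * Hz p (p - 1) [3] * z3 + (190) * z6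
  · have hD : ((36 : ℕ) : ZMod p) ≠ 0 := natCast_ne (by norm_num) (by omega)
    refine mul_left_cancel₀ hD ?_
    push_cast
    linear_combination (72) * r0 + (72) * (Hz p (p - 1) [2, 1] + b) * hb21 + (-24) * r1 + (-24) * Hz p (p - 1) [1, 1, 3] * z1 + (-204) * r2 + (-204) * Hz p (p - 1) [1, 3, 1] * z1 + (120) * r3 + (120) * Hz p (p - 1) [3, 1, 1] * z1 + (-18) * r4 + (18) * r5 + (-6) * r6 + (132) * r7 + (6) * r8 + (-60) * r9 + (-54) * r10 + (324) * r11 + (324) * Hz p (p - 1) [3, 1] * z2 + (-312) * r12 + (-312) * Hz p (p - 1) [1, 4] * z1 + (-132) * r13 + (-132) * Hz p (p - 1) [4, 1] * z1 + (216) * r14 + (12) * r15 + (-6) * r16 + (108) * r17 + (-99) * r18 + (16) * r19 + (16) * Hz p (p - 1) [2, 2] * z2 + (-36) * r20 + (312) * r21 + (312) * Hz p (p - 1) [5] * z1 + (296) * r22 + (296) * Hz p (p - 1) [4] * z2 + (-42) * r23 + (-99) * r24 + (-99) * Hz p (p - 1) [3] * z3 + (-509) * z6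

theorem amhs_modEq (p : ℕ) [Fact p.Prime] (hp : 10000 ≤ p) (b : ZMod p)
    (hb : Red p (bernoulli (p - 3)) b) (l : List ℕ) (k : ℤ) (c : ℚ) (hc : c = k * 3 / 2)
    (h : 6 * Hz p (p - 1) l = k * b ^ 2) :
    RatModEq p 1 (AMHS (p - 1) (posComp l)) (c * (bernoulli (p - 3) / 3) ^ 2) := by
  have h6 : ((6 : ℕ) : ZMod p) ≠ 0 := natCast_ne (by norm_num) (by omega)
  have e : c * (bernoulli (p - 3) / 3) ^ 2 = (k : ℚ) * bernoulli (p - 3) ^ 2 / ((6 : ℕ) : ℚ) := by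
    rw [hc]; push_cast; ring
  rw [e]
  refine Red.modEq (red_AMHS (p - 1) l (by omega)) ?_
  have := ((Red.int (p := p) k).mul (hb.pow 2)).div (Red.nat 6) h6
  rw [← h] at this
  convert this using 1
  push_cast at h6 ⊢
  field_simp

theorem star_modEq (p : ℕ) [Fact p.Prime] (hp : 10000 ≤ p) (a b c : ℕ)
    (h1 : Hz p (p - 1) [a + b, c] = 0) (h2 : Hz p (p - 1) [a, b + c] = 0)
    (h3 : Hz p (p - 1) [a + b + c] = 0) :
    RatModEq p 1 (AMHSstar (p - 1) (posComp [a, b, c])) (AMHS (p - 1) (posComp [a, b, c])) := by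
  have hlt : p - 1 < p := by omega
  refine Red.modEq (z := Hz p (p - 1) [a, b, c]) ?_ (red_AMHS (p - 1) _ hlt)
  rw [amhsStar_three]
  have := (((red_AMHS (p - 1) [a, b, c] hlt).add (red_AMHS (p - 1) [a + b, c] hlt)).add
    (red_AMHS (p - 1) [a, b + c] hlt)).add (red_AMHS (p - 1) [a + b + c] hlt)
  simpa [h1, h2, h3] using this

/-- Theorem `thm:wt6FMZV`: FMZVs of superbity 1, depth 3, weight 6.
For all sufficiently large primes `p`, with `β = B_{p-3}/3`, modulo `p`:
`H(1,3,2) ≡ -9β²/2`, `H(1,4,1) ≡ 3β²`, `H(1,1,4) ≡ -3β²/2`, `H(2,1,3) ≡ 3β²/2`,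
`H(2,3,1) ≡ -9β²/2`, `H(3,1,2) ≡ 3β²/2`, `H(3,2,1) ≡ 3β²`, `H(4,1,1) ≡ -3β²/2`,
`H(1,2,3) ≡ 3β²`, and `H⋆(𝐬) ≡ H(𝐬)` for each listed `𝐬`
(sums with upper index `p-1`). -/
theorem weight_six_depth_three :
    ∃ N, ∀ p ≥ N, Nat.Prime p →
      (RatModEq p 1 (AMHS (p - 1) (posComp [1, 3, 2]))
          (-(9 / 2) * (bernoulli (p - 3) / 3) ^ 2) ∧
        RatModEq p 1 (AMHS (p - 1) (posComp [1, 4, 1])) (3 * (bernoulli (p - 3) / 3) ^ 2) ∧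
        RatModEq p 1 (AMHS (p - 1) (posComp [1, 1, 4]))
          (-(3 / 2) * (bernoulli (p - 3) / 3) ^ 2) ∧
        RatModEq p 1 (AMHS (p - 1) (posComp [2, 1, 3])) ((3 / 2) * (bernoulli (p - 3) / 3) ^ 2) ∧
        RatModEq p 1 (AMHS (p - 1) (posComp [2, 3, 1]))
          (-(9 / 2) * (bernoulli (p - 3) / 3) ^ 2) ∧
        RatModEq p 1 (AMHS (p - 1) (posComp [3, 1, 2])) ((3 / 2) * (bernoulli (p - 3) / 3) ^ 2) ∧
        RatModEq p 1 (AMHS (p - 1) (posComp [3, 2, 1])) (3 * (bernoulli (p - 3) / 3) ^ 2) ∧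
        RatModEq p 1 (AMHS (p - 1) (posComp [4, 1, 1]))
          (-(3 / 2) * (bernoulli (p - 3) / 3) ^ 2) ∧
        RatModEq p 1 (AMHS (p - 1) (posComp [1, 2, 3])) (3 * (bernoulli (p - 3) / 3) ^ 2)) ∧
      (∀ l ∈ [[1, 3, 2], [1, 4, 1], [1, 1, 4], [2, 1, 3], [2, 3, 1], [3, 1, 2],
          [3, 2, 1], [4, 1, 1], [1, 2, 3]],
        RatModEq p 1 (AMHSstar (p - 1) (posComp l)) (AMHS (p - 1) (posComp l))) := by
  refine ⟨10000, fun p hp hprime => ?_⟩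
  have : Fact p.Prime := ⟨hprime⟩
  obtain ⟨b, hb⟩ := red_bernoulli p (p - 3) (by omega)
  obtain ⟨d15, d24, d33, d42, d51, t132, t141, t114, t213, t231, t312, t321, t411, t123⟩ :=
    core_relations p hp b (Hz_one_two p (by omega) b hb)
  have z6 := Hz_one p 6 (by norm_num) (by omega)
  refine ⟨⟨?_, ?_, ?_, ?_, ?_, ?_, ?_, ?_, ?_⟩, ?_⟩
  · exact amhs_modEq p hp b hb _ (-3) _ (by norm_num) (by rw [t132]; push_cast; ring)
  · exact amhs_modEq p hp b hb _ 2 _ (by norm_num) (by rw [t141]; push_cast; ring)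
  · exact amhs_modEq p hp b hb _ (-1) _ (by norm_num) (by rw [t114]; push_cast; ring)
  · exact amhs_modEq p hp b hb _ 1 _ (by norm_num) (by rw [t213]; push_cast; ring)
  · exact amhs_modEq p hp b hb _ (-3) _ (by norm_num) (by rw [t231]; push_cast; ring)
  · exact amhs_modEq p hp b hb _ 1 _ (by norm_num) (by rw [t312]; push_cast; ring)
  · exact amhs_modEq p hp b hb _ 2 _ (by norm_num) (by rw [t321]; push_cast; ring)
  · exact amhs_modEq p hp b hb _ (-1) _ (by norm_num) (by rw [t411]; push_cast; ring)
  · exact amhs_modEq p hp b hb _ 2 _ (by norm_num) (by rw [t123]; push_cast; ring)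
  · intro l hl
    simp only [List.mem_cons, List.not_mem_nil, or_false] at hl
    rcases hl with rfl | rfl | rfl | rfl | rfl | rfl | rfl | rfl | rfl <;>
      exact star_modEq p hp _ _ _ (by assumption) (by assumption) (by assumption)
end
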